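/- Let α = (α,…,α,α₁,…,α_r) with k > 1 copies of α and α < α_i for all i, β = (α₁,…,α_r). Then σ_α(x) = α x^{1/α}(log log x)^{k-1}/((k-1)! log x) · ∑_{m ∈ 𝒫_β^σ} m^{-1/α} + O(x^{1/α}(log log x)^{k-2}/log x). -/

import Mathlib

open Filter Asymptotics Real

/-- The set of integers expressible as `p₁^{β 0} ⋯ p_r^{β (r-1)}` for primes `pᵢ`
(repetitions allowed). -/
def Psigma {r : ℕ} (β : Fin r → ℕ) : Set ℕ :=
  {n | ∃ p : Fin r → ℕ, (∀ i, (p i).Prime) ∧ n = ∏ i, p i ^ β i}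

/-- The set of integers expressible as `p₁^{β 0} ⋯ p_r^{β (r-1)}` for pairwise distinct
primes `pᵢ`. -/
def Ppi {r : ℕ} (β : Fin r → ℕ) : Set ℕ :=
  {n | ∃ p : Fin r → ℕ, (∀ i, (p i).Prime) ∧ Function.Injective p ∧ n = ∏ i, p i ^ β i}

/-- The number of `n ∈ S` with `n ≤ x`. -/
noncomputable def countIn (S : Set ℕ) (x : ℝ) : ℕ :=
  Nat.card {n : ℕ | (n : ℝ) ≤ x ∧ n ∈ S}

section ZetaBounds

/-- The `n`-th term of the series for `(s - 1) ζ(s) - 1` converging on `0 < re s`. -/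
noncomputable def zetaTerm (n : ℕ) (s : ℂ) : ℂ :=
  (s - 1) * ((n + 1 : ℝ) : ℂ) ^ (-s) + ((n + 2 : ℝ) : ℂ) ^ (1 - s) - ((n + 1 : ℝ) : ℂ) ^ (1 - s)

lemma norm_cpow_neg_sub_le {a x : ℝ} (ha : 0 < a) (hx : x ∈ Set.Icc a (a + 1)) {s : ℂ}
    (hs : 0 < s.re) :
    ‖(x : ℂ) ^ (-s) - (a : ℂ) ^ (-s)‖ ≤ ‖s‖ * a ^ (-(s.re + 1)) := by
  have hs0 : -s ≠ 0 := by
    intro h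
    have : s = 0 := by simpa using h
    simp [this] at hs
  have key := norm_image_sub_le_of_norm_deriv_le_segment' (f := fun y : ℝ => (y : ℂ) ^ (-s))
    (f' := fun y : ℝ => -s * (y : ℂ) ^ (-s - 1)) (a := a) (b := a + 1)
    (C := ‖s‖ * a ^ (-(s.re + 1)))
    (fun y hy => (hasDerivAt_ofReal_cpow_const (by linarith [hy.1]) hs0).hasDerivWithinAt)
    (fun y hy => by
      have hy0 : 0 < y := by linarith [hy.1]
      rw [norm_mul, norm_neg, Complex.norm_cpow_eq_rpow_re_of_pos hy0]
      gcongr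
      have : (-s - 1).re = -(s.re + 1) := by simp; ring
      rw [this]
      exact rpow_le_rpow_of_nonpos ha hy.1 (by linarith)) x hx
  refine key.trans ?_
  have : 0 ≤ ‖s‖ * a ^ (-(s.re + 1)) := by positivity
  nlinarith [hx.2]

lemma norm_zetaTerm_le (n : ℕ) {s : ℂ} (hs : 0 < s.re) :
    ‖zetaTerm n s‖ ≤ ‖s - 1‖ * ‖s‖ * (n + 1 : ℝ) ^ (-(s.re + 1)) := by
  by_cases hs1 : s = 1
  · simp [zetaTerm, hs1]
  have ha : (0 : ℝ) < n + 1 := by positivity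
  have h1s : 1 - s ≠ 0 := fun h => hs1 (sub_eq_zero.mp h).symm
  have key := norm_image_sub_le_of_norm_deriv_le_segment'
    (f := fun y : ℝ => (y : ℂ) ^ (1 - s) - (1 - s) * ((n + 1 : ℝ) : ℂ) ^ (-s) * y)
    (f' := fun y : ℝ => (1 - s) * (y : ℂ) ^ (1 - s - 1) - (1 - s) * ((n + 1 : ℝ) : ℂ) ^ (-s) * 1)
    (a := (n + 1 : ℝ)) (b := n + 1 + 1)
    (C := ‖s - 1‖ * ‖s‖ * (n + 1 : ℝ) ^ (-(s.re + 1)))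
    (fun y hy => ((hasDerivAt_ofReal_cpow_const (by linarith [hy.1]) h1s).sub
      ((Complex.ofRealCLM.hasDerivAt (x := y)).const_mul _)).hasDerivWithinAt)
    (fun y hy => by
      have : (1 - s) * (y : ℂ) ^ (1 - s - 1) - (1 - s) * ((n + 1 : ℝ) : ℂ) ^ (-s) * 1
          = (1 - s) * ((y : ℂ) ^ (-s) - ((n + 1 : ℝ) : ℂ) ^ (-s)) := by
        rw [show (1 : ℂ) - s - 1 = -s by ring]; ring
      rw [this, norm_mul, norm_sub_rev, mul_assoc]
      gcongr
      exact norm_cpow_neg_sub_le ha ⟨hy.1, hy.2.le⟩ hs) (n + 1 + 1)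
      ⟨by linarith, le_rfl⟩
  have e : zetaTerm n s = ((n + 1 + 1 : ℝ) : ℂ) ^ (1 - s)
      - (1 - s) * ((n + 1 : ℝ) : ℂ) ^ (-s) * (n + 1 + 1 : ℝ)
      - (((n + 1 : ℝ) : ℂ) ^ (1 - s) - (1 - s) * ((n + 1 : ℝ) : ℂ) ^ (-s) * (n + 1 : ℝ)) := by
    rw [zetaTerm, show (n + 1 + 1 : ℝ) = n + 2 by ring]
    push_cast
    ring
  rw [e]
  refine key.trans (le_of_eq (by ring))

lemma differentiable_zetaTerm (n : ℕ) : Differentiable ℂ (zetaTerm n) := by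
  have h1 : ((n + 1 : ℝ) : ℂ) ≠ 0 := by exact_mod_cast (by positivity : (n + 1 : ℝ) ≠ 0)
  have h2 : ((n + 2 : ℝ) : ℂ) ≠ 0 := by exact_mod_cast (by positivity : (n + 2 : ℝ) ≠ 0)
  intro s
  unfold zetaTerm
  refine DifferentiableAt.sub (DifferentiableAt.add (DifferentiableAt.mul (by fun_prop) ?_) ?_) ?_
  · exact DifferentiableAt.const_cpow (by fun_prop) (Or.inl h1)
  · exact DifferentiableAt.const_cpow (by fun_prop) (Or.inl h2)
  · exact DifferentiableAt.const_cpow (by fun_prop) (Or.inl h1)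

lemma summable_nat_add_one_rpow {a : ℝ} (ha : a < -1) :
    Summable fun n : ℕ => (n + 1 : ℝ) ^ a := by
  have := (summable_nat_add_iff 1).mpr (Real.summable_nat_rpow.mpr ha)
  simpa using this

lemma riemannZeta₁_eq_tsum_of_one_lt_re {s : ℂ} (hs : 1 < s.re) :
    riemannZeta₁ s = 1 + ∑' n, zetaTerm n s := by
  have hs1 : s ≠ 1 := by rintro rfl; simp at hs
  have hz : HasSum (fun n : ℕ => ((n + 1 : ℝ) : ℂ) ^ (-s)) (riemannZeta s) := by
    rw [zeta_eq_tsum_one_div_nat_add_one_cpow hs]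
    have : Summable fun n : ℕ => 1 / ((n : ℂ) + 1) ^ s := by
      have := (summable_nat_add_iff 1).mpr (Complex.summable_one_div_nat_cpow.mpr hs)
      simpa using this
    convert this.hasSum using 2 with n
    rw [Complex.cpow_neg]; simp
  have hsum : Summable fun n => zetaTerm n s := by
    refine Summable.of_norm_bounded ?_ (fun n => norm_zetaTerm_le n (by linarith))
    exact (summable_nat_add_one_rpow (by linarith)).mul_left _
  have hpart : ∀ N, ∑ n ∈ Finset.range N, zetaTerm n s =
      (s - 1) * ∑ n ∈ Finset.range N, ((n + 1 : ℝ) : ℂ) ^ (-s)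
        + ((N + 1 : ℝ) : ℂ) ^ (1 - s) - 1 := by
    intro N
    induction N with
    | zero => simp
    | succ N ih =>
      rw [Finset.sum_range_succ, ih, Finset.sum_range_succ, zetaTerm]
      have : ((N + 1 : ℕ) : ℝ) + 1 = N + 2 := by push_cast; ring
      rw [this]; ring
  have hlim0 : Tendsto (fun N : ℕ => ((N + 1 : ℝ) : ℂ) ^ (1 - s)) atTop (nhds 0) := by
    rw [tendsto_zero_iff_norm_tendsto_zero]
    have : ∀ N : ℕ, ‖((N + 1 : ℝ) : ℂ) ^ (1 - s)‖ = (N + 1 : ℝ) ^ (-(s.re - 1)) := fun N => by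
      rw [Complex.norm_cpow_eq_rpow_re_of_pos (by positivity)]; simp
    simp_rw [this]
    exact (tendsto_rpow_neg_atTop (by linarith)).comp
      (tendsto_atTop_add_const_right _ _ tendsto_natCast_atTop_atTop)
  have h1 := hsum.hasSum.tendsto_sum_nat
  have h2 : Tendsto (fun N => ∑ n ∈ Finset.range N, zetaTerm n s) atTop
      (nhds ((s - 1) * riemannZeta s + 0 - 1)) := by
    simp_rw [hpart]
    exact ((hz.tendsto_sum_nat.const_mul _).add hlim0).sub_const 1
  rw [tendsto_nhds_unique h1 h2, riemannZeta_eq_inv_sub_mul hs1]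
  field_simp [sub_ne_zero.mpr hs1]
  ring

lemma riemannZeta₁_eq_tsum {s : ℂ} (hs : 1 / 4 < s.re) :
    riemannZeta₁ s = 1 + ∑' n, zetaTerm n s := by
  set R := ‖s‖ + 3
  set U : Set ℂ := {z | 1 / 4 < z.re} ∩ Metric.ball 0 R
  have hUo : IsOpen U := (isOpen_lt continuous_const Complex.continuous_re).inter Metric.isOpen_ball
  have hUc : Convex ℝ U := (convex_halfSpace_re_gt _).inter (convex_ball _ _)
  have hd : DifferentiableOn ℂ (fun z => ∑' n, zetaTerm n z) U := by
    refine Complex.differentiableOn_tsum_of_summable_norm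
      (u := fun n : ℕ => (R + 1) * R * (n + 1 : ℝ) ^ (-(5 / 4 : ℝ)))
      ((summable_nat_add_one_rpow (by norm_num)).mul_left _)
      (fun n => (differentiable_zetaTerm n).differentiableOn) hUo fun n z hz => ?_
    have hz1 : 1 / 4 < z.re := hz.1
    have hz2 : ‖z‖ < R := by simpa using hz.2
    refine (norm_zetaTerm_le n (by linarith)).trans ?_
    have : ‖z - 1‖ ≤ R + 1 := (norm_sub_le _ _).trans (by simp; linarith)
    have h3 : (n + 1 : ℝ) ^ (-(z.re + 1)) ≤ (n + 1 : ℝ) ^ (-(5 / 4 : ℝ)) :=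
      rpow_le_rpow_of_exponent_le (by linarith [n.cast_nonneg (α := ℝ)]) (by linarith)
    gcongr
  have hE := AnalyticOnNhd.eqOn_of_preconnected_of_eventuallyEq (𝕜 := ℂ) (U := U)
    (f := riemannZeta₁) (g := fun z => 1 + ∑' n, zetaTerm n z) (z₀ := 2)
    (differentiable_riemannZeta₁.differentiableOn.analyticOnNhd hUo)
    ((hd.const_add 1).analyticOnNhd hUo) hUc.isPreconnected
    ⟨by simp; norm_num, by simp [R]; linarith [norm_nonneg s]⟩ ?_
  · exact hE ⟨hs, by simp [R]⟩
  · have : {z : ℂ | 1 < z.re} ∈ nhds (2 : ℂ) :=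
      (isOpen_lt continuous_const Complex.continuous_re).mem_nhds (by simp)
    filter_upwards [this] with z hz using riemannZeta₁_eq_tsum_of_one_lt_re hz

/-- Polynomial growth of `(s - 1) ζ(s)`. -/
lemma exists_norm_riemannZeta₁_le :
    ∃ C : ℝ, 0 < C ∧ ∀ s : ℂ, 1 / 2 ≤ s.re → ‖riemannZeta₁ s‖ ≤ C * (1 + ‖s‖) ^ 2 := by
  set S : ℝ := ∑' n : ℕ, (n + 1 : ℝ) ^ (-(3 / 2 : ℝ))
  have hsum : Summable fun n : ℕ => (n + 1 : ℝ) ^ (-(3 / 2 : ℝ)) :=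
    summable_nat_add_one_rpow (by norm_num)
  have hS : 0 ≤ S := tsum_nonneg fun n => by positivity
  refine ⟨1 + S, by positivity, fun s hs => ?_⟩
  have hb : ∀ n : ℕ, ‖zetaTerm n s‖ ≤ ‖s - 1‖ * ‖s‖ * (n + 1 : ℝ) ^ (-(3 / 2 : ℝ)) := fun n => by
    refine (norm_zetaTerm_le n (by linarith)).trans ?_
    have h3 : (n + 1 : ℝ) ^ (-(s.re + 1)) ≤ (n + 1 : ℝ) ^ (-(3 / 2 : ℝ)) :=
      rpow_le_rpow_of_exponent_le (by linarith [n.cast_nonneg (α := ℝ)]) (by linarith)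
    gcongr
  have h1 : ‖∑' n, zetaTerm n s‖ ≤ ‖s - 1‖ * ‖s‖ * S :=
    tsum_of_norm_bounded (hsum.hasSum.mul_left _) hb
  rw [riemannZeta₁_eq_tsum (by linarith)]
  have h2 : ‖s - 1‖ ≤ 1 + ‖s‖ := (norm_sub_le _ _).trans (by simp [add_comm])
  have h3 : ‖s - 1‖ * ‖s‖ ≤ (1 + ‖s‖) ^ 2 := by nlinarith [norm_nonneg s, norm_nonneg (s - 1)]
  calc ‖1 + ∑' n, zetaTerm n s‖ ≤ ‖(1 : ℂ)‖ + ‖∑' n, zetaTerm n s‖ := norm_add_le _ _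
    _ ≤ 1 + (1 + ‖s‖) ^ 2 * S := by
        rw [norm_one]; gcongr; exact h1.trans (by gcongr)
    _ ≤ (1 + S) * (1 + ‖s‖) ^ 2 := by nlinarith [norm_nonneg s]

/-- Cauchy's estimate carries a quadratic bound on a half-plane to the derivative. -/
lemma norm_deriv_le_of_quadratic_growth {f : ℂ → ℂ} (hf : Differentiable ℂ f) {C a : ℝ}
    (hC : 0 < C) (h : ∀ s : ℂ, a ≤ s.re → ‖f s‖ ≤ C * (1 + ‖s‖) ^ 2) {s : ℂ}
    (hs : a + 1 / 4 ≤ s.re) : ‖deriv f s‖ ≤ 16 * C * (1 + ‖s‖) ^ 2 := by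
  have key := Complex.norm_deriv_le_of_forall_mem_sphere_norm_le (c := s) (R := 1 / 4)
    (C := C * (2 * (1 + ‖s‖)) ^ 2) (f := f) (by norm_num) hf.diffContOnCl (fun z hz => ?_)
  · refine key.trans (le_of_eq (by ring))
  · have hz' : ‖z - s‖ = 1 / 4 := by simpa [dist_eq_norm] using hz
    have hre : |(z - s).re| ≤ 1 / 4 := hz' ▸ Complex.abs_re_le_norm _
    rw [Complex.sub_re] at hre
    have hn : ‖z‖ ≤ ‖s‖ + 1 / 4 := by
      have := norm_add_le (z - s) s
      rw [sub_add_cancel] at this; linarith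
    refine (h z (by linarith [(abs_le.mp hre).1])).trans ?_
    gcongr
    linarith [norm_nonneg s]

lemma norm_le_of_re_mem {x y : ℝ} (hx0 : 0 ≤ x) (hx1 : x ≤ 1) :
    1 + ‖(1 + x + Complex.I * y : ℂ)‖ ≤ 3 * (1 + |y|) := by
  have h : ‖(1 + x + Complex.I * y : ℂ)‖ ≤ ‖((1 + x : ℝ) : ℂ)‖ + ‖Complex.I * (y : ℂ)‖ := by
    refine (le_of_eq ?_).trans (norm_add_le _ _)
    push_cast; rfl
  rw [norm_mul, Complex.norm_I, Complex.norm_real, Complex.norm_real, norm_eq_abs, norm_eq_abs,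
    abs_of_nonneg (by linarith : 0 ≤ 1 + x)] at h
  linarith [abs_nonneg y]

/-- Polynomial bounds for `(s - 1) ζ(s)` and its first two derivatives on `1 ≤ re s ≤ 2`. -/
lemma exists_bound_riemannZeta₁_deriv :
    ∃ C : ℝ, 1 ≤ C ∧ ∀ x y : ℝ, 0 ≤ x → x ≤ 1 →
      ‖riemannZeta₁ (1 + x + Complex.I * y)‖ ≤ C * (1 + |y|) ^ 2 ∧
      ‖deriv riemannZeta₁ (1 + x + Complex.I * y)‖ ≤ C * (1 + |y|) ^ 2 ∧
      ‖deriv (deriv riemannZeta₁) (1 + x + Complex.I * y)‖ ≤ C * (1 + |y|) ^ 2 := by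
  obtain ⟨C, hC, h0⟩ := exists_norm_riemannZeta₁_le
  have h1 : ∀ s : ℂ, 3 / 4 ≤ s.re → ‖deriv riemannZeta₁ s‖ ≤ 16 * C * (1 + ‖s‖) ^ 2 :=
    fun s hs => norm_deriv_le_of_quadratic_growth differentiable_riemannZeta₁ hC h0 (by linarith)
  have hd : Differentiable ℂ (deriv riemannZeta₁) := by
    have := differentiable_riemannZeta₁.contDiff (n := 2)
    exact this.differentiable_deriv_two
  have h2 : ∀ s : ℂ, 1 ≤ s.re → ‖deriv (deriv riemannZeta₁) s‖ ≤ 16 * (16 * C) * (1 + ‖s‖) ^ 2 :=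
    fun s hs => norm_deriv_le_of_quadratic_growth hd (by positivity) h1 (by linarith)
  refine ⟨16 * (16 * C) * 9 + 1, by linarith, fun x y hx0 hx1 => ?_⟩
  have hre : (1 + x + Complex.I * y : ℂ).re = 1 + x := by simp
  have hn := norm_le_of_re_mem (y := y) hx0 hx1
  set s : ℂ := 1 + x + Complex.I * y
  have hsq : (1 + ‖s‖) ^ 2 ≤ 9 * (1 + |y|) ^ 2 := by
    nlinarith [norm_nonneg s, abs_nonneg y]
  have hX : 0 ≤ (1 + |y|) ^ 2 := by positivity
  refine ⟨(h0 s (by linarith)).trans ?_, (h1 s (by linarith)).trans ?_,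
    (h2 s (by linarith)).trans ?_⟩ <;> nlinarith [mul_le_mul_of_nonneg_left hsq hC.le]

lemma riemannZeta₁_ne_zero_of_one_le_re {s : ℂ} (hs : 1 ≤ s.re) : riemannZeta₁ s ≠ 0 := by
  by_cases h1 : s = 1
  · simp [h1]
  · intro h
    have := riemannZeta_ne_zero_of_one_le_re hs
    rw [riemannZeta_eq_inv_sub_mul h1, h, mul_zero] at this
    exact this rfl

lemma riemannZeta_three_four_one {x : ℝ} (hx : 0 < x) (y : ℝ) :
    1 ≤ ‖riemannZeta (1 + x)‖ ^ 3 * ‖riemannZeta (1 + x + Complex.I * y)‖ ^ 4 *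
      ‖riemannZeta (1 + x + Complex.I * (2 * y : ℝ))‖ := by
  have := DirichletCharacter.norm_LFunction_product_ge_one (1 : DirichletCharacter ℂ 1) hx y
  simp only [DirichletCharacter.LFunction_modOne_eq, norm_mul, norm_pow] at this
  convert this.le using 4
  push_cast; ring

/-- The lower bound coming from the `3-4-1` inequality. -/
lemma exists_le_norm_riemannZeta₁_pow_four :
    ∃ c : ℝ, 0 < c ∧ ∀ x y : ℝ, 0 < x → x ≤ 1 → 1 ≤ |y| →
      c * x ^ 3 ≤ ‖riemannZeta₁ (1 + x + Complex.I * y)‖ ^ 4 * (1 + |y|) ^ 2 := by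
  obtain ⟨C, hC, hb⟩ := exists_bound_riemannZeta₁_deriv
  refine ⟨(C ^ 3 * (4 * C))⁻¹, by positivity, fun x y hx0 hx1 hy => ?_⟩
  have h341 := riemannZeta_three_four_one hx0 y
  have hz : ∀ w : ℝ, riemannZeta (1 + x + Complex.I * w) =
      (x + Complex.I * w : ℂ)⁻¹ * riemannZeta₁ (1 + x + Complex.I * w) := fun w => by
    rw [riemannZeta_eq_inv_sub_mul]
    · congr 2; ring
    · intro h
      have := congrArg Complex.re h
      simp at this
      linarith
  have hb0 := (hb x 0 hx0.le hx1).1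
  have hb2 := (hb x (2 * y) hx0.le hx1).1
  have hz0 : ‖riemannZeta (1 + x)‖ ≤ C / x := by
    have := hz 0
    simp only [Complex.ofReal_zero, mul_zero, add_zero] at this hb0
    rw [this, norm_mul, norm_inv, Complex.norm_real, norm_eq_abs, abs_of_pos hx0, div_eq_inv_mul]
    gcongr
    simpa using hb0
  have hnorm : ∀ w : ℝ, 1 ≤ |w| → 1 ≤ ‖(x + Complex.I * w : ℂ)‖ := fun w hw => by
    refine hw.trans ?_
    simpa using Complex.abs_im_le_norm (x + Complex.I * w : ℂ)
  have hle : ∀ w : ℝ, 1 ≤ |w| → ‖riemannZeta (1 + x + Complex.I * w)‖ ≤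
      ‖riemannZeta₁ (1 + x + Complex.I * w)‖ := fun w hw => by
    rw [hz w, norm_mul, norm_inv]
    exact mul_le_of_le_one_left (norm_nonneg _) (inv_le_one_of_one_le₀ (hnorm w hw))
  have hy2 : 1 ≤ |2 * y| := by rw [abs_mul]; norm_num; linarith
  have h2 : ‖riemannZeta (1 + x + Complex.I * (2 * y : ℝ))‖ ≤ 4 * C * (1 + |y|) ^ 2 := by
    refine (hle _ hy2).trans (hb2.trans ?_)
    rw [abs_mul, abs_two]
    have : (1 + 2 * |y|) ^ 2 ≤ 4 * (1 + |y|) ^ 2 := by nlinarith [abs_nonneg y]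
    nlinarith
  have h4 := hle y hy
  set Z := ‖riemannZeta₁ (1 + x + Complex.I * y)‖
  have h5 : 1 ≤ (C / x) ^ 3 * Z ^ 4 * (4 * C * (1 + |y|) ^ 2) := by
    refine h341.trans ?_
    gcongr
  have hC0 : 0 < C := by linarith
  rw [inv_mul_le_iff₀ (by positivity)]
  have h6 : (C / x) ^ 3 * Z ^ 4 * (4 * C * (1 + |y|) ^ 2) =
      (C ^ 3 * (4 * C) * (Z ^ 4 * (1 + |y|) ^ 2)) / x ^ 3 := by
    field_simp
  rw [h6, le_div_iff₀ (by positivity), one_mul] at h5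
  exact h5

/-- A polynomial lower bound for `(s - 1) ζ(s)` on `1 < re s ≤ 2`. -/
lemma exists_le_norm_riemannZeta₁ :
    ∃ c : ℝ, 0 < c ∧ ∀ x y : ℝ, 0 < x → x ≤ 1 →
      c ≤ ‖riemannZeta₁ (1 + x + Complex.I * y)‖ * (1 + |y|) ^ 8 := by
  obtain ⟨c, hc, h4⟩ := exists_le_norm_riemannZeta₁_pow_four
  obtain ⟨C, hC, hb⟩ := exists_bound_riemannZeta₁_deriv
  have hC0 : 0 < C := by linarith
  -- the compact part `|y| ≤ 1`
  obtain ⟨c₁, hc₁, hcomp⟩ : ∃ c₁ : ℝ, 0 < c₁ ∧ ∀ x y : ℝ, 0 < x → x ≤ 1 → |y| ≤ 1 →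
      c₁ ≤ ‖riemannZeta₁ (1 + x + Complex.I * y)‖ := by
    have hK : IsCompact (Set.Icc (0 : ℝ) 1 ×ˢ Set.Icc (-1 : ℝ) 1) :=
      isCompact_Icc.prod isCompact_Icc
    have hcont : Continuous fun q : ℝ × ℝ => ‖riemannZeta₁ (1 + q.1 + Complex.I * q.2)‖ :=
      (differentiable_riemannZeta₁.continuous.comp (by fun_prop)).norm
    obtain ⟨q, hq, hmin⟩ := hK.exists_isMinOn ⟨(0, 0), by simp⟩ hcont.continuousOn
    refine ⟨_, norm_pos_iff.mpr (riemannZeta₁_ne_zero_of_one_le_re (s := 1 + q.1 + Complex.I * q.2)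
      (by simpa using hq.1.1)), fun x y hx0 hx1 hy => ?_⟩
    exact hmin (a := (x, y)) ⟨⟨hx0.le, hx1⟩, abs_le.mp hy⟩
  set η : ℝ := min 1 (c / (16 * C ^ 4))
  have hη : 0 < η := lt_min one_pos (by positivity)
  have hηc : 16 * C ^ 4 * η ≤ c := by
    have := min_le_right 1 (c / (16 * C ^ 4))
    rwa [le_div_iff₀ (by positivity), mul_comm] at this
  refine ⟨min c₁ (C * η), lt_min hc₁ (by positivity), fun x y hx0 hx1 => ?_⟩
  set X := 1 + |y| with hX
  have hX1 : 1 ≤ X := by simp [X]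
  rcases le_total |y| 1 with hy | hy
  · refine (min_le_left _ _).trans ((hcomp x y hx0 hx1 hy).trans ?_)
    exact le_mul_of_one_le_right (norm_nonneg _) (one_le_pow₀ hX1)
  refine (min_le_right _ _).trans ?_
  set x₀ : ℝ := η / X ^ 10 with hx₀
  have hx₀pos : 0 < x₀ := by positivity
  have hx₀1 : x₀ ≤ 1 :=
    div_le_one_of_le₀ ((min_le_left _ _).trans (one_le_pow₀ hX1)) (by positivity)
  have hlow : ∀ z : ℝ, x₀ ≤ z → z ≤ 1 →
      2 * (x₀ * (C * X ^ 2)) ≤ ‖riemannZeta₁ (1 + z + Complex.I * y)‖ := fun z hz0 hz1 => by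
    have h := h4 z y (hx₀pos.trans_le hz0) hz1 hy
    refine le_of_pow_le_pow_left₀ (n := 4) (by norm_num) (norm_nonneg _) ?_
    refine le_of_mul_le_mul_right ?_ (by positivity : 0 < X ^ 2)
    refine le_trans ?_ h
    calc (2 * (x₀ * (C * X ^ 2))) ^ 4 * X ^ 2
        = x₀ ^ 3 * (16 * C ^ 4 * (x₀ * X ^ 10)) := by ring
      _ = x₀ ^ 3 * (16 * C ^ 4 * η) := by rw [hx₀, div_mul_cancel₀]; positivity
      _ ≤ x₀ ^ 3 * c := by gcongr
      _ ≤ c * z ^ 3 := by rw [mul_comm]; gcongr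
  have hfin : x₀ * (C * X ^ 2) ≤ ‖riemannZeta₁ (1 + x + Complex.I * y)‖ := by
    rcases le_total x₀ x with hx | hx
    · have := hlow x hx hx1
      have : 0 ≤ x₀ * (C * X ^ 2) := by positivity
      linarith
    · have hz := hlow x₀ le_rfl hx₀1
      have hmv := norm_image_sub_le_of_norm_deriv_le_segment'
        (f := fun z : ℝ => riemannZeta₁ (1 + z + Complex.I * y))
        (f' := fun z : ℝ => deriv riemannZeta₁ (1 + z + Complex.I * y)) (a := x) (b := x₀)
        (C := C * X ^ 2)
        (fun z hz => by
          have h1 : HasDerivAt (fun z : ℝ => (1 + z + Complex.I * y : ℂ)) 1 z :=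
            ((Complex.ofRealCLM.hasDerivAt (x := z)).const_add 1).add_const _
          have h2 := (differentiable_riemannZeta₁ (1 + z + Complex.I * y)).hasDerivAt
          have h3 := (h2.comp z h1).hasDerivWithinAt (s := Set.Icc x x₀)
          rw [mul_one] at h3
          exact h3)
        (fun z hz => (hb z y (hx0.le.trans hz.1) (hz.2.le.trans hx₀1)).2.1) x₀ ⟨hx, le_rfl⟩
      have h3 : C * X ^ 2 * (x₀ - x) ≤ x₀ * (C * X ^ 2) := by
        have : 0 ≤ C * X ^ 2 := by positivity
        nlinarith
      have h4 := norm_sub_norm_le (riemannZeta₁ (1 + x₀ + Complex.I * y))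
        (riemannZeta₁ (1 + x + Complex.I * y))
      linarith
  calc C * η = x₀ * (C * X ^ 2) * X ^ 8 := by
        rw [hx₀]; field_simp
    _ ≤ _ := by gcongr

end ZetaBounds

section PsiMellin

open MeasureTheory

/-- The error `ψ(t) - t`, cut off to `t > 1`. -/
noncomputable def psiError (t : ℝ) : ℂ :=
  (Set.Ioi (1 : ℝ)).indicator (fun t => ((Chebyshev.psi t - t : ℝ) : ℂ)) t

lemma measurable_psi : Measurable Chebyshev.psi := Chebyshev.psi_mono.measurable

lemma measurable_psiError : Measurable psiError :=
  Measurable.indicator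
    (Complex.measurable_ofReal.comp (measurable_psi.sub measurable_id)) measurableSet_Ioi

lemma abs_psi_sub_le {t : ℝ} (ht : 0 ≤ t) : |Chebyshev.psi t - t| ≤ 6 * t := by
  have h1 := Chebyshev.psi_le_const_mul_self ht
  have h2 := Chebyshev.psi_nonneg t
  have h3 : log 4 ≤ 2 := by
    rw [show (4 : ℝ) = 2 ^ 2 by norm_num, Real.log_pow]
    have := Real.log_two_lt_d9
    push_cast; linarith
  rw [abs_le]
  constructor <;> nlinarith

lemma norm_psiError_le {t : ℝ} (ht : 0 ≤ t) : ‖psiError t‖ ≤ 6 * t := by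
  unfold psiError
  by_cases h : t ∈ Set.Ioi (1 : ℝ)
  · rw [Set.indicator_of_mem h, Complex.norm_real, norm_eq_abs]
    exact abs_psi_sub_le ht
  · rw [Set.indicator_of_notMem h, norm_zero]; positivity

lemma locallyIntegrableOn_psiError : LocallyIntegrableOn psiError (Set.Ioi 0) := by
  have h : LocallyIntegrable (fun t : ℝ => 6 * t) :=
    (by fun_prop : Continuous fun t : ℝ => 6 * t).locallyIntegrable
  refine (h.mono measurable_psiError.aestronglyMeasurable
    (Eventually.of_forall fun t => ?_)).locallyIntegrableOn _
  rcases le_or_gt 0 t with ht | ht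
  · exact (norm_psiError_le ht).trans (le_abs_self _)
  · rw [psiError, Set.indicator_of_notMem (by simp; linarith), norm_zero]
    exact norm_nonneg _

lemma integrableOn_psi_mul_cpow {s : ℂ} (hs : 1 < s.re) :
    IntegrableOn (fun t : ℝ => (Chebyshev.psi t : ℂ) * (t : ℂ) ^ (-(s + 1))) (Set.Ioi 1) := by
  have h : IntegrableOn (fun t : ℝ => (log 4 + 4) * t ^ (-s.re)) (Set.Ioi 1) :=
    (integrableOn_Ioi_rpow_of_lt (by linarith) one_pos).const_mul _
  refine h.mono' ?_ ?_
  · refine AEStronglyMeasurable.mul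
      (Complex.measurable_ofReal.comp measurable_psi).aestronglyMeasurable ?_
    exact (Complex.measurable_ofReal.pow_const _).aestronglyMeasurable
  · refine (ae_restrict_iff' measurableSet_Ioi).mpr (Eventually.of_forall fun t ht => ?_)
    have ht0 : (0 : ℝ) < t := lt_trans one_pos ht
    rw [norm_mul, Complex.norm_real, Complex.norm_cpow_eq_rpow_re_of_pos ht0, norm_eq_abs,
      abs_of_nonneg (Chebyshev.psi_nonneg t)]
    have e : t ^ (-s.re) = t * t ^ (-(s + 1)).re := by
      rw [← Real.rpow_one_add' ht0.le]
      · congr 1; simp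
      · simp; linarith
    rw [e, ← mul_assoc]
    gcongr
    exact Chebyshev.psi_le_const_mul_self ht0.le

lemma LSeries_vonMangoldt_eq_mul_integral_psi {s : ℂ} (hs : 1 < s.re) :
    LSeries (fun n => (ArithmeticFunction.vonMangoldt n : ℂ)) s =
      s * ∫ t in Set.Ioi (1 : ℝ), (Chebyshev.psi t : ℂ) * (t : ℂ) ^ (-(s + 1)) := by
  have hsum : ∀ t : ℝ, ∑ k ∈ Finset.Icc 1 ⌊t⌋₊, (ArithmeticFunction.vonMangoldt k : ℂ) =
      (Chebyshev.psi t : ℂ) := fun t => by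
    rw [Chebyshev.psi]
    push_cast
    rfl
  rw [LSeries_eq_mul_integral (r := 1) _ zero_le_one hs
    (ArithmeticFunction.LSeriesSummable_vonMangoldt hs)]
  · simp_rw [hsum]
  · refine IsBigO.of_bound (log 4 + 4) (Eventually.of_forall fun n => ?_)
    have := hsum n
    rw [Nat.floor_natCast] at this
    rw [this, Complex.norm_real, Real.rpow_one, norm_eq_abs, norm_eq_abs,
      abs_of_nonneg (Chebyshev.psi_nonneg _), Nat.abs_cast]
    exact Chebyshev.psi_le_const_mul_self n.cast_nonneg

lemma mellin_psiError {s : ℂ} (hs : 1 < s.re) :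
    mellin psiError (-s) = -((deriv riemannZeta₁ s / riemannZeta₁ s + 1) / s) := by
  have hs0 : s ≠ 0 := by rintro rfl; simp at hs; linarith
  have hs1 : s - 1 ≠ 0 := by
    intro h; rw [sub_eq_zero] at h; subst h; simp at hs
  have hZ : riemannZeta₁ s ≠ 0 := riemannZeta₁_ne_zero_of_one_le_re hs.le
  have h1 : mellin psiError (-s) = ∫ t in Set.Ioi (1 : ℝ),
      ((Chebyshev.psi t : ℂ) * (t : ℂ) ^ (-(s + 1)) - (t : ℂ) ^ (-s)) := by
    rw [mellin]
    have : ∀ t : ℝ, (t : ℂ) ^ (-s - 1) • psiError t = (Set.Ioi (1 : ℝ)).indicator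
        (fun t : ℝ => (t : ℂ) ^ (-s - 1) * ((Chebyshev.psi t - t : ℝ) : ℂ)) t := fun t => by
      by_cases h : t ∈ Set.Ioi (1 : ℝ) <;> simp [psiError, h]
    simp_rw [this]
    rw [setIntegral_indicator measurableSet_Ioi,
      Set.inter_eq_self_of_subset_right (Set.Ioi_subset_Ioi zero_le_one)]
    refine setIntegral_congr_fun measurableSet_Ioi fun t ht => ?_
    have ht0 : (t : ℂ) ≠ 0 := by exact_mod_cast (lt_trans one_pos ht : (0 : ℝ) < t).ne'
    have e : (t : ℂ) ^ (-s) = t * (t : ℂ) ^ (-(s + 1)) := by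
      rw [show -s = 1 + -(s + 1) by ring, Complex.cpow_add _ _ ht0, Complex.cpow_one]
    rw [e, show -s - 1 = -(s + 1) by ring]
    push_cast; ring
  have h2 : ∫ t in Set.Ioi (1 : ℝ), (t : ℂ) ^ (-s) = 1 / (s - 1) := by
    rw [integral_Ioi_cpow_of_lt (by simpa using hs) one_pos]
    rw [Complex.ofReal_one, Complex.one_cpow, neg_div, ← div_neg]
    congr 1; ring
  have h3 := LSeries_vonMangoldt_eq_mul_integral_psi hs
  rw [ArithmeticFunction.LSeries_vonMangoldt_eq_deriv_riemannZeta_div hs] at h3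
  have hne : s ≠ 1 := sub_ne_zero.mp hs1
  have h4 : deriv riemannZeta s = deriv (fun z => (z - 1)⁻¹ * riemannZeta₁ z) s := by
    refine EventuallyEq.deriv_eq ?_
    filter_upwards [isOpen_ne.mem_nhds hne] with z hz using riemannZeta_eq_inv_sub_mul hz
  have h5 : HasDerivAt (fun z => (z - 1)⁻¹ * riemannZeta₁ z)
      (-1 / (s - 1) ^ 2 * riemannZeta₁ s + (s - 1)⁻¹ * deriv riemannZeta₁ s) s :=
    (((hasDerivAt_id s).sub_const 1).inv hs1).mul (differentiable_riemannZeta₁ s).hasDerivAt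
  rw [h4, h5.deriv, riemannZeta_eq_inv_sub_mul hne] at h3
  rw [h1, integral_sub (integrableOn_psi_mul_cpow hs)
    (integrableOn_Ioi_cpow_of_lt (by simpa using hs) one_pos), h2]
  have h6 : ∫ t in Set.Ioi (1 : ℝ), (Chebyshev.psi t : ℂ) * (t : ℂ) ^ (-(s + 1)) =
      (-(-1 / (s - 1) ^ 2 * riemannZeta₁ s + (s - 1)⁻¹ * deriv riemannZeta₁ s) /
        ((s - 1)⁻¹ * riemannZeta₁ s)) / s := by
    rw [h3]; field_simp
  rw [h6]
  field_simp
  ring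

lemma isBigO_psiError_atTop : psiError =O[atTop] fun x : ℝ => x ^ (-(-1 : ℝ)) := by
  refine IsBigO.of_bound 6 ?_
  filter_upwards [eventually_ge_atTop (0 : ℝ)] with t ht
  rw [neg_neg, Real.rpow_one, norm_eq_abs, abs_of_nonneg ht]
  exact norm_psiError_le ht

lemma isBigO_psiError_nhdsGT (b : ℝ) :
    psiError =O[nhdsWithin 0 (Set.Ioi 0)] fun x : ℝ => x ^ (-b) := by
  refine IsBigO.of_bound 1 ?_
  have : Set.Iio (1 : ℝ) ∈ nhdsWithin (0 : ℝ) (Set.Ioi 0) :=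
    mem_nhdsWithin_of_mem_nhds (Iio_mem_nhds one_pos)
  filter_upwards [this] with t ht
  have : t ∉ Set.Ioi (1 : ℝ) := by simpa using ht.le
  rw [psiError, Set.indicator_of_notMem this, norm_zero]
  positivity

lemma mellin_log_smul_psiError {s : ℂ} (hs : 1 < s.re) :
    mellin (fun t => log t • psiError t) (-s) =
      (((deriv (deriv riemannZeta₁) s * riemannZeta₁ s -
          deriv riemannZeta₁ s * deriv riemannZeta₁ s)
        / riemannZeta₁ s ^ 2) * s - (deriv riemannZeta₁ s / riemannZeta₁ s + 1)) / s ^ 2 := by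
  have hs0 : s ≠ 0 := by rintro rfl; simp at hs; linarith
  have hZ : riemannZeta₁ s ≠ 0 := riemannZeta₁_ne_zero_of_one_le_re hs.le
  have hd : Differentiable ℂ (deriv riemannZeta₁) :=
    (differentiable_riemannZeta₁.contDiff (n := 2)).differentiable_deriv_two
  have h1 := (mellin_hasDerivAt_of_isBigO_rpow (s := -s) (b := (-s).re - 1)
    locallyIntegrableOn_psiError isBigO_psiError_atTop (by simpa using hs)
    (isBigO_psiError_nhdsGT _) (by linarith)).2
  have h2 : HasDerivAt (fun z => mellin psiError (-z))
      (mellin (fun t => log t • psiError t) (-s) * (-1)) s := h1.comp s (hasDerivAt_neg s)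
  have h3 : HasDerivAt (fun z => -((deriv riemannZeta₁ z / riemannZeta₁ z + 1) / z)) _ s :=
    (((((hd s).hasDerivAt.div (differentiable_riemannZeta₁ s).hasDerivAt hZ).add_const 1).div
      (hasDerivAt_id s) hs0)).neg
  have h4 : (fun z => mellin psiError (-z)) =ᶠ[nhds s]
      fun z => -((deriv riemannZeta₁ z / riemannZeta₁ z + 1) / z) := by
    filter_upwards [(isOpen_lt continuous_const Complex.continuous_re).mem_nhds hs] with z hz
      using mellin_psiError hz
  have h5 := h2.unique (h3.congr_of_eventuallyEq h4)
  rw [mul_neg_one, neg_inj] at h5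
  rw [h5]
  simp

lemma exists_norm_mellin_log_smul_psiError_le :
    ∃ C : ℝ, 0 < C ∧ ∀ x y : ℝ, 0 < x → x ≤ 1 →
      ‖mellin (fun t => log t • psiError t) (-(1 + x + Complex.I * y))‖ ≤ C * (1 + |y|) ^ 20 := by
  obtain ⟨c, hc, hlow⟩ := exists_le_norm_riemannZeta₁
  obtain ⟨C, hC, hb⟩ := exists_bound_riemannZeta₁_deriv
  have hC0 : 0 < C := by linarith
  refine ⟨C / c + (C / c) ^ 2 + C / c + 1, by positivity, fun x y hx0 hx1 => ?_⟩
  have hre : (1 + x + Complex.I * y : ℂ).re = 1 + x := by simp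
  have hl := hlow x y hx0 hx1
  obtain ⟨-, hb1, hb2⟩ := hb x y hx0.le hx1
  set s : ℂ := 1 + x + Complex.I * y
  set X := 1 + |y|
  have hX1 : 1 ≤ X := by simp [X]
  rw [mellin_log_smul_psiError (by linarith)]
  set Z := riemannZeta₁ s
  set Z' := deriv riemannZeta₁ s
  set Z'' := deriv (deriv riemannZeta₁) s
  have hZ : Z ≠ 0 := riemannZeta₁_ne_zero_of_one_le_re (by linarith)
  have hs1 : 1 ≤ ‖s‖ := by
    have := Complex.abs_re_le_norm s
    rw [hre, abs_of_pos (by linarith)] at this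
    linarith
  have hs0 : s ≠ 0 := norm_pos_iff.mp (by linarith)
  have hinv : ‖Z‖⁻¹ ≤ X ^ 8 / c := by
    rw [inv_le_iff_one_le_mul₀ (norm_pos_iff.mpr hZ), div_mul_eq_mul_div, le_div_iff₀ hc]
    linarith
  have hq1 : ‖Z' / Z‖ ≤ C / c * X ^ 10 := by
    rw [norm_div, div_eq_mul_inv]
    calc ‖Z'‖ * ‖Z‖⁻¹ ≤ C * X ^ 2 * (X ^ 8 / c) := by gcongr
      _ = _ := by ring
  have hq2 : ‖Z'' / Z‖ ≤ C / c * X ^ 10 := by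
    rw [norm_div, div_eq_mul_inv]
    calc ‖Z''‖ * ‖Z‖⁻¹ ≤ C * X ^ 2 * (X ^ 8 / c) := by gcongr
      _ = _ := by ring
  have e : ((Z'' * Z - Z' * Z') / Z ^ 2 * s - (Z' / Z + 1)) / s ^ 2 =
      (Z'' / Z - (Z' / Z) ^ 2) * s⁻¹ - (Z' / Z + 1) * (s⁻¹) ^ 2 := by
    field_simp
  have hsi : ‖s⁻¹‖ ≤ 1 := by rw [norm_inv]; exact inv_le_one_of_one_le₀ hs1
  have hX20 : X ^ 10 ≤ X ^ 20 := pow_le_pow_right₀ hX1 (by norm_num)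
  have hX0 : 1 ≤ X ^ 20 := one_le_pow₀ hX1
  rw [e]
  calc _ ≤ ‖(Z'' / Z - (Z' / Z) ^ 2) * s⁻¹‖ + ‖(Z' / Z + 1) * (s⁻¹) ^ 2‖ := norm_sub_le _ _
    _ ≤ (‖Z'' / Z‖ + ‖Z' / Z‖ ^ 2) * 1 + (‖Z' / Z‖ + 1) * 1 ^ 2 := by
        rw [norm_mul, norm_mul, norm_pow s⁻¹]
        gcongr
        · exact (norm_sub_le _ _).trans (by rw [norm_pow])
        · exact (norm_add_le _ _).trans (by rw [norm_one])
    _ ≤ (C / c * X ^ 10 + (C / c * X ^ 10) ^ 2) * 1 + (C / c * X ^ 10 + 1) * 1 ^ 2 := by gcongr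
    _ = C / c * X ^ 10 + (C / c) ^ 2 * X ^ 20 + C / c * X ^ 10 + 1 := by ring
    _ ≤ C / c * X ^ 20 + (C / c) ^ 2 * X ^ 20 + C / c * X ^ 20 + X ^ 20 := by gcongr
    _ = _ := by ring

end PsiMellin

section Smoothing

open MeasureTheory FourierTransform

/-- A Schwartz test function that is nonnegative, supported in `[-1, 1]` and of integral one. -/
structure IsSmoothingKernel (φ : ℝ → ℝ) (Φ : SchwartzMap ℝ ℂ) : Prop where
  coe_eq : ∀ u, Φ u = (φ u : ℂ)
  nonneg : ∀ u, 0 ≤ φ u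
  continuous : Continuous φ
  eq_zero : ∀ u, 1 < |u| → φ u = 0
  integral_eq_one : ∫ u, φ u = 1

lemma exists_isSmoothingKernel : ∃ φ Φ, IsSmoothingKernel φ Φ := by
  let b : ContDiffBump (0 : ℝ) := ⟨1 / 2, 1, by norm_num, by norm_num⟩
  have hc : HasCompactSupport fun u => ((b.normed volume u : ℝ) : ℂ) :=
    b.hasCompactSupport_normed.comp_left (g := fun r : ℝ => (r : ℂ)) (by simp)
  have hs : ContDiff ℝ (⊤ : ℕ∞) fun u => ((b.normed volume u : ℝ) : ℂ) :=
    Complex.ofRealCLM.contDiff.comp b.contDiff_normed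
  refine ⟨b.normed volume, hc.toSchwartzMap hs, fun u => rfl, fun u => b.nonneg_normed u,
    b.continuous_normed, fun u hu => ?_, b.integral_normed⟩
  have : u ∉ Function.support (b.normed volume) := by
    rw [b.support_normed_eq]
    simp only [Metric.mem_ball, dist_zero_right, norm_eq_abs, not_lt]
    exact hu.le
  simpa using this

lemma IsSmoothingKernel.integral_scaled {φ : ℝ → ℝ} {Φ : SchwartzMap ℝ ℂ}
    (h : IsSmoothingKernel φ Φ) {δ : ℝ} (hδ : 0 < δ) (v : ℝ) :
    ∫ w, φ ((v - w) / δ) / δ = 1 := by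
  have h1 : ∫ w, φ ((v - w) / δ) = ∫ w, φ (w / δ) :=
    integral_sub_left_eq_self (fun w => φ (w / δ)) volume v
  rw [integral_div, h1, Measure.integral_comp_div, h.integral_eq_one, abs_of_pos hδ]
  simp [hδ.ne']

/-- `psiError` with a logarithmic weight, in exponential coordinates and damped by `σ`. -/
noncomputable def dampedError (σ u : ℝ) : ℂ :=
  Real.exp ((1 + σ) * u) • (log (Real.exp (-u)) • psiError (Real.exp (-u)))

lemma dampedError_eq (σ u : ℝ) : dampedError σ u = Real.exp (σ * u) • dampedError 0 u := by
  unfold dampedError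
  rw [smul_smul (Real.exp (σ * u)), ← Real.exp_add]
  congr 2; ring

lemma dampedError_eq_zero {σ u : ℝ} (hu : 0 ≤ u) : dampedError σ u = 0 := by
  have : Real.exp (-u) ∉ Set.Ioi (1 : ℝ) := by simpa using hu
  simp [dampedError, psiError, this]

lemma measurable_dampedError (σ : ℝ) : Measurable (dampedError σ) := by
  unfold dampedError
  have h := measurable_psiError
  have h2 : Measurable fun u : ℝ => psiError (Real.exp (-u)) := h.comp (by fun_prop)
  have h1 : Measurable fun u : ℝ => Real.exp ((1 + σ) * u) := by fun_prop
  have h3 : Measurable fun u : ℝ => log (Real.exp (-u)) := by fun_prop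
  exact h1.smul (h3.smul h2)

lemma norm_dampedError_zero_le (u : ℝ) : ‖dampedError 0 u‖ ≤ 6 * |u| := by
  unfold dampedError
  rw [norm_smul, norm_smul, Real.log_exp, norm_eq_abs, norm_eq_abs, abs_neg,
    abs_of_pos (Real.exp_pos _)]
  calc Real.exp ((1 + 0) * u) * (|u| * ‖psiError (Real.exp (-u))‖)
      ≤ Real.exp ((1 + 0) * u) * (|u| * (6 * Real.exp (-u))) := by
        gcongr; exact norm_psiError_le (Real.exp_pos _).le
    _ = 6 * |u| * (Real.exp u * Real.exp (-u)) := by ring_nf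
    _ = 6 * |u| := by rw [← Real.exp_add]; simp

lemma integrable_dampedError {σ : ℝ} (hσ : 0 < σ) : Integrable (dampedError σ) := by
  have h : IntegrableOn (fun u : ℝ => 6 * (u * Real.exp (-σ * u))) (Set.Ioi 0) := by
    have := integrableOn_rpow_mul_exp_neg_mul_rpow (p := 1) (s := 1) (b := σ) (by norm_num)
      one_pos hσ
    have h2 : IntegrableOn (fun u : ℝ => 6 * (u ^ (1 : ℝ) * Real.exp (-σ * u ^ (1 : ℝ))))
      (Set.Ioi 0) := this.const_mul 6
    simpa only [rpow_one] using h2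
  suffices Integrable fun u => dampedError σ (-u) by simpa using this.comp_neg
  rw [← integrableOn_univ, ← Set.Ioi_union_Iic (a := (0 : ℝ))]
  refine IntegrableOn.union ?_ ?_
  · refine h.mono' ((measurable_dampedError σ).comp measurable_neg).aestronglyMeasurable ?_
    refine (ae_restrict_iff' measurableSet_Ioi).mpr (Eventually.of_forall fun u hu => ?_)
    rw [dampedError_eq, norm_smul, norm_eq_abs, abs_of_pos (Real.exp_pos _)]
    have := norm_dampedError_zero_le (-u)
    rw [abs_neg, abs_of_pos hu] at this
    calc _ ≤ Real.exp (σ * -u) * (6 * u) := by gcongr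
      _ = _ := by rw [neg_mul, mul_neg]; ring
  · exact integrableOn_zero.congr_fun
      (fun u hu => (dampedError_eq_zero (by simpa using hu)).symm) measurableSet_Iic

lemma exists_norm_fourier_dampedError_le :
    ∃ C : ℝ, 0 < C ∧ ∀ σ ξ : ℝ, 0 < σ → σ ≤ 1 →
      ‖𝓕 (dampedError σ) ξ‖ ≤ C * (1 + |2 * π * ξ|) ^ 20 := by
  obtain ⟨C, hC, h⟩ := exists_norm_mellin_log_smul_psiError_le
  refine ⟨C, hC, fun σ ξ h0 h1 => ?_⟩
  have := h σ (-(2 * π * ξ)) h0 h1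
  rw [mellin_eq_fourier, abs_neg] at this
  convert this using 3
  · ext u
    simp [dampedError]
  · simp

/-- The Fourier dual of the rescaled and translated kernel. -/
lemma IsSmoothingKernel.fourier_dual {φ : ℝ → ℝ} {Φ : SchwartzMap ℝ ℂ}
    (h : IsSmoothingKernel φ Φ) {δ : ℝ} (hδ : 0 < δ) (v u : ℝ) :
    𝓕 (fun ξ : ℝ => (𝐞 (-(v * ξ)) • (𝓕⁻ Φ : SchwartzMap ℝ ℂ) (δ * ξ) : ℂ)) u =
      ((φ ((v + u) / δ) / δ : ℝ) : ℂ) := by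
  have h1 : 𝓕 (𝓕⁻ Φ) ((v + u) / δ) = (φ ((v + u) / δ) : ℂ) := by
    rw [← h.coe_eq]; simp
  rw [SchwartzMap.fourier_coe, Real.fourier_real_eq] at h1
  have h2 := Measure.integral_comp_mul_left
    (fun w : ℝ => 𝐞 (-(w * ((v + u) / δ))) • (𝓕⁻ Φ) w) δ
  rw [h1] at h2
  rw [Real.fourier_real_eq]
  have h3 : ∀ ξ : ℝ, 𝐞 (-(ξ * u)) • 𝐞 (-(v * ξ)) • (𝓕⁻ Φ) (δ * ξ) =
      𝐞 (-(δ * ξ * ((v + u) / δ))) • (𝓕⁻ Φ) (δ * ξ) := fun ξ => by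
    rw [smul_smul, ← AddChar.map_add_eq_mul]
    congr 2
    field_simp
    ring
  simp_rw [h3]
  rw [h2, abs_of_pos (by positivity)]
  push_cast
  rw [Complex.real_smul]
  push_cast
  ring

lemma exists_norm_integral_dampedError_le {φ : ℝ → ℝ} {Φ : SchwartzMap ℝ ℂ}
    (h : IsSmoothingKernel φ Φ) :
    ∃ C : ℝ, 0 < C ∧ ∀ σ δ v : ℝ, 0 < σ → σ ≤ 1 → 0 < δ → δ ≤ 1 →
      ‖∫ u, dampedError σ u * ((φ ((v + u) / δ) / δ : ℝ) : ℂ)‖ ≤ C / δ ^ 21 := by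
  obtain ⟨C, hC, hF⟩ := exists_norm_fourier_dampedError_le
  set q : ℝ → ℝ := fun w => (1 + |2 * π * w|) ^ 20 * ‖(𝓕⁻ Φ) w‖
  have hq : Integrable q := by
    have h1 := (𝓕⁻ Φ : SchwartzMap ℝ ℂ).integrable_pow_mul volume 0
    have h2 := (𝓕⁻ Φ : SchwartzMap ℝ ℂ).integrable_pow_mul volume 20
    refine ((h1.add (h2.const_mul ((2 * π) ^ 20))).const_mul (2 ^ 19)).mono' ?_ ?_
    · refine Continuous.aestronglyMeasurable ?_
      have := (𝓕⁻ Φ : SchwartzMap ℝ ℂ).continuous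
      fun_prop
    · refine Eventually.of_forall fun w => ?_
      have h3 := add_pow_le zero_le_one (abs_nonneg (2 * π * w)) 20
      have h4 : |2 * π * w| ^ 20 = (2 * π) ^ 20 * ‖w‖ ^ 20 := by
        rw [abs_mul, mul_pow, abs_of_pos (by positivity), norm_eq_abs]
      rw [norm_eq_abs, abs_of_nonneg (by positivity)]
      calc q w ≤ 2 ^ 19 * (1 ^ 20 + |2 * π * w| ^ 20) * ‖(𝓕⁻ Φ : SchwartzMap ℝ ℂ) w‖ := by
            simp only [q]; gcongr
        _ = _ := by simp only [h4, Pi.add_apply]; ring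
  have hq0 : 0 ≤ ∫ w, q w := integral_nonneg fun w => by positivity
  refine ⟨C * (∫ w, q w) + 1, by positivity, fun σ δ v hσ0 hσ1 hδ0 hδ1 => ?_⟩
  set g : ℝ → ℂ := fun ξ => 𝐞 (-(v * ξ)) • (𝓕⁻ Φ) (δ * ξ)
  have hg : Integrable g := by
    have h1 : Integrable fun ξ => (𝓕⁻ Φ) (δ * ξ) := (𝓕⁻ Φ).integrable.comp_mul_left' hδ0.ne'
    refine h1.mono ?_ (Eventually.of_forall fun ξ => by simp [g, Circle.norm_smul])
    refine Continuous.aestronglyMeasurable ?_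
    have : Continuous fun ξ => (𝓕⁻ Φ) (δ * ξ) := (𝓕⁻ Φ).continuous.comp (by fun_prop)
    have h2 : Continuous fun ξ : ℝ => 𝐞 (-(v * ξ)) := Real.continuous_fourierChar.comp (by fun_prop)
    exact h2.smul this
  have key := VectorFourier.integral_fourierIntegral_smul_eq_flip (𝕜 := ℝ) (e := 𝐞)
    (L := innerₗ ℝ) (μ := volume) (ν := volume) (f := dampedError σ) (g := g)
    Real.continuous_fourierChar continuous_inner (integrable_dampedError hσ0) hg
  have e1 : ∫ u, dampedError σ u * ((φ ((v + u) / δ) / δ : ℝ) : ℂ) =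
      ∫ ξ, 𝓕 (dampedError σ) ξ • g ξ := by
    rw [show (∫ ξ, 𝓕 (dampedError σ) ξ • g ξ) = _ from key]
    refine integral_congr_ae (Eventually.of_forall fun u => ?_)
    simp only
    rw [← h.fourier_dual hδ0 v u, flip_innerₗ]
    rfl
  rw [e1]
  have hb : ∀ ξ, ‖𝓕 (dampedError σ) ξ • g ξ‖ ≤ C / δ ^ 20 * q (δ * ξ) := fun ξ => by
    have hgn : ‖g ξ‖ = ‖(𝓕⁻ Φ) (δ * ξ)‖ := by simp [g, Circle.norm_smul]
    rw [norm_smul, hgn]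
    have h1 : δ * (1 + |2 * π * ξ|) ≤ 1 + |2 * π * (δ * ξ)| := by
      have : |2 * π * (δ * ξ)| = δ * |2 * π * ξ| := by
        rw [show 2 * π * (δ * ξ) = δ * (2 * π * ξ) by ring, abs_mul, abs_of_pos hδ0]
      rw [this]; linarith
    have h2 : (1 + |2 * π * ξ|) ^ 20 ≤ (1 + |2 * π * (δ * ξ)|) ^ 20 / δ ^ 20 := by
      rw [le_div_iff₀ (by positivity), mul_comm, ← mul_pow]
      gcongr
    calc _ ≤ C * (1 + |2 * π * ξ|) ^ 20 * ‖(𝓕⁻ Φ) (δ * ξ)‖ := by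
          gcongr; exact hF σ ξ hσ0 hσ1
      _ ≤ C * ((1 + |2 * π * (δ * ξ)|) ^ 20 / δ ^ 20) * ‖(𝓕⁻ Φ) (δ * ξ)‖ := by gcongr
      _ = _ := by simp only [q]; ring
  have hqi : Integrable fun ξ => C / δ ^ 20 * q (δ * ξ) := (hq.comp_mul_left' hδ0.ne').const_mul _
  refine (norm_integral_le_of_norm_le hqi (Eventually.of_forall hb)).trans ?_
  rw [integral_const_mul, Measure.integral_comp_mul_left, abs_of_pos (by positivity), smul_eq_mul]
  calc C / δ ^ 20 * (δ⁻¹ * ∫ w, q w) = C * (∫ w, q w) / δ ^ 21 := by field_simp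
    _ ≤ _ := by gcongr; linarith

end Smoothing

section PrimeNumberTheorem

open MeasureTheory Chebyshev

variable {φ : ℝ → ℝ} {Φ : SchwartzMap ℝ ℂ}

lemma IsSmoothingKernel.scaled_eq_zero (h : IsSmoothingKernel φ Φ) {δ v w : ℝ} (hδ : 0 < δ)
    (hw : δ < |v - w|) : φ ((v - w) / δ) / δ = 0 := by
  rw [h.eq_zero _ (by rwa [abs_div, abs_of_pos hδ, one_lt_div hδ]), zero_div]

lemma IsSmoothingKernel.scaled_nonneg (h : IsSmoothingKernel φ Φ) {δ : ℝ} (hδ : 0 < δ) (v w : ℝ) :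
    0 ≤ φ ((v - w) / δ) / δ := div_nonneg (h.nonneg _) hδ.le

lemma IsSmoothingKernel.continuous_scaled (h : IsSmoothingKernel φ Φ) (δ v : ℝ) :
    Continuous fun w => φ ((v - w) / δ) / δ :=
  (h.continuous.comp (by fun_prop)).div_const _

lemma IsSmoothingKernel.integrable_mul_scaled (h : IsSmoothingKernel φ Φ) {δ : ℝ} (hδ : 0 < δ)
    (v : ℝ) {f : ℝ → ℝ} (hf : Continuous f) :
    Integrable fun w => f w * (φ ((v - w) / δ) / δ) := by
  refine Continuous.integrable_of_hasCompactSupport (hf.mul (h.continuous_scaled δ v)) ?_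
  refine HasCompactSupport.intro (K := Set.Icc (v - δ) (v + δ)) isCompact_Icc fun w hw => ?_
  rw [h.scaled_eq_zero hδ, mul_zero]
  by_contra! hc
  rw [abs_le] at hc
  exact hw ⟨by linarith, by linarith⟩

lemma exists_norm_integral_dampedError_zero_le (h : IsSmoothingKernel φ Φ) :
    ∃ C : ℝ, 0 < C ∧ ∀ δ v : ℝ, 0 < δ → δ ≤ 1 →
      ‖∫ w, dampedError 0 (-w) * ((φ ((v - w) / δ) / δ : ℝ) : ℂ)‖ ≤ C / δ ^ 21 := by
  obtain ⟨C, hC, hb⟩ := exists_norm_integral_dampedError_le h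
  refine ⟨C, hC, fun δ v h0 h1 => ?_⟩
  have hlim : Tendsto (fun n : ℕ => ∫ w, dampedError (1 / ((n : ℝ) + 1)) (-w) *
      ((φ ((v - w) / δ) / δ : ℝ) : ℂ)) atTop
      (nhds (∫ w, dampedError 0 (-w) * ((φ ((v - w) / δ) / δ : ℝ) : ℂ))) := by
    refine tendsto_integral_of_dominated_convergence
      (fun w => 6 * |w| * (φ ((v - w) / δ) / δ)) (fun n => ?_) ?_ (fun n => ?_) ?_
    · exact (((measurable_dampedError _).comp measurable_neg).mul
        (Complex.measurable_ofReal.comp (h.continuous_scaled δ v).measurable)).aestronglyMeasurable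
    · exact h.integrable_mul_scaled h0 v (by fun_prop)
    · refine Eventually.of_forall fun w => ?_
      rw [norm_mul, Complex.norm_real, norm_of_nonneg (h.scaled_nonneg h0 v w)]
      refine mul_le_mul_of_nonneg_right ?_ (h.scaled_nonneg h0 v w)
      rcases le_total w 0 with hw | hw
      · rw [dampedError_eq_zero (by linarith), norm_zero]; positivity
      · rw [dampedError_eq, norm_smul, norm_of_nonneg (Real.exp_pos _).le]
        have h2 := norm_dampedError_zero_le (-w)
        rw [abs_neg] at h2
        refine (mul_le_of_le_one_left (norm_nonneg _) ?_).trans h2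
        rw [Real.exp_le_one_iff]
        have : 0 ≤ 1 / ((n : ℝ) + 1) := by positivity
        nlinarith
    · refine Eventually.of_forall fun w => ?_
      have h2 : Tendsto (fun n : ℕ => Real.exp (1 / ((n : ℝ) + 1) * -w)) atTop (nhds 1) := by
        have := (tendsto_one_div_add_atTop_nhds_zero_nat (𝕜 := ℝ)).mul_const (-w)
        rw [zero_mul] at this
        simpa only [Real.exp_zero] using this.rexp
      have h3 := (h2.smul_const (dampedError 0 (-w))).mul_const ((φ ((v - w) / δ) / δ : ℝ) : ℂ)
      rw [one_smul] at h3
      refine h3.congr fun n => ?_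
      rw [← dampedError_eq]
  refine le_of_tendsto hlim.norm (Eventually.of_forall fun n => ?_)
  have h4 := hb (1 / ((n : ℝ) + 1)) δ v (by positivity) ?_ h0 h1
  · rw [← integral_neg_eq_self] at h4
    simpa only [sub_eq_add_neg] using h4
  · rw [div_le_one (by positivity)]; linarith [n.cast_nonneg (α := ℝ)]

/-- `ψ` in exponential coordinates, normalised by its expected size. -/
noncomputable def psiRatio (w : ℝ) : ℝ := ψ (Real.exp w) * Real.exp (-w)

lemma abs_psiRatio_sub_one_le (w : ℝ) : |psiRatio w - 1| ≤ 6 := by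
  have h := abs_psi_sub_le (Real.exp_pos w).le
  have e : psiRatio w - 1 = (ψ (Real.exp w) - Real.exp w) * Real.exp (-w) := by
    rw [psiRatio, sub_mul, ← Real.exp_add]; simp
  rw [e, abs_mul, abs_of_pos (Real.exp_pos _)]
  calc _ ≤ 6 * Real.exp w * Real.exp (-w) := by gcongr
    _ = 6 := by rw [mul_assoc, ← Real.exp_add]; simp

lemma measurable_psiRatio : Measurable psiRatio := by
  have h : Measurable fun w : ℝ => ψ (Real.exp w) := measurable_psi.comp Real.measurable_exp
  have h2 : Measurable fun w : ℝ => Real.exp (-w) := by fun_prop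
  exact h.mul h2

lemma dampedError_zero_neg {w : ℝ} (hw : 0 < w) :
    dampedError 0 (-w) = ((w * (psiRatio w - 1) : ℝ) : ℂ) := by
  have : Real.exp w ∈ Set.Ioi (1 : ℝ) := by simpa using hw
  have e : Real.exp (-w) * Real.exp w = 1 := by rw [← Real.exp_add]; simp
  rw [dampedError, neg_neg, psiError, Set.indicator_of_mem this, Real.log_exp,
    Complex.real_smul, Complex.real_smul, ← Complex.ofReal_mul, ← Complex.ofReal_mul, psiRatio,
    add_zero, one_mul]
  congr 1
  linear_combination (-w) * e

lemma IsSmoothingKernel.integrable_mul_psiRatio (h : IsSmoothingKernel φ Φ) {δ : ℝ} (hδ : 0 < δ)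
    (v : ℝ) {f : ℝ → ℝ} (hf : Continuous f) :
    Integrable fun w => f w * (psiRatio w - 1) * (φ ((v - w) / δ) / δ) := by
  refine (h.integrable_mul_scaled hδ v (hf.abs.mul_const 6)).mono' ?_
    (Eventually.of_forall fun w => ?_)
  · exact ((hf.measurable.mul (measurable_psiRatio.sub_const 1)).mul
      (h.continuous_scaled δ v).measurable).aestronglyMeasurable
  · rw [norm_mul, norm_mul, norm_of_nonneg (h.scaled_nonneg hδ v w), norm_eq_abs, norm_eq_abs]
    gcongr
    · exact h.scaled_nonneg hδ v w
    · exact abs_psiRatio_sub_one_le w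

lemma exists_abs_integral_psiRatio_le (h : IsSmoothingKernel φ Φ) :
    ∃ C : ℝ, 0 < C ∧ ∀ δ v : ℝ, 0 < δ → δ ≤ 1 → 2 ≤ v →
      |∫ w, (psiRatio w - 1) * (φ ((v - w) / δ) / δ)| ≤ C / (δ ^ 21 * v) := by
  obtain ⟨C, hC, hb⟩ := exists_norm_integral_dampedError_zero_le h
  refine ⟨C + 6, by positivity, fun δ v h0 h1 hv => ?_⟩
  have i1 : ‖∫ w, w * (psiRatio w - 1) * (φ ((v - w) / δ) / δ)‖ ≤ C / δ ^ 21 := by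
    have h2 := hb δ v h0 h1
    rw [← Complex.norm_real, ← integral_complex_ofReal]
    refine le_of_eq_of_le (congrArg _ (integral_congr_ae (Eventually.of_forall fun w => ?_))) h2
    simp only
    rcases le_or_gt w 0 with hw | hw
    · rw [h.scaled_eq_zero h0]
      · simp
      · exact lt_of_lt_of_le (by linarith) (le_abs_self _)
    · rw [dampedError_zero_neg hw, Complex.ofReal_mul]
  have i2 : ‖∫ w, (v - w) * (psiRatio w - 1) * (φ ((v - w) / δ) / δ)‖ ≤ 6 := by
    have h3 := h.integrable_mul_scaled h0 v (continuous_const (y := (6 : ℝ)))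
    refine (norm_integral_le_of_norm_le h3 (Eventually.of_forall fun w => ?_)).trans ?_
    · rw [norm_mul, norm_mul, norm_of_nonneg (h.scaled_nonneg h0 v w), norm_eq_abs, norm_eq_abs]
      rcases le_or_gt |v - w| δ with hd | hd
      · refine mul_le_mul_of_nonneg_right ?_ (h.scaled_nonneg h0 v w)
        calc _ ≤ 1 * (6 : ℝ) := by
              gcongr
              · linarith
              · exact abs_psiRatio_sub_one_le w
          _ = 6 := one_mul _
      · rw [h.scaled_eq_zero h0 hd]; simp
    · rw [integral_const_mul, h.integral_scaled h0, mul_one]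
  have e : v * ∫ w, (psiRatio w - 1) * (φ ((v - w) / δ) / δ) =
      (∫ w, w * (psiRatio w - 1) * (φ ((v - w) / δ) / δ)) +
        ∫ w, (v - w) * (psiRatio w - 1) * (φ ((v - w) / δ) / δ) := by
    rw [← integral_add (h.integrable_mul_psiRatio h0 v (f := fun w => w) continuous_id)
      (h.integrable_mul_psiRatio h0 v (f := fun w => v - w) (by fun_prop)), ← integral_const_mul]
    congr 1; ext w; ring
  have e2 : |v * ∫ w, (psiRatio w - 1) * (φ ((v - w) / δ) / δ)| ≤ C / δ ^ 21 + 6 := by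
    rw [e]
    exact (norm_add_le _ _).trans (add_le_add i1 i2)
  rw [abs_mul, abs_of_pos (by linarith : 0 < v)] at e2
  have h6 : (6 : ℝ) ≤ 6 / δ ^ 21 := by
    rw [le_div_iff₀ (by positivity)]
    have := pow_le_one₀ h0.le h1 (n := 21)
    linarith
  rw [← div_div, le_div_iff₀ (by linarith), mul_comm, add_div]
  linarith

lemma psiRatio_nonneg (w : ℝ) : 0 ≤ psiRatio w := mul_nonneg (psi_nonneg _) (Real.exp_pos _).le

lemma psiRatio_mul_exp_le {v w : ℝ} (h : v ≤ w) : psiRatio v * Real.exp (v - w) ≤ psiRatio w := by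
  have h1 : psiRatio v * Real.exp (v - w) = ψ (Real.exp v) * Real.exp (-w) := by
    rw [psiRatio, mul_assoc, ← Real.exp_add]; ring_nf
  rw [h1, psiRatio]
  exact mul_le_mul_of_nonneg_right (psi_mono (Real.exp_le_exp.mpr h)) (Real.exp_pos _).le

lemma exists_abs_psiRatio_sub_one_le : ∃ C : ℝ, 0 < C ∧ ∀ v : ℝ, 3 ≤ v →
    |psiRatio v - 1| ≤ C * v ^ (-(1 / 22) : ℝ) := by
  obtain ⟨φ, Φ, h⟩ := exists_isSmoothingKernel
  obtain ⟨C, hC, hb⟩ := exists_abs_integral_psiRatio_le h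
  have main : ∀ δ v : ℝ, 0 < δ → δ ≤ 1 → 3 ≤ v →
      |psiRatio v - 1| ≤ 14 * δ + 2 * C / (δ ^ 21 * v) := fun δ v h0 h1 hv => by
    have hI : ∀ v, ∫ w, (psiRatio w - 1) * (φ ((v - w) / δ) / δ) =
        (∫ w, psiRatio w * (φ ((v - w) / δ) / δ)) - 1 := fun v => by
      have i1 := h.integrable_mul_psiRatio h0 v (continuous_const (y := (1 : ℝ)))
      have i2 := h.integrable_mul_scaled h0 v (continuous_const (y := (1 : ℝ)))
      simp only [one_mul] at i1 i2
      have e := integral_add i1 i2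
      rw [h.integral_scaled h0] at e
      rw [eq_sub_iff_add_eq, ← e]
      congr 1; ext w; ring
    have hψφ : ∀ v, Integrable fun w => psiRatio w * (φ ((v - w) / δ) / δ) := fun v => by
      have i1 := h.integrable_mul_psiRatio h0 v (continuous_const (y := (1 : ℝ)))
      have i2 := h.integrable_mul_scaled h0 v (continuous_const (y := (1 : ℝ)))
      refine (i1.add i2).congr (Eventually.of_forall fun w => ?_)
      simp only [Pi.add_apply]; ring
    have hexp : 1 - 2 * δ ≤ Real.exp (-(2 * δ)) := by linarith [Real.add_one_le_exp (-(2 * δ))]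
    have hexp1 : Real.exp (-(2 * δ)) ≤ 1 := by rw [Real.exp_le_one_iff]; linarith
    have hp := abs_le.mp (abs_psiRatio_sub_one_le v)
    have up : psiRatio v * Real.exp (-(2 * δ)) ≤ 1 + C / (δ ^ 21 * v) := by
      have h2 := hb δ (v + δ) h0 h1 (by linarith)
      rw [hI] at h2
      have h3 : psiRatio v * Real.exp (-(2 * δ)) ≤
          ∫ w, psiRatio w * (φ ((v + δ - w) / δ) / δ) := by
        rw [← mul_one (psiRatio v * _), ← h.integral_scaled h0 (v + δ), ← integral_const_mul]
        refine integral_mono (h.integrable_mul_scaled h0 _ continuous_const) (hψφ _) fun w => ?_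
        simp only
        rcases le_or_gt |v + δ - w| δ with hd | hd
        · refine mul_le_mul_of_nonneg_right ?_ (h.scaled_nonneg h0 _ w)
          rw [abs_le] at hd
          refine le_trans ?_ (psiRatio_mul_exp_le (by linarith : v ≤ w))
          gcongr
          · exact psiRatio_nonneg _
          · linarith
        · rw [h.scaled_eq_zero h0 hd]; simp
      have h4 : C / (δ ^ 21 * (v + δ)) ≤ C / (δ ^ 21 * v) := by gcongr; linarith
      have := (abs_le.mp h2).2
      linarith
    have lo : (1 - 2 * C / (δ ^ 21 * v)) ≤ psiRatio v * Real.exp (2 * δ) := by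
      have h2 := hb δ (v - δ) h0 h1 (by linarith)
      rw [hI] at h2
      have h3 : ∫ w, psiRatio w * (φ ((v - δ - w) / δ) / δ) ≤ psiRatio v * Real.exp (2 * δ) := by
        rw [← mul_one (psiRatio v * _), ← h.integral_scaled h0 (v - δ), ← integral_const_mul]
        refine integral_mono (hψφ _) (h.integrable_mul_scaled h0 _ continuous_const) fun w => ?_
        simp only
        rcases le_or_gt |v - δ - w| δ with hd | hd
        · refine mul_le_mul_of_nonneg_right ?_ (h.scaled_nonneg h0 _ w)
          rw [abs_le] at hd
          have h5 := psiRatio_mul_exp_le (by linarith : w ≤ v)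
          calc psiRatio w = psiRatio w * Real.exp (w - v) * Real.exp (v - w) := by
                rw [mul_assoc, ← Real.exp_add]; simp
            _ ≤ psiRatio v * Real.exp (2 * δ) := by
              gcongr
              · exact psiRatio_nonneg _
              · linarith
        · rw [h.scaled_eq_zero h0 hd]; simp
      have h4 : C / (δ ^ 21 * (v - δ)) ≤ 2 * C / (δ ^ 21 * v) := by
        have hvd : 0 < v - δ := by linarith
        rw [div_le_div_iff₀ (by positivity) (by positivity)]
        have : v ≤ 2 * (v - δ) := by linarith
        calc C * (δ ^ 21 * v) ≤ C * (δ ^ 21 * (2 * (v - δ))) := by gcongr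
          _ = _ := by ring
      have := (abs_le.mp h2).1
      linarith
    have hE : 0 ≤ C / (δ ^ 21 * v) := by positivity
    have hE2 : 2 * C / (δ ^ 21 * v) = 2 * (C / (δ ^ 21 * v)) := by ring
    rw [hE2] at lo ⊢
    have hn := psiRatio_nonneg v
    have lo2 : (1 - 2 * (C / (δ ^ 21 * v))) * Real.exp (-(2 * δ)) ≤ psiRatio v := by
      calc _ ≤ psiRatio v * Real.exp (2 * δ) * Real.exp (-(2 * δ)) := by gcongr
        _ = _ := by rw [mul_assoc, ← Real.exp_add]; simp
    rw [abs_le]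
    constructor <;> nlinarith
  refine ⟨14 + 2 * C, by positivity, fun v hv => ?_⟩
  have hv0 : 0 < v := by linarith
  have h2 := main (v ^ (-(1 / 22) : ℝ)) v (by positivity)
    (rpow_le_one_of_one_le_of_nonpos (by linarith) (by norm_num)) hv
  have h3 : (v ^ (-(1 / 22) : ℝ)) ^ 21 * v = (v ^ (-(1 / 22) : ℝ))⁻¹ := by
    rw [← rpow_natCast, ← rpow_mul hv0.le, ← rpow_neg hv0.le]
    nth_rewrite 2 [← rpow_one v]
    rw [← rpow_add hv0]; norm_num
  rw [h3, div_inv_eq_mul] at h2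
  linarith

end PrimeNumberTheorem

section Mertens

open MeasureTheory Chebyshev

/-- A shifted logarithm, at least `1` on `[1, ∞)`. -/
noncomputable def ell (x : ℝ) : ℝ := 1 + log x

/-- A shifted iterated logarithm, at least `1` on `[1, ∞)`. -/
noncomputable def logEll (x : ℝ) : ℝ := 1 + log (ell x)

lemma one_le_ell {x : ℝ} (hx : 1 ≤ x) : 1 ≤ ell x := by
  have := log_nonneg hx
  unfold ell; linarith

lemma ell_pos {x : ℝ} (hx : 1 ≤ x) : 0 < ell x := one_pos.trans_le (one_le_ell hx)

lemma one_le_logEll {x : ℝ} (hx : 1 ≤ x) : 1 ≤ logEll x := by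
  have := log_nonneg (one_le_ell hx)
  unfold logEll; linarith

lemma logEll_pos {x : ℝ} (hx : 1 ≤ x) : 0 < logEll x := one_pos.trans_le (one_le_logEll hx)

lemma logEll_le_ell {x : ℝ} (hx : 1 ≤ x) : logEll x ≤ ell x := by
  have := log_le_sub_one_of_pos (ell_pos hx)
  unfold logEll; linarith

lemma ell_mono {x y : ℝ} (hx : 1 ≤ x) (hxy : x ≤ y) : ell x ≤ ell y := by
  have := log_le_log (by linarith) hxy
  unfold ell; linarith

lemma logEll_mono {x y : ℝ} (hx : 1 ≤ x) (hxy : x ≤ y) : logEll x ≤ logEll y := by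
  have := log_le_log (ell_pos hx) (ell_mono hx hxy)
  unfold logEll; linarith

lemma ell_sq_le {x : ℝ} (hx : 1 ≤ x) : ell x ^ 2 ≤ 16 * √x := by
  have h0 : 0 ≤ √√x := sqrt_nonneg _
  have h1 : 0 < √√x := by positivity
  have h2 : (√√x) ^ 2 = √x := sq_sqrt (sqrt_nonneg _)
  have h3 : (√x) ^ 2 = x := sq_sqrt (by linarith)
  have h4 : log x = 4 * log √√x := by
    conv_lhs => rw [← h3, ← h2, ← pow_mul, log_pow]
    norm_num
  have h5 := log_le_sub_one_of_pos h1
  have h6 : ell x ≤ 4 * √√x := by unfold ell; linarith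
  have h7 := ell_pos hx
  calc ell x ^ 2 ≤ (4 * √√x) ^ 2 := by gcongr
    _ = 16 * √x := by rw [mul_pow, h2]; norm_num

/-- The prime number theorem with a weak error term. -/
lemma exists_abs_theta_sub_le : ∃ C : ℝ, 0 < C ∧ ∀ x : ℝ, 1 ≤ x →
    |θ x - x| ≤ C * x * ell x ^ (-(1 / 22) : ℝ) := by
  obtain ⟨C, hC, h⟩ := exists_abs_psiRatio_sub_one_le
  refine ⟨2 * C + 32 + 24, by positivity, fun x hx => ?_⟩
  have hx0 : 0 < x := by linarith
  have hl := one_le_ell hx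
  have hl0 := ell_pos hx
  have hp : 0 < ell x ^ (-(1 / 22) : ℝ) := by positivity
  rcases le_or_gt 3 (log x) with h3 | h3
  · have h1 := h (log x) h3
    have e : ψ x - x = (psiRatio (log x) - 1) * x := by
      rw [psiRatio, Real.exp_neg, exp_log hx0]
      field_simp
    have h2 : log x ^ (-(1 / 22) : ℝ) ≤ 2 * ell x ^ (-(1 / 22) : ℝ) := by
      have h4 : ell x / 2 ≤ log x := by unfold ell; linarith
      calc log x ^ (-(1 / 22) : ℝ) ≤ (ell x / 2) ^ (-(1 / 22) : ℝ) :=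
            rpow_le_rpow_of_nonpos (by positivity) h4 (by norm_num)
        _ = 2 ^ (1 / 22 : ℝ) * ell x ^ (-(1 / 22) : ℝ) := by
            rw [div_rpow hl0.le zero_le_two, rpow_neg zero_le_two]; field_simp
        _ ≤ 2 * ell x ^ (-(1 / 22) : ℝ) := by
            gcongr
            exact rpow_le_self_of_one_le (by norm_num) (by norm_num)
    have hψ : |ψ x - x| ≤ 2 * C * x * ell x ^ (-(1 / 22) : ℝ) := by
      rw [e, abs_mul, abs_of_pos hx0]
      calc _ ≤ C * log x ^ (-(1 / 22) : ℝ) * x := by gcongr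
        _ ≤ C * (2 * ell x ^ (-(1 / 22) : ℝ)) * x := by gcongr
        _ = _ := by ring
    have hd := psi_sub_theta_le hx
    have hd2 : 2 * √x * log x ≤ 32 * x * ell x ^ (-(1 / 22) : ℝ) := by
      have h5 : ell x ^ (-1 : ℝ) ≤ ell x ^ (-(1 / 22) : ℝ) :=
        rpow_le_rpow_of_exponent_le hl (by norm_num)
      rw [rpow_neg_one] at h5
      have h6 : log x ≤ ell x := by unfold ell; linarith
      have h7 : √x * log x * ell x ≤ 16 * x := by
        calc √x * log x * ell x ≤ √x * ell x * ell x := by gcongr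
          _ = √x * ell x ^ 2 := by ring
          _ ≤ √x * (16 * √x) := by gcongr; exact ell_sq_le hx
          _ = 16 * x := by rw [mul_left_comm, mul_self_sqrt hx0.le]
      calc 2 * √x * log x = 2 * (√x * log x * ell x) * (ell x)⁻¹ := by field_simp
        _ ≤ 2 * (16 * x) * ell x ^ (-(1 / 22) : ℝ) := by gcongr
        _ = _ := by ring
    have h8 := theta_le_psi x
    have h9 : 0 ≤ x * ell x ^ (-(1 / 22) : ℝ) := by positivity
    rw [abs_le] at hψ ⊢
    constructor <;> nlinarith
  · have h4 : (1 / 4 : ℝ) ≤ ell x ^ (-(1 / 22) : ℝ) := by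
      calc (1 / 4 : ℝ) = 4 ^ (-1 : ℝ) := by rw [rpow_neg_one]; norm_num
        _ ≤ 4 ^ (-(1 / 22) : ℝ) := rpow_le_rpow_of_exponent_le (by norm_num) (by norm_num)
        _ ≤ _ := rpow_le_rpow_of_nonpos hl0 (by unfold ell; linarith) (by norm_num)
    have h5 := theta_le_log4_mul_x hx0.le
    have h6 := theta_nonneg x
    have h7 : log 4 ≤ 3 := by
      have := log_le_sub_one_of_pos (show (0 : ℝ) < 4 by norm_num); linarith
    have h8 : |θ x - x| ≤ 6 * x := by rw [abs_le]; constructor <;> nlinarith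
    have h9 : 6 * x ≤ 24 * x * ell x ^ (-(1 / 22) : ℝ) := by nlinarith
    have h10 : 0 ≤ x * ell x ^ (-(1 / 22) : ℝ) := by positivity
    nlinarith

lemma half_le_log_two : 1 / 2 ≤ log 2 := by linarith [Real.log_two_gt_d9]

lemma sum_primesLE_inv_eq {x : ℝ} (hx : 2 ≤ x) :
    ∑ p ∈ Nat.primesLE ⌊x⌋₊, (p : ℝ)⁻¹ =
      θ x / (x * log x) + ∫ t in (2 : ℝ)..x, (log t + 1) / (t * log t) ^ 2 * θ t := by
  let a : ℕ → ℝ := fun n => if n.Prime then log n else 0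
  have hd : ∀ t : ℝ, 2 ≤ t → HasDerivAt (fun t => (t * log t)⁻¹)
      (-((log t + 1) / (t * log t) ^ 2)) t := fun t ht => by
    have h1 : 0 < log t := log_pos (by linarith)
    have h2 : t ≠ 0 := by linarith
    have := ((hasDerivAt_id t).mul (hasDerivAt_log h2)).inv (mul_ne_zero h2 h1.ne')
    refine this.congr_deriv ?_
    simp only [Pi.mul_apply, id]
    field_simp
  have hsum : ∀ t : ℝ, ∑ n ∈ Finset.Icc 0 ⌊t⌋₊, a n = θ t := fun t => by
    rw [theta_eq_sum_Icc, Finset.sum_filter]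
  have e : ∑ p ∈ Nat.primesLE ⌊x⌋₊, (p : ℝ)⁻¹ =
      ∑ n ∈ Finset.Icc 0 ⌊x⌋₊, ((n : ℝ) * log n)⁻¹ * a n := by
    rw [Nat.primesLE_eq_filter_Icc_zero, Finset.sum_filter]
    refine Finset.sum_congr rfl fun n _ => ?_
    by_cases hn : n.Prime
    · have h1 : 0 < log (n : ℝ) := log_pos (by exact_mod_cast hn.one_lt)
      have h2 : (n : ℝ) ≠ 0 := by exact_mod_cast hn.ne_zero
      simp only [a, hn, if_true]
      field_simp
    · simp [a, hn]
  have hcont : ContinuousOn (fun t : ℝ => -((log t + 1) / (t * log t) ^ 2)) (Set.Icc 2 x) := by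
    intro t ht
    have h1 : 0 < log t := log_pos (by linarith [ht.1])
    have h2 : t ≠ 0 := by linarith [ht.1]
    have h3 : (t * log t) ^ 2 ≠ 0 := by positivity
    refine ContinuousAt.continuousWithinAt ?_
    fun_prop (disch := assumption)
  rw [e, sum_mul_eq_sub_integral_mul₁ a (f := fun t => (t * log t)⁻¹) (by simp [a]) (by simp [a]) x
    (fun t ht => (hd t ht.1).differentiableAt), ← intervalIntegral.integral_of_le hx, hsum,
    sub_eq_add_neg, ← intervalIntegral.integral_neg]
  · congr 1
    · field_simp
    · refine intervalIntegral.integral_congr fun t ht => ?_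
      rw [Set.uIcc_of_le hx] at ht
      simp only [hsum]
      rw [(hd t ht.1).deriv]
      ring
  · exact (hcont.integrableOn_Icc).congr_fun (fun t ht => ((hd t ht.1).deriv).symm)
      measurableSet_Icc

/-- Mertens' second theorem, up to a bounded error. -/
lemma exists_abs_sum_primesLE_inv_sub_le : ∃ C : ℝ, 0 < C ∧ ∀ x : ℝ, 1 ≤ x →
    |∑ p ∈ Nat.primesLE ⌊x⌋₊, (p : ℝ)⁻¹ - logEll x| ≤ C := by
  obtain ⟨C, hC, h⟩ := exists_abs_theta_sub_le
  set D : ℝ := 22 * (3 * C) * log 2 ^ (-(1 / 22) : ℝ) with hD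
  have hl2 := half_le_log_two
  have hD0 : 0 < D := by positivity
  refine ⟨D + 20, by positivity, fun x hx => ?_⟩
  rcases lt_or_ge x 2 with hx2 | hx2
  · have e : Nat.primesLE ⌊x⌋₊ = ∅ := by
      have : ⌊x⌋₊ < 2 := (Nat.floor_lt' two_ne_zero).mpr (by exact_mod_cast hx2)
      rw [Nat.primesLE_eq_filter_Icc_zero, Finset.filter_eq_empty_iff]
      intro n hn hp
      have := hp.two_le
      rw [Finset.mem_Icc] at hn
      omega
    rw [e, Finset.sum_empty, zero_sub, abs_neg, abs_of_pos (logEll_pos hx)]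
    have h1 := logEll_le_ell hx
    have h2 := log_le_sub_one_of_pos (show 0 < x by linarith)
    have h3 : ell x ≤ 2 := by unfold ell; linarith
    linarith
  have hx0 : 0 < x := by linarith
  have hlx : log 2 ≤ log x := log_le_log (by norm_num) hx2
  have hpos : ∀ t ∈ Set.uIcc 2 x, 0 < t ∧ 1 / 2 ≤ log t := fun t ht => by
    rw [Set.uIcc_of_le hx2] at ht
    exact ⟨by linarith [ht.1], hl2.trans (log_le_log (by norm_num) ht.1)⟩
  have hk : ContinuousOn (fun t : ℝ => (log t + 1) / (t * log t) ^ 2) (Set.uIcc 2 x) := by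
    intro t ht
    obtain ⟨h1, h2⟩ := hpos t ht
    have h3 : (t * log t) ^ 2 ≠ 0 := by positivity
    have h4 : t ≠ 0 := h1.ne'
    refine ContinuousAt.continuousWithinAt ?_
    fun_prop (disch := assumption)
  have hθ : IntervalIntegrable θ volume 2 x := (theta_mono.monotoneOn _).intervalIntegrable
  have i1 : IntervalIntegrable (fun t => (log t + 1) / (t * log t) ^ 2 * θ t) volume 2 x :=
    hθ.continuousOn_mul hk
  have i2 : IntervalIntegrable (fun t => (log t + 1) / (t * log t) ^ 2 * t) volume 2 x :=
    (hk.mul continuousOn_id).intervalIntegrable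
  have m1 : ∫ t in (2 : ℝ)..x, (log t + 1) / (t * log t) ^ 2 * t =
      (log (log x) - (log x)⁻¹) - (log (log 2) - (log 2)⁻¹) := by
    refine intervalIntegral.integral_eq_sub_of_hasDerivAt
      (f := fun t => log (log t) - (log t)⁻¹) (fun t ht => ?_) i2
    obtain ⟨h1, h2⟩ := hpos t ht
    have h3 : log t ≠ 0 := by positivity
    have h4 := hasDerivAt_log h1.ne'
    refine ((h4.log h3).sub (h4.inv h3)).congr_deriv ?_
    field_simp
    ring
  have i3 : IntervalIntegrable (fun t => 3 * C * (log t ^ (-(23 / 22) : ℝ) / t)) volume 2 x := by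
    refine ContinuousOn.intervalIntegrable fun t ht => ?_
    obtain ⟨h1, h2⟩ := hpos t ht
    have h3 : log t ≠ 0 := by positivity
    have h4 : t ≠ 0 := h1.ne'
    refine ContinuousAt.continuousWithinAt ?_
    refine continuousAt_const.mul (ContinuousAt.div ?_ continuousAt_id h4)
    exact (continuousAt_log h4).rpow_const (Or.inl h3)
  have m2 : ∫ t in (2 : ℝ)..x, 3 * C * (log t ^ (-(23 / 22) : ℝ) / t) ≤ D := by
    have : ∫ t in (2 : ℝ)..x, 3 * C * (log t ^ (-(23 / 22) : ℝ) / t) =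
        -22 * (3 * C) * log x ^ (-(1 / 22) : ℝ) - -22 * (3 * C) * log 2 ^ (-(1 / 22) : ℝ) := by
      refine intervalIntegral.integral_eq_sub_of_hasDerivAt
        (f := fun t => -22 * (3 * C) * log t ^ (-(1 / 22) : ℝ)) (fun t ht => ?_) i3
      obtain ⟨h1, h2⟩ := hpos t ht
      have h3 : log t ≠ 0 := by positivity
      have h4 := ((hasDerivAt_log h1.ne').rpow_const (p := -(1 / 22)) (Or.inl h3)).const_mul
        (-22 * (3 * C))
      refine h4.congr_deriv ?_
      norm_num
      ring
    rw [this]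
    have : 0 ≤ log x ^ (-(1 / 22) : ℝ) := rpow_nonneg (by linarith) _
    nlinarith
  have key : |∫ t in (2 : ℝ)..x, ((log t + 1) / (t * log t) ^ 2 * θ t -
      (log t + 1) / (t * log t) ^ 2 * t)| ≤ D := by
    refine le_trans ?_ m2
    rw [← norm_eq_abs]
    refine intervalIntegral.norm_integral_le_of_norm_le hx2 ?_ i3
    refine Eventually.of_forall fun t ht => ?_
    have ht2 : t ∈ Set.uIcc 2 x := by rw [Set.uIcc_of_le hx2]; exact ⟨ht.1.le, ht.2⟩
    obtain ⟨h1, h2⟩ := hpos t ht2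
    have h3 : 0 < log t := by linarith
    have h5 := h t (by linarith [ht.1])
    have h6 : ell t ^ (-(1 / 22) : ℝ) ≤ log t ^ (-(1 / 22) : ℝ) :=
      rpow_le_rpow_of_nonpos h3 (by unfold ell; linarith) (by norm_num)
    have h7 : log t ^ (-(23 / 22) : ℝ) = log t ^ (-(1 / 22) : ℝ) * (log t)⁻¹ := by
      rw [← rpow_neg_one, ← rpow_add h3]; norm_num
    rw [← mul_sub, norm_mul, norm_eq_abs, norm_eq_abs, abs_of_nonneg (by positivity), h7]
    calc (log t + 1) / (t * log t) ^ 2 * |θ t - t|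
        ≤ (3 * log t) / (t * log t) ^ 2 * (C * t * log t ^ (-(1 / 22) : ℝ)) := by
          gcongr
          · linarith
          · exact h5.trans (by gcongr)
      _ = _ := by field_simp
  rw [intervalIntegral.integral_sub i1 i2, m1] at key
  have hθx : |θ x / (x * log x)| ≤ 6 := by
    have h5 := theta_le_log4_mul_x hx0.le
    have h6 := theta_nonneg x
    have h7 : log 4 ≤ 3 := by
      have := log_le_sub_one_of_pos (show (0 : ℝ) < 4 by norm_num); linarith
    have h8 : 0 < log x := by linarith
    rw [abs_of_nonneg (by positivity), div_le_iff₀ (by positivity)]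
    nlinarith
  have hinv : ∀ y : ℝ, 1 / 2 ≤ y → 0 ≤ y⁻¹ ∧ y⁻¹ ≤ 2 := fun y hy =>
    ⟨by positivity, by rw [inv_le_comm₀ (by linarith) (by norm_num)]; linarith⟩
  have b1 := hinv (log x) (by linarith)
  have b2 := hinv (log 2) hl2
  have b3 : |log (log 2)| ≤ 2 := by
    have h1 := log_le_sub_one_of_pos (show 0 < log 2 by linarith)
    have h2 := one_sub_inv_le_log_of_pos (show 0 < log 2 by linarith)
    have h3 := log_le_sub_one_of_pos (show (0 : ℝ) < 2 by linarith)
    rw [abs_le]; constructor <;> linarith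
  have b4 : |log (log x) - log (ell x)| ≤ 2 := by
    have hlx0 : 0 < log x := by linarith
    have h1 : log (log x) ≤ log (ell x) := log_le_log hlx0 (by unfold ell; linarith)
    have h2 : log (ell x / log x) ≤ ell x / log x - 1 := log_le_sub_one_of_pos
      (div_pos (ell_pos hx) hlx0)
    rw [log_div (ell_pos hx).ne' hlx0.ne'] at h2
    have h3 : ell x / log x - 1 = (log x)⁻¹ := by unfold ell; field_simp; ring
    rw [abs_le]; constructor <;> linarith
  rw [sum_primesLE_inv_eq hx2]
  unfold logEll
  rw [abs_le] at *
  constructor <;> linarith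

end Mertens

section TupleCount

open ArithmeticFunction hiding log

/-- The number of ordered `k`-tuples of primes with product `n`. -/
def tupleCount : ℕ → ℕ → ℕ
  | 0, n => if n = 1 then 1 else 0
  | k + 1, n => ∑ p ∈ n.primeFactors, tupleCount k (n / p)

lemma mem_primeFactors_div_comm {n p q : ℕ} :
    p ∈ n.primeFactors ∧ q ∈ (n / p).primeFactors ↔
      p ∈ (n / q).primeFactors ∧ q ∈ n.primeFactors := by
  have key : ∀ {n p q : ℕ}, p ∈ n.primeFactors → q ∈ (n / p).primeFactors →
      p ∈ (n / q).primeFactors ∧ q ∈ n.primeFactors := by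
    intro n p q hp hq
    obtain ⟨pp, hpn, hn⟩ := Nat.mem_primeFactors.mp hp
    obtain ⟨pq, hqn, -⟩ := Nat.mem_primeFactors.mp hq
    obtain ⟨m, rfl⟩ := hpn
    rw [Nat.mul_div_cancel_left _ pp.pos] at hqn
    obtain ⟨l, rfl⟩ := hqn
    rw [show p * (q * l) = q * (p * l) by ring] at hn ⊢
    rw [Nat.mul_div_cancel_left _ pq.pos]
    exact ⟨Nat.mem_primeFactors.mpr ⟨pp, dvd_mul_right _ _, right_ne_zero_of_mul hn⟩,
      Nat.mem_primeFactors.mpr ⟨pq, dvd_mul_right _ _, hn⟩⟩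
  exact ⟨fun h => key h.1 h.2, fun h => (key h.2 h.1).symm⟩

lemma sum_primeFactors_div_comm (n : ℕ) (f : ℕ → ℕ → ℝ) :
    ∑ p ∈ n.primeFactors, ∑ q ∈ (n / p).primeFactors, f p q =
      ∑ q ∈ n.primeFactors, ∑ p ∈ (n / q).primeFactors, f p q :=
  Finset.sum_comm' fun _ _ => mem_primeFactors_div_comm

lemma tupleCount_mul_log (k : ℕ) {n : ℕ} (hn : n ≠ 0) :
    (tupleCount (k + 1) n : ℝ) * log n =
      (k + 1) * ∑ p ∈ n.primeFactors, (tupleCount k (n / p) : ℝ) * log p := by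
  induction k generalizing n with
  | zero =>
    simp only [tupleCount, Nat.cast_sum, Finset.sum_mul, Nat.cast_zero, zero_add, one_mul]
    refine Finset.sum_congr rfl fun p hp => ?_
    split_ifs with h
    · rw [Nat.eq_mul_of_div_eq_right (Nat.dvd_of_mem_primeFactors hp) h, mul_one]
    · simp
  | succ k ih =>
    have e1 : (tupleCount (k + 2) n : ℝ) * log n = ∑ p ∈ n.primeFactors,
        ((tupleCount (k + 1) (n / p) : ℝ) * log p +
          (tupleCount (k + 1) (n / p) : ℝ) * log (n / p : ℕ)) := by
      rw [tupleCount, Nat.cast_sum, Finset.sum_mul]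
      refine Finset.sum_congr rfl fun p hp => ?_
      obtain ⟨pp, hpn, -⟩ := Nat.mem_primeFactors.mp hp
      obtain ⟨m, rfl⟩ := hpn
      rw [Nat.mul_div_cancel_left _ pp.pos, ← mul_add, Nat.cast_mul, log_mul]
      · exact_mod_cast pp.ne_zero
      · exact_mod_cast right_ne_zero_of_mul hn
    have e2 : ∑ p ∈ n.primeFactors, (tupleCount (k + 1) (n / p) : ℝ) * log (n / p : ℕ) =
        (k + 1) * ∑ p ∈ n.primeFactors, (tupleCount (k + 1) (n / p) : ℝ) * log p := by
      have : ∀ p ∈ n.primeFactors, (tupleCount (k + 1) (n / p) : ℝ) * log (n / p : ℕ) =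
          ∑ q ∈ (n / p).primeFactors, (k + 1) * ((tupleCount k (n / p / q) : ℝ) * log q) := by
        intro p hp
        rw [ih (Nat.div_ne_zero_iff_of_dvd (Nat.dvd_of_mem_primeFactors hp) |>.mpr
          ⟨hn, (Nat.prime_of_mem_primeFactors hp).ne_zero⟩), Finset.mul_sum]
      rw [Finset.sum_congr rfl this, sum_primeFactors_div_comm, Finset.mul_sum]
      refine Finset.sum_congr rfl fun q _ => ?_
      rw [tupleCount, Nat.cast_sum, Finset.sum_mul, Finset.mul_sum]
      refine Finset.sum_congr rfl fun p _ => ?_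
      rw [Nat.div_div_eq_div_mul, Nat.div_div_eq_div_mul, mul_comm p q]
    rw [e1, Finset.sum_add_distrib, e2]
    push_cast
    ring

lemma cardFactors_div_prime {n p : ℕ} (hn : n ≠ 0) (hp : p.Prime) (h : p ∣ n) :
    cardFactors n = cardFactors (n / p) + 1 := by
  obtain ⟨m, rfl⟩ := h
  rw [Nat.mul_div_cancel_left _ hp.pos, cardFactors_mul hp.ne_zero (right_ne_zero_of_mul hn),
    cardFactors_apply_prime hp, add_comm]

lemma cardFactors_of_tupleCount_ne_zero {k n : ℕ} (hn : n ≠ 0) (h : tupleCount k n ≠ 0) :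
    cardFactors n = k := by
  induction k generalizing n with
  | zero =>
    simp only [tupleCount, ne_eq, ite_eq_right_iff, one_ne_zero, imp_false, not_not] at h
    simp [h]
  | succ k ih =>
    rw [tupleCount] at h
    obtain ⟨p, hp, hpk⟩ := Finset.exists_ne_zero_of_sum_ne_zero h
    obtain ⟨pp, hpn, -⟩ := Nat.mem_primeFactors.mp hp
    rw [cardFactors_div_prime hn pp hpn, ih _ hpk]
    exact (Nat.div_ne_zero_iff_of_dvd hpn).mpr ⟨hn, pp.ne_zero⟩

lemma card_primeFactors_eq (n : ℕ) : n.primeFactors.card = cardDistinctFactors n :=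
  List.card_toFinset _

lemma card_primeFactors_le_cardFactors (n : ℕ) : n.primeFactors.card ≤ cardFactors n := by
  rw [card_primeFactors_eq, cardDistinctFactors_apply, cardFactors_apply]
  exact (List.dedup_sublist _).length_le

lemma tupleCount_le_factorial (k : ℕ) {n : ℕ} (hn : n ≠ 0) : tupleCount k n ≤ k.factorial := by
  induction k generalizing n with
  | zero => rw [tupleCount]; split_ifs <;> simp
  | succ k ih =>
    by_cases h : tupleCount (k + 1) n = 0
    · simp [h]
    have hc := cardFactors_of_tupleCount_ne_zero hn h
    calc tupleCount (k + 1) n = ∑ p ∈ n.primeFactors, tupleCount k (n / p) := rfl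
      _ ≤ ∑ p ∈ n.primeFactors, k.factorial := by
        refine Finset.sum_le_sum fun p hp => ih ?_
        exact (Nat.div_ne_zero_iff_of_dvd (Nat.dvd_of_mem_primeFactors hp)).mpr
          ⟨hn, (Nat.prime_of_mem_primeFactors hp).ne_zero⟩
      _ = n.primeFactors.card * k.factorial := by simp
      _ ≤ (k + 1) * k.factorial := by
        gcongr; exact hc ▸ card_primeFactors_le_cardFactors n
      _ = (k + 1).factorial := (Nat.factorial_succ k).symm

lemma one_le_tupleCount {k n : ℕ} (hn : n ≠ 0) (h : cardFactors n = k) : 1 ≤ tupleCount k n := by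
  induction k generalizing n with
  | zero =>
    rw [cardFactors_eq_zero_iff_eq_zero_or_one] at h
    simp [tupleCount, h.resolve_left hn]
  | succ k ih =>
    have h1 : n ≠ 1 := by rintro rfl; simp at h
    have hp := Nat.minFac_prime h1
    have hd := Nat.minFac_dvd n
    rw [cardFactors_div_prime hn hp hd, add_left_inj] at h
    refine (ih ((Nat.div_ne_zero_iff_of_dvd hd).mpr ⟨hn, hp.ne_zero⟩) h).trans ?_
    exact Finset.single_le_sum (f := fun p => tupleCount k (n / p)) (fun _ _ => Nat.zero_le _)
      (Nat.mem_primeFactors.mpr ⟨hp, hd, hn⟩)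

lemma tupleCount_of_squarefree {k n : ℕ} (hn : Squarefree n) (h : cardFactors n = k) :
    tupleCount k n = k.factorial := by
  induction k generalizing n with
  | zero =>
    rw [cardFactors_eq_zero_iff_eq_zero_or_one] at h
    simp [tupleCount, h.resolve_left hn.ne_zero]
  | succ k ih =>
    have : ∀ p ∈ n.primeFactors, tupleCount k (n / p) = k.factorial := fun p hp => by
      obtain ⟨pp, hd, h0⟩ := Nat.mem_primeFactors.mp hp
      refine ih (hn.squarefree_of_dvd (Nat.div_dvd_of_dvd hd)) ?_
      rw [cardFactors_div_prime h0 pp hd] at h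
      omega
    rw [tupleCount, Finset.sum_congr rfl this, Finset.sum_const, smul_eq_mul,
      Nat.factorial_succ, ← h,
      ← (cardDistinctFactors_eq_cardFactors_iff_squarefree hn.ne_zero).mpr hn,
      card_primeFactors_eq]

/-- Summation over `n = p * m` with `p` prime, organised by `p`. -/
lemma sum_sum_primeFactors (N : ℕ) (F : ℕ → ℕ → ℝ) :
    ∑ n ∈ Finset.Icc 1 N, ∑ p ∈ n.primeFactors, F p (n / p) =
      ∑ p ∈ Nat.primesLE N, ∑ m ∈ Finset.Icc 1 (N / p), F p m := by
  rw [Finset.sum_sigma', Finset.sum_sigma']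
  refine Finset.sum_bij' (fun a _ => ⟨a.2, a.1 / a.2⟩) (fun b _ => ⟨b.1 * b.2, b.1⟩) ?_ ?_ ?_ ?_ ?_
  · rintro ⟨n, p⟩ h
    simp only [Finset.mem_sigma, Finset.mem_Icc, Nat.mem_primeFactors] at h
    obtain ⟨⟨h1, h2⟩, pp, hd, h0⟩ := h
    have hle := Nat.le_of_dvd (by omega) hd
    simp only [Finset.mem_sigma, Nat.primesLE_eq_filter_Icc_zero, Finset.mem_filter,
      Finset.mem_Icc]
    exact ⟨⟨⟨Nat.zero_le _, by omega⟩, pp⟩, Nat.div_pos hle pp.pos, Nat.div_le_div_right h2⟩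
  · rintro ⟨p, m⟩ h
    simp only [Finset.mem_sigma, Nat.primesLE_eq_filter_Icc_zero, Finset.mem_filter,
      Finset.mem_Icc] at h
    obtain ⟨⟨-, pp⟩, h1, h2⟩ := h
    simp only [Finset.mem_sigma, Finset.mem_Icc, Nat.mem_primeFactors]
    have h3 : p * m ≤ N := by
      rw [mul_comm]; exact (Nat.le_div_iff_mul_le pp.pos).mp h2
    have h4 : 0 < p * m := Nat.mul_pos pp.pos h1
    exact ⟨⟨h4, h3⟩, pp, dvd_mul_right _ _, h4.ne'⟩
  · rintro ⟨n, p⟩ h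
    simp only [Finset.mem_sigma, Nat.mem_primeFactors] at h
    simp [Nat.mul_div_cancel' h.2.2.1]
  · rintro ⟨p, m⟩ h
    simp only [Finset.mem_sigma, Nat.primesLE_eq_filter_Icc_zero, Finset.mem_filter] at h
    simp [Nat.mul_div_cancel_left _ h.1.2.pos]
  · rintro ⟨n, p⟩ h
    rfl

/-- Summation over `p * m ≤ N` with `p` prime, with the order of summation exchanged. -/
lemma sum_primesLE_sum_comm (N : ℕ) (F : ℕ → ℕ → ℝ) :
    ∑ p ∈ Nat.primesLE N, ∑ m ∈ Finset.Icc 1 (N / p), F p m =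
      ∑ m ∈ Finset.Icc 1 N, ∑ p ∈ Nat.primesLE (N / m), F p m := by
  refine Finset.sum_comm' fun p m => ?_
  simp only [Nat.primesLE_eq_filter_Icc_zero, Finset.mem_filter, Finset.mem_Icc]
  constructor
  · rintro ⟨⟨⟨-, h1⟩, pp⟩, h2, h3⟩
    have h4 := (Nat.le_div_iff_mul_le pp.pos).mp h3
    exact ⟨⟨⟨Nat.zero_le _, (Nat.le_div_iff_mul_le (by omega)).mpr (by linarith)⟩, pp⟩, h2,
      h3.trans (Nat.div_le_self _ _)⟩
  · rintro ⟨⟨⟨-, h1⟩, pp⟩, h2, h3⟩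
    have h4 := (Nat.le_div_iff_mul_le (by omega)).mp h1
    exact ⟨⟨⟨Nat.zero_le _, h1.trans (Nat.div_le_self _ _)⟩, pp⟩, h2,
      (Nat.le_div_iff_mul_le pp.pos).mpr (by linarith)⟩

end TupleCount

section TupleSums

open Chebyshev

lemma one_le_div_of_mem_Icc {x : ℝ} {n : ℕ} (h : n ∈ Finset.Icc 1 ⌊x⌋₊) :
    (1 : ℝ) ≤ n ∧ 1 ≤ x / n := by
  rw [Finset.mem_Icc] at h
  have h1 : (1 : ℝ) ≤ n := by exact_mod_cast h.1
  have h2 : (n : ℝ) ≤ x := (Nat.le_floor_iff' (by omega)).mp h.2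
  exact ⟨h1, (one_le_div (by linarith)).mpr h2⟩

lemma mem_primesLE_floor {x : ℝ} {p : ℕ} :
    p ∈ Nat.primesLE ⌊x⌋₊ ↔ p.Prime ∧ (p : ℝ) ≤ x := by
  rw [Nat.primesLE_eq_filter_Icc_zero, Finset.mem_filter, Finset.mem_Icc]
  constructor
  · rintro ⟨⟨-, h⟩, hp⟩
    exact ⟨hp, (Nat.le_floor_iff' hp.ne_zero).mp h⟩
  · rintro ⟨hp, h⟩
    exact ⟨⟨Nat.zero_le _, (Nat.le_floor_iff' hp.ne_zero).mpr h⟩, hp⟩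

lemma sum_tupleCount_succ_eq_sum_primesLE (k : ℕ) (x : ℝ) (g : ℕ → ℝ) :
    ∑ n ∈ Finset.Icc 1 ⌊x⌋₊, (tupleCount (k + 1) n : ℝ) * g n =
      ∑ p ∈ Nat.primesLE ⌊x⌋₊, ∑ m ∈ Finset.Icc 1 ⌊x / p⌋₊, (tupleCount k m : ℝ) * g (p * m) := by
  have e : ∀ n, (tupleCount (k + 1) n : ℝ) * g n =
      ∑ p ∈ n.primeFactors, (tupleCount k (n / p) : ℝ) * g (p * (n / p)) := fun n => by
    rw [tupleCount, Nat.cast_sum, Finset.sum_mul]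
    refine Finset.sum_congr rfl fun p hp => ?_
    rw [Nat.mul_div_cancel' (Nat.dvd_of_mem_primeFactors hp)]
  rw [Finset.sum_congr rfl fun n _ => e n,
    sum_sum_primeFactors ⌊x⌋₊ fun p m => (tupleCount k m : ℝ) * g (p * m)]
  refine Finset.sum_congr rfl fun p _ => ?_
  rw [Nat.floor_div_natCast]

lemma sum_tupleCount_succ_eq_sum_Icc (k : ℕ) (x : ℝ) (g : ℕ → ℝ) :
    ∑ n ∈ Finset.Icc 1 ⌊x⌋₊, (tupleCount (k + 1) n : ℝ) * g n =
      ∑ m ∈ Finset.Icc 1 ⌊x⌋₊, (tupleCount k m : ℝ) * ∑ p ∈ Nat.primesLE ⌊x / m⌋₊, g (p * m) := by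
  rw [sum_tupleCount_succ_eq_sum_primesLE]
  have e : ∀ p ∈ Nat.primesLE ⌊x⌋₊, ∑ m ∈ Finset.Icc 1 ⌊x / p⌋₊, (tupleCount k m : ℝ) * g (p * m) =
      ∑ m ∈ Finset.Icc 1 (⌊x⌋₊ / p), (tupleCount k m : ℝ) * g (p * m) := fun p _ => by
    rw [Nat.floor_div_natCast]
  rw [Finset.sum_congr rfl e, sum_primesLE_sum_comm]
  refine Finset.sum_congr rfl fun m _ => ?_
  rw [Nat.floor_div_natCast, Finset.mul_sum]

lemma sum_tupleCount_mul_log (k : ℕ) (x : ℝ) :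
    ∑ n ∈ Finset.Icc 1 ⌊x⌋₊, (tupleCount (k + 1) n : ℝ) * log n =
      (k + 1) * ∑ m ∈ Finset.Icc 1 ⌊x⌋₊, (tupleCount k m : ℝ) * θ (x / m) := by
  have e : ∀ n ∈ Finset.Icc 1 ⌊x⌋₊, (tupleCount (k + 1) n : ℝ) * log n =
      ∑ p ∈ n.primeFactors, (k + 1) * ((tupleCount k (n / p) : ℝ) * log p) := fun n hn => by
    rw [tupleCount_mul_log k (by rw [Finset.mem_Icc] at hn; omega), Finset.mul_sum]
  rw [Finset.sum_congr rfl e,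
    sum_sum_primeFactors ⌊x⌋₊ fun p m => (k + 1) * ((tupleCount k m : ℝ) * log p),
    sum_primesLE_sum_comm, Finset.mul_sum]
  refine Finset.sum_congr rfl fun m _ => ?_
  rw [theta_eq_sum_primesLE, Nat.floor_div_natCast, Finset.mul_sum, Finset.mul_sum]

/-- The number of ordered `k`-tuples of primes with product at most `x`. -/
noncomputable def tupleSum (k : ℕ) (x : ℝ) : ℝ :=
  ∑ n ∈ Finset.Icc 1 ⌊x⌋₊, (tupleCount k n : ℝ)

/-- The sum of `1 / (p₁ ⋯ p_k)` over ordered `k`-tuples of primes with product at most `x`. -/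
noncomputable def tupleInvSum (k : ℕ) (x : ℝ) : ℝ :=
  ∑ n ∈ Finset.Icc 1 ⌊x⌋₊, (tupleCount k n : ℝ) * (n : ℝ)⁻¹

lemma tupleInvSum_nonneg (k : ℕ) (x : ℝ) : 0 ≤ tupleInvSum k x :=
  Finset.sum_nonneg fun _ _ => by positivity

lemma tupleSum_nonneg (k : ℕ) (x : ℝ) : 0 ≤ tupleSum k x :=
  Finset.sum_nonneg fun _ _ => by positivity

lemma tupleInvSum_mono (k : ℕ) {x y : ℝ} (h : x ≤ y) : tupleInvSum k x ≤ tupleInvSum k y :=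
  Finset.sum_le_sum_of_subset_of_nonneg
    (Finset.Icc_subset_Icc_right (Nat.floor_le_floor h)) fun _ _ _ => by positivity

lemma tupleSum_mono (k : ℕ) {x y : ℝ} (h : x ≤ y) : tupleSum k x ≤ tupleSum k y :=
  Finset.sum_le_sum_of_subset_of_nonneg
    (Finset.Icc_subset_Icc_right (Nat.floor_le_floor h)) fun _ _ _ => by positivity

lemma tupleSum_eq_zero (k : ℕ) {x : ℝ} (h : x < 1) : tupleSum k x = 0 := by
  rw [tupleSum, Nat.floor_eq_zero.mpr h]; simp

lemma tupleInvSum_zero {x : ℝ} (hx : 1 ≤ x) : tupleInvSum 0 x = 1 := by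
  have h1 : 1 ∈ Finset.Icc 1 ⌊x⌋₊ := by simpa using hx
  rw [tupleInvSum, Finset.sum_eq_single_of_mem 1 h1]
  · simp [tupleCount]
  · intro n _ hn; simp [tupleCount, hn]

lemma tupleSum_zero {x : ℝ} (hx : 1 ≤ x) : tupleSum 0 x = 1 := by
  have h1 : 1 ∈ Finset.Icc 1 ⌊x⌋₊ := by simpa using hx
  rw [tupleSum, Finset.sum_eq_single_of_mem 1 h1]
  · simp [tupleCount]
  · intro n _ hn; simp [tupleCount, hn]

lemma tupleInvSum_succ (k : ℕ) (x : ℝ) :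
    tupleInvSum (k + 1) x = ∑ p ∈ Nat.primesLE ⌊x⌋₊, (p : ℝ)⁻¹ * tupleInvSum k (x / p) := by
  rw [tupleInvSum, sum_tupleCount_succ_eq_sum_primesLE k x fun n => (n : ℝ)⁻¹]
  refine Finset.sum_congr rfl fun p _ => ?_
  rw [tupleInvSum, Finset.mul_sum]
  refine Finset.sum_congr rfl fun m _ => ?_
  push_cast
  rw [mul_inv]; ring

lemma tupleInvSum_le_pow (k : ℕ) {x : ℝ} (hx : 1 ≤ x) :
    tupleInvSum k x ≤ (∑ p ∈ Nat.primesLE ⌊x⌋₊, (p : ℝ)⁻¹) ^ k := by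
  induction k with
  | zero => rw [tupleInvSum_zero hx, pow_zero]
  | succ k ih =>
    rw [tupleInvSum_succ, pow_succ', Finset.sum_mul]
    refine Finset.sum_le_sum fun p hp => ?_
    obtain ⟨pp, -⟩ := mem_primesLE_floor.mp hp
    have hp1 : (1 : ℝ) ≤ p := by exact_mod_cast pp.one_lt.le
    gcongr
    exact (tupleInvSum_mono k (div_le_self (by linarith) hp1)).trans ih

lemma pow_le_tupleInvSum (k : ℕ) {y : ℝ} (hy : 1 ≤ y) :
    (∑ p ∈ Nat.primesLE ⌊y⌋₊, (p : ℝ)⁻¹) ^ k ≤ tupleInvSum k (y ^ k) := by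
  induction k with
  | zero => rw [pow_zero, pow_zero, tupleInvSum_zero le_rfl]
  | succ k ih =>
    rw [tupleInvSum_succ, pow_succ', Finset.sum_mul]
    have hsub : Nat.primesLE ⌊y⌋₊ ⊆ Nat.primesLE ⌊y ^ (k + 1)⌋₊ := fun p hp => by
      rw [mem_primesLE_floor] at hp ⊢
      exact ⟨hp.1, hp.2.trans (le_self_pow₀ hy (by omega))⟩
    refine le_trans (Finset.sum_le_sum fun p hp => ?_)
      (Finset.sum_le_sum_of_subset_of_nonneg hsub fun p _ _ => ?_)
    · obtain ⟨pp, hpy⟩ := mem_primesLE_floor.mp hp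
      have hp0 : (0 : ℝ) < p := by exact_mod_cast pp.pos
      gcongr
      refine ih.trans (tupleInvSum_mono k ?_)
      rw [le_div_iff₀ hp0, pow_succ]
      gcongr
    · have := tupleInvSum_nonneg k (y ^ (k + 1) / p)
      positivity

lemma logEll_sub_le {x y a : ℝ} (hx : 1 ≤ x) (hy : 1 ≤ y) (ha : 1 ≤ a) (h : ell x ≤ a * ell y) :
    logEll x - logEll y ≤ log a := by
  have h1 := log_le_log (ell_pos hx) h
  rw [log_mul (by linarith) (ell_pos hy).ne'] at h1
  unfold logEll; linarith

lemma exists_abs_tupleInvSum_sub_le (k : ℕ) : ∃ C : ℝ, 0 < C ∧ ∀ x : ℝ, 1 ≤ x →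
    |tupleInvSum (k + 1) x - logEll x ^ (k + 1)| ≤ C * logEll x ^ k := by
  obtain ⟨C, hC, h⟩ := exists_abs_sum_primesLE_inv_sub_le
  set D := C + log (k + 1) with hD
  have hlk : 0 ≤ log ((k : ℝ) + 1) := log_nonneg (by linarith [k.cast_nonneg (α := ℝ)])
  have hD0 : 0 < D := by positivity
  have key : ∀ x s : ℝ, 1 ≤ x → 0 ≤ s → |s - logEll x| ≤ D →
      |s ^ (k + 1) - logEll x ^ (k + 1)| ≤ D * (k + 1) * (1 + D) ^ k * logEll x ^ k := by
    intro x s hx hs hsd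
    have h1 := one_le_logEll hx
    have h2 := logEll_pos hx
    have h3 := abs_pow_sub_pow_le s (logEll x) (k + 1)
    refine h3.trans ?_
    have h4 : max |s| |logEll x| ≤ (1 + D) * logEll x := by
      rw [abs_of_nonneg hs, abs_of_pos h2]
      have := (abs_le.mp hsd).2
      exact max_le (by nlinarith) (by nlinarith)
    have h5 : 0 ≤ max |s| |logEll x| := (abs_nonneg s).trans (le_max_left _ _)
    calc _ ≤ D * ((k + 1 : ℕ) : ℝ) * ((1 + D) * logEll x) ^ (k + 1 - 1) := by gcongr
      _ = _ := by rw [Nat.add_sub_cancel, mul_pow]; push_cast; ring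
  refine ⟨D * (k + 1) * (1 + D) ^ k, by positivity, fun x hx => ?_⟩
  have hx0 : 0 ≤ x := by linarith
  set y := x ^ (((k + 1 : ℕ) : ℝ)⁻¹) with hy
  have hyk : y ^ (k + 1) = x := rpow_inv_natCast_pow hx0 (by omega)
  have hy1 : 1 ≤ y := one_le_rpow hx (by positivity)
  have hyx : y ≤ x := hyk ▸ le_self_pow₀ hy1 (by omega)
  have hell : ell x ≤ (k + 1) * ell y := by
    have : log x = (k + 1) * log y := by rw [← hyk, log_pow]; push_cast; ring
    unfold ell; rw [this]; nlinarith [k.cast_nonneg (α := ℝ)]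
  have hsub := logEll_sub_le hx hy1 (by linarith [k.cast_nonneg (α := ℝ)]) hell
  have hmono := logEll_mono hy1 hyx
  have hup := tupleInvSum_le_pow (k + 1) hx
  have hlo := pow_le_tupleInvSum (k + 1) hy1
  rw [hyk] at hlo
  have a1 := abs_le.mp (h x hx)
  have a2 := abs_le.mp (h y hy1)
  have k1 := abs_le.mp (key x _ hx (Finset.sum_nonneg fun p _ => by positivity)
    (abs_le.mpr ⟨by linarith [a1.1], by linarith [a1.2]⟩ :
      |∑ p ∈ Nat.primesLE ⌊x⌋₊, (p : ℝ)⁻¹ - logEll x| ≤ D))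
  have k2 := abs_le.mp (key x _ hx (Finset.sum_nonneg fun p _ => by positivity)
    (abs_le.mpr ⟨by linarith [a2.1], by linarith [a2.2]⟩ :
      |∑ p ∈ Nat.primesLE ⌊y⌋₊, (p : ℝ)⁻¹ - logEll x| ≤ D))
  exact abs_le.mpr ⟨by linarith [k2.1], by linarith [k1.2]⟩

lemma exists_tupleInvSum_le (k : ℕ) : ∃ C : ℝ, 0 < C ∧ ∀ x : ℝ, 1 ≤ x →
    tupleInvSum k x ≤ C * logEll x ^ k := by
  cases k with
  | zero => exact ⟨1, one_pos, fun x hx => by rw [tupleInvSum_zero hx]; simp⟩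
  | succ k =>
    obtain ⟨C, hC, h⟩ := exists_abs_tupleInvSum_sub_le k
    refine ⟨C + 1, by positivity, fun x hx => ?_⟩
    have h1 := (abs_le.mp (h x hx)).2
    have h2 : C * logEll x ^ k ≤ C * logEll x ^ (k + 1) := by
      gcongr
      · exact one_le_logEll hx
      · omega
    linarith

lemma exists_sum_primesLE_inv_mul_rpow_le : ∃ C : ℝ, 0 < C ∧ ∀ x : ℝ, 1 ≤ x →
    ∑ p ∈ Nat.primesLE ⌊x⌋₊, (p : ℝ)⁻¹ * ell (x / p) ^ (-(1 / 22) : ℝ) ≤ C := by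
  obtain ⟨C, hC, h⟩ := exists_abs_sum_primesLE_inv_sub_le
  refine ⟨2 * (C + 23) + (2 * C + 1), by positivity, fun x hx => ?_⟩
  have hx0 : 0 < x := by linarith
  have hs1 : 1 ≤ √x := one_le_sqrt.mpr hx
  have hsx : √x ≤ x := by nlinarith [mul_self_sqrt hx0.le]
  have hl := ell_pos hx
  have hl1 := one_le_ell hx
  have hls : ell x ≤ 2 * ell √x := by
    unfold ell; rw [log_sqrt hx0.le]; linarith
  have hr : 0 < ell x ^ (-(1 / 22) : ℝ) := by positivity
  have hterm : ∀ p ∈ Nat.primesLE ⌊x⌋₊, (p : ℝ)⁻¹ * ell (x / p) ^ (-(1 / 22) : ℝ) ≤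
      2 * ell x ^ (-(1 / 22) : ℝ) * (p : ℝ)⁻¹ +
        ((p : ℝ)⁻¹ - if p ∈ Nat.primesLE ⌊√x⌋₊ then (p : ℝ)⁻¹ else 0) := by
    intro p hp
    obtain ⟨pp, hpx⟩ := mem_primesLE_floor.mp hp
    have hp0 : (0 : ℝ) < p := by exact_mod_cast pp.pos
    have hd : 1 ≤ x / p := (one_le_div hp0).mpr hpx
    split_ifs with hs
    · have hps := (mem_primesLE_floor.mp hs).2
      have h1 : √x ≤ x / p := by
        rw [le_div_iff₀ hp0]
        calc √x * p ≤ √x * √x := by gcongr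
          _ = x := mul_self_sqrt hx0.le
      have h2 : ell x / 2 ≤ ell (x / p) := by linarith [ell_mono hs1 h1]
      have h3 : ell (x / p) ^ (-(1 / 22) : ℝ) ≤ 2 * ell x ^ (-(1 / 22) : ℝ) := by
        calc _ ≤ (ell x / 2) ^ (-(1 / 22) : ℝ) :=
              rpow_le_rpow_of_nonpos (by positivity) h2 (by norm_num)
          _ = 2 ^ (1 / 22 : ℝ) * ell x ^ (-(1 / 22) : ℝ) := by
              rw [div_rpow hl.le zero_le_two, rpow_neg zero_le_two]; field_simp
          _ ≤ 2 * ell x ^ (-(1 / 22) : ℝ) := by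
              gcongr
              exact rpow_le_self_of_one_le (by norm_num) (by norm_num)
      rw [sub_self, add_zero, mul_comm]
      gcongr
    · have h3 : ell (x / p) ^ (-(1 / 22) : ℝ) ≤ 1 :=
        rpow_le_one_of_one_le_of_nonpos (one_le_ell hd) (by norm_num)
      have h4 : 0 ≤ 2 * ell x ^ (-(1 / 22) : ℝ) * (p : ℝ)⁻¹ := by positivity
      have h5 : (p : ℝ)⁻¹ * ell (x / p) ^ (-(1 / 22) : ℝ) ≤ (p : ℝ)⁻¹ * 1 := by gcongr
      linarith
  refine (Finset.sum_le_sum hterm).trans ?_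
  have hsub : Nat.primesLE ⌊√x⌋₊ ⊆ Nat.primesLE ⌊x⌋₊ := fun p hp => by
    rw [mem_primesLE_floor] at hp ⊢
    exact ⟨hp.1, hp.2.trans hsx⟩
  rw [Finset.sum_add_distrib, Finset.sum_sub_distrib, ← Finset.mul_sum, Finset.sum_ite_mem,
    Finset.inter_eq_right.mpr hsub]
  have a1 := abs_le.mp (h x hx)
  have a2 := abs_le.mp (h (√x) hs1)
  have a3 := logEll_sub_le hx hs1 one_le_two hls
  have hl2 : log 2 ≤ 1 := by linarith [log_le_sub_one_of_pos (show (0 : ℝ) < 2 by norm_num)]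
  have b1 : ell x ^ (-(1 / 22) : ℝ) * (logEll x + C) ≤ C + 23 := by
    have h1 := log_le_rpow_div hl.le (show (0 : ℝ) < 1 / 22 by norm_num)
    have h2 : ell x ^ (-(1 / 22) : ℝ) * ell x ^ (1 / 22 : ℝ) = 1 := by
      rw [← rpow_add hl]; norm_num
    have h3 : ell x ^ (-(1 / 22) : ℝ) ≤ 1 := rpow_le_one_of_one_le_of_nonpos hl1 (by norm_num)
    have h4 : logEll x ≤ 1 + 22 * ell x ^ (1 / 22 : ℝ) := by
      unfold logEll
      have : ell x ^ (1 / 22 : ℝ) / (1 / 22) = 22 * ell x ^ (1 / 22 : ℝ) := by ring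
      linarith
    calc _ ≤ ell x ^ (-(1 / 22) : ℝ) * (1 + 22 * ell x ^ (1 / 22 : ℝ) + C) := by gcongr
      _ = (1 + C) * ell x ^ (-(1 / 22) : ℝ) +
          22 * (ell x ^ (-(1 / 22) : ℝ) * ell x ^ (1 / 22 : ℝ)) := by ring
      _ ≤ (1 + C) * 1 + 22 * 1 := by rw [h2]; gcongr
      _ = C + 23 := by ring
  have b2 : 2 * ell x ^ (-(1 / 22) : ℝ) * ∑ p ∈ Nat.primesLE ⌊x⌋₊, (p : ℝ)⁻¹ ≤
      2 * (ell x ^ (-(1 / 22) : ℝ) * (logEll x + C)) := by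
    rw [mul_assoc]
    gcongr
    linarith [a1.2]
  linarith [a1.2, a2.1]

/-- The contribution of the error term of the prime number theorem. -/
lemma exists_sum_tupleCount_mul_rpow_le (k : ℕ) : ∃ C : ℝ, 0 < C ∧ ∀ x : ℝ, 1 ≤ x →
    ∑ n ∈ Finset.Icc 1 ⌊x⌋₊, (tupleCount (k + 1) n : ℝ) *
      ((n : ℝ)⁻¹ * ell (x / n) ^ (-(1 / 22) : ℝ)) ≤ C * logEll x ^ k := by
  obtain ⟨C, hC, h⟩ := exists_sum_primesLE_inv_mul_rpow_le
  obtain ⟨D, hD, hL⟩ := exists_tupleInvSum_le k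
  refine ⟨C * D, by positivity, fun x hx => ?_⟩
  rw [sum_tupleCount_succ_eq_sum_Icc k x fun n => (n : ℝ)⁻¹ * ell (x / n) ^ (-(1 / 22) : ℝ)]
  calc _ ≤ ∑ m ∈ Finset.Icc 1 ⌊x⌋₊, (tupleCount k m : ℝ) * ((m : ℝ)⁻¹ * C) := by
        refine Finset.sum_le_sum fun m hm => ?_
        obtain ⟨-, h2⟩ := one_le_div_of_mem_Icc hm
        gcongr
        calc _ = (m : ℝ)⁻¹ * ∑ p ∈ Nat.primesLE ⌊x / m⌋₊,
              (p : ℝ)⁻¹ * ell (x / m / p) ^ (-(1 / 22) : ℝ) := by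
              rw [Finset.mul_sum]
              refine Finset.sum_congr rfl fun p _ => ?_
              push_cast
              rw [mul_inv, div_div, mul_comm (m : ℝ) p]; ring
          _ ≤ _ := by gcongr; exact h _ h2
    _ = C * tupleInvSum k x := by
        rw [tupleInvSum, Finset.mul_sum]
        exact Finset.sum_congr rfl fun m _ => by ring
    _ ≤ C * (D * logEll x ^ k) := by gcongr; exact hL x hx
    _ = _ := by ring

end TupleSums

section TupleAsymptotics

open Chebyshev

/-- The comparison function `x (log log x)^j / log x`, normalised to be positive on `[1, ∞)`. -/
noncomputable def errScale (j : ℕ) (x : ℝ) : ℝ := x * logEll x ^ j / ell x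

lemma errScale_pos (j : ℕ) {x : ℝ} (hx : 1 ≤ x) : 0 < errScale j x := by
  have := ell_pos hx
  have := logEll_pos hx
  unfold errScale; positivity

lemma errScale_mono (x : ℝ) (hx : 1 ≤ x) {i j : ℕ} (h : i ≤ j) : errScale i x ≤ errScale j x := by
  have := ell_pos hx
  have := one_le_logEll hx
  unfold errScale; gcongr

lemma ell_le_self {x : ℝ} (hx : 1 ≤ x) : ell x ≤ x := by
  have := log_le_sub_one_of_pos (show 0 < x by linarith)
  unfold ell; linarith

lemma ell_le_mul_ell {y μ : ℝ} (hμ : 1 ≤ μ) (hy : 1 ≤ y / μ) : ell y ≤ ell (y / μ) * ell μ := by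
  have hμ0 : 0 < μ := by linarith
  have hy0 : 0 < y / μ := by linarith
  have e : log y = log (y / μ) + log μ := by
    rw [← log_mul hy0.ne' hμ0.ne', div_mul_cancel₀ _ hμ0.ne']
  unfold ell
  nlinarith [mul_nonneg (log_nonneg hy) (log_nonneg hμ)]

lemma div_le_self_of_one_le {y μ : ℝ} (hμ : 1 ≤ μ) (hy : 1 ≤ y / μ) : y / μ ≤ y := by
  have hμ0 : 0 < μ := by linarith
  have h : y = y / μ * μ := (div_mul_cancel₀ _ hμ0.ne').symm
  nlinarith

lemma inv_ell_div_le {y μ : ℝ} (hμ : 1 ≤ μ) (hy : 1 ≤ y / μ) :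
    1 / ell (y / μ) ≤ ell μ / ell y := by
  have hy1 : 1 ≤ y := hy.trans (div_le_self_of_one_le hμ hy)
  rw [div_le_div_iff₀ (ell_pos hy) (ell_pos hy1), one_mul, mul_comm]
  exact ell_le_mul_ell hμ hy

lemma errScale_div_le (j : ℕ) {y μ : ℝ} (hμ : 1 ≤ μ) (hy : 1 ≤ y / μ) :
    errScale j (y / μ) ≤ errScale j y * (ell μ / μ) := by
  have hμ0 : 0 < μ := by linarith
  have hle := div_le_self_of_one_le hμ hy
  have h1 := logEll_mono hy hle
  have h2 := logEll_pos hy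
  have h3 := logEll_pos (hy.trans hle)
  have h0 : 0 ≤ y := by linarith
  have h4 := ell_pos hy
  calc errScale j (y / μ) = y / μ * logEll (y / μ) ^ j * (1 / ell (y / μ)) := by
        unfold errScale; ring
    _ ≤ y / μ * logEll y ^ j * (ell μ / ell y) := by
        refine mul_le_mul ?_ (inv_ell_div_le hμ hy) (by positivity) (by positivity)
        gcongr
    _ = errScale j y * (ell μ / μ) := by unfold errScale; ring

lemma ell_le_four_mul_sqrt {x : ℝ} (hx : 1 ≤ x) : ell x ≤ 4 * √x := by
  have h1 := ell_sq_le hx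
  have h2 : 1 ≤ √x := one_le_sqrt.mpr hx
  have h3 := ell_pos hx
  nlinarith

lemma sum_inv_sqrt_le (N : ℕ) : ∑ n ∈ Finset.Icc 1 N, (√(n : ℝ))⁻¹ ≤ 2 * √(N : ℝ) := by
  induction N with
  | zero => simp
  | succ N ih =>
    rw [Finset.sum_Icc_succ_top (by omega)]
    have a : 0 < √((N + 1 : ℕ) : ℝ) := by positivity
    have b : √((N + 1 : ℕ) : ℝ) * √((N + 1 : ℕ) : ℝ) = N + 1 := by
      rw [mul_self_sqrt (by positivity)]; push_cast; ring
    have c : √(N : ℝ) * √(N : ℝ) = N := mul_self_sqrt (by positivity)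
    have d : (√((N + 1 : ℕ) : ℝ))⁻¹ ≤ 2 * √((N + 1 : ℕ) : ℝ) - 2 * √(N : ℝ) := by
      rw [inv_le_iff_one_le_mul₀ a]
      nlinarith [sq_nonneg (√((N + 1 : ℕ) : ℝ) - √(N : ℝ))]
    linarith

lemma tupleSum_mul_ell (k : ℕ) {x : ℝ} (hx : 1 ≤ x) :
    tupleSum k x * ell x = ∑ n ∈ Finset.Icc 1 ⌊x⌋₊, (tupleCount k n : ℝ) * log n +
      ∑ n ∈ Finset.Icc 1 ⌊x⌋₊, (tupleCount k n : ℝ) * ell (x / n) := by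
  rw [tupleSum, Finset.sum_mul, ← Finset.sum_add_distrib]
  refine Finset.sum_congr rfl fun n hn => ?_
  have h1 := (one_le_div_of_mem_Icc hn).1
  unfold ell
  rw [log_div (by linarith) (by linarith)]
  ring

lemma sum_tupleCount_mul_ell_nonneg (k : ℕ) (x : ℝ) :
    0 ≤ ∑ n ∈ Finset.Icc 1 ⌊x⌋₊, (tupleCount k n : ℝ) * ell (x / n) :=
  Finset.sum_nonneg fun _ hn =>
    mul_nonneg (Nat.cast_nonneg _) (ell_pos (one_le_div_of_mem_Icc hn).2).le

lemma sum_tupleCount_mul_ell_le (k : ℕ) {x : ℝ} (hx : 1 ≤ x) :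
    ∑ n ∈ Finset.Icc 1 ⌊x⌋₊, (tupleCount k n : ℝ) * ell (x / n) ≤ 8 * k.factorial * x := by
  have hx0 : 0 ≤ x := by linarith
  calc _ ≤ ∑ n ∈ Finset.Icc 1 ⌊x⌋₊, (k.factorial : ℝ) * (4 * √x * (√(n : ℝ))⁻¹) := by
        refine Finset.sum_le_sum fun n hn => ?_
        have h1 := (one_le_div_of_mem_Icc hn).2
        have h2 : n ≠ 0 := by rw [Finset.mem_Icc] at hn; omega
        have h3 : ell (x / n) ≤ 4 * √x * (√(n : ℝ))⁻¹ := by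
          refine (ell_le_four_mul_sqrt h1).trans_eq ?_
          rw [sqrt_div hx0]; ring
        have h4 : (tupleCount k n : ℝ) ≤ k.factorial := by
          exact_mod_cast tupleCount_le_factorial k h2
        have := ell_pos h1
        gcongr
    _ = k.factorial * (4 * √x) * ∑ n ∈ Finset.Icc 1 ⌊x⌋₊, (√(n : ℝ))⁻¹ := by
        rw [Finset.mul_sum]
        exact Finset.sum_congr rfl fun n _ => by ring
    _ ≤ k.factorial * (4 * √x) * (2 * √x) := by
        gcongr
        refine (sum_inv_sqrt_le _).trans ?_
        gcongr
        exact Nat.floor_le hx0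
    _ = 8 * k.factorial * (√x * √x) := by ring
    _ = _ := by rw [mul_self_sqrt hx0]

lemma exists_tupleSum_succ_le (j : ℕ) : ∃ C : ℝ, 0 < C ∧ ∀ x : ℝ, 1 ≤ x →
    tupleSum (j + 1) x ≤ C * errScale j x := by
  obtain ⟨D, hD, hL⟩ := exists_tupleInvSum_le j
  have hlog4 : 0 < log 4 := log_pos (by norm_num)
  refine ⟨(j + 1) * (log 4 * D) + 8 * (j + 1).factorial, by positivity, fun x hx => ?_⟩
  have hx0 : 0 < x := by linarith
  have hl := ell_pos hx
  have hp : 1 ≤ logEll x ^ j := one_le_pow₀ (one_le_logEll hx)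
  have h1 : ∑ m ∈ Finset.Icc 1 ⌊x⌋₊, (tupleCount j m : ℝ) * θ (x / m) ≤
      log 4 * x * tupleInvSum j x := by
    rw [tupleInvSum, Finset.mul_sum]
    refine Finset.sum_le_sum fun m hm => ?_
    have h2 := theta_le_log4_mul_x (show 0 ≤ x / m by positivity)
    calc _ ≤ (tupleCount j m : ℝ) * (log 4 * (x / m)) := by gcongr
      _ = _ := by ring
  have h2 : tupleSum (j + 1) x * ell x ≤
      ((j + 1) * (log 4 * D) + 8 * (j + 1).factorial) * (x * logEll x ^ j) := by
    rw [tupleSum_mul_ell _ hx, sum_tupleCount_mul_log]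
    have h3 := sum_tupleCount_mul_ell_le (j + 1) hx
    calc _ ≤ (j + 1) * (log 4 * x * (D * logEll x ^ j)) +
          8 * (j + 1).factorial * (x * logEll x ^ j) := by
          refine add_le_add ?_ (h3.trans ?_)
          · gcongr
            exact h1.trans (by gcongr; exact hL x hx)
          · gcongr
            exact le_mul_of_one_le_right hx0.le hp
      _ = _ := by ring
  rw [errScale, ← mul_div_assoc, le_div_iff₀ hl]
  exact h2

lemma exists_tupleSum_le (j : ℕ) : ∃ C : ℝ, 0 < C ∧ ∀ x : ℝ, 1 ≤ x →
    tupleSum j x ≤ C * errScale j x := by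
  cases j with
  | zero =>
    refine ⟨1, one_pos, fun x hx => ?_⟩
    rw [tupleSum_zero hx, errScale, pow_zero, mul_one, one_mul, one_le_div (ell_pos hx)]
    exact ell_le_self hx
  | succ j =>
    obtain ⟨C, hC, h⟩ := exists_tupleSum_succ_le j
    refine ⟨C, hC, fun x hx => (h x hx).trans ?_⟩
    gcongr
    exact errScale_mono x hx (Nat.le_succ j)

lemma exists_abs_tupleSum_sub_le (K : ℕ) : ∃ C : ℝ, 0 < C ∧ ∀ x : ℝ, 1 ≤ x →
    |tupleSum (K + 2) x - (K + 2) * errScale (K + 1) x| ≤ C * errScale K x := by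
  obtain ⟨A, hA, hT⟩ := exists_abs_theta_sub_le
  obtain ⟨B, hB, hS⟩ := exists_sum_tupleCount_mul_rpow_le K
  obtain ⟨D, hD, hL⟩ := exists_abs_tupleInvSum_sub_le K
  refine ⟨(K + 2) * (A * B) + (K + 2) * D + 8 * (K + 2).factorial, by positivity, fun x hx => ?_⟩
  have hx0 : 0 < x := by linarith
  have hl := ell_pos hx
  have hp : 1 ≤ logEll x ^ K := one_le_pow₀ (one_le_logEll hx)
  set S := ∑ m ∈ Finset.Icc 1 ⌊x⌋₊, (tupleCount (K + 1) m : ℝ) * θ (x / m) with hSdef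
  set E := ∑ n ∈ Finset.Icc 1 ⌊x⌋₊, (tupleCount (K + 2) n : ℝ) * ell (x / n) with hE
  have h1 : |S - x * tupleInvSum (K + 1) x| ≤ A * B * (x * logEll x ^ K) := by
    rw [hSdef, tupleInvSum, Finset.mul_sum, ← Finset.sum_sub_distrib]
    calc _ ≤ ∑ m ∈ Finset.Icc 1 ⌊x⌋₊, A * x * ((tupleCount (K + 1) m : ℝ) *
          ((m : ℝ)⁻¹ * ell (x / m) ^ (-(1 / 22) : ℝ))) := by
          refine (Finset.abs_sum_le_sum_abs _ _).trans (Finset.sum_le_sum fun m hm => ?_)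
          have h2 := hT _ (one_le_div_of_mem_Icc hm).2
          calc _ = |(tupleCount (K + 1) m : ℝ) * (θ (x / m) - x / m)| := by
                congr 1; ring
            _ = (tupleCount (K + 1) m : ℝ) * |θ (x / m) - x / m| := by
                rw [abs_mul, Nat.abs_cast]
            _ ≤ (tupleCount (K + 1) m : ℝ) * (A * (x / m) * ell (x / m) ^ (-(1 / 22) : ℝ)) := by
                gcongr
            _ = _ := by ring
      _ ≤ A * x * (B * logEll x ^ K) := by
          rw [← Finset.mul_sum]
          gcongr
          exact hS x hx
      _ = _ := by ring
  have h2 : |x * tupleInvSum (K + 1) x - x * logEll x ^ (K + 1)| ≤ D * (x * logEll x ^ K) := by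
    rw [← mul_sub, abs_mul, abs_of_pos hx0]
    calc _ ≤ x * (D * logEll x ^ K) := by gcongr; exact hL x hx
      _ = _ := by ring
  have h3 : |E| ≤ 8 * (K + 2).factorial * (x * logEll x ^ K) := by
    rw [abs_of_nonneg (sum_tupleCount_mul_ell_nonneg _ _)]
    refine (sum_tupleCount_mul_ell_le _ hx).trans ?_
    gcongr
    exact le_mul_of_one_le_right hx0.le hp
  have h4 : tupleSum (K + 2) x * ell x = (K + 2) * S + E := by
    rw [tupleSum_mul_ell _ hx, sum_tupleCount_mul_log]; push_cast; ring
  have h5 : tupleSum (K + 2) x - (K + 2) * errScale (K + 1) x =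
      ((K + 2) * (S - x * tupleInvSum (K + 1) x) +
        (K + 2) * (x * tupleInvSum (K + 1) x - x * logEll x ^ (K + 1)) + E) / ell x := by
    rw [eq_div_iff hl.ne', sub_mul, h4, errScale]
    field_simp
    ring
  rw [h5, abs_div, abs_of_pos hl, errScale, ← mul_div_assoc]
  gcongr
  refine (abs_add_le _ _).trans ?_
  have h6 := abs_add_le ((K + 2 : ℝ) * (S - x * tupleInvSum (K + 1) x))
    ((K + 2) * (x * tupleInvSum (K + 1) x - x * logEll x ^ (K + 1)))
  rw [abs_mul, abs_mul, abs_of_pos (show (0 : ℝ) < K + 2 by positivity)] at h6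
  have h7 : (K + 2 : ℝ) * |S - x * tupleInvSum (K + 1) x| ≤
      (K + 2) * (A * B * (x * logEll x ^ K)) := by gcongr
  have h8 : (K + 2 : ℝ) * |x * tupleInvSum (K + 1) x - x * logEll x ^ (K + 1)| ≤
      (K + 2) * (D * (x * logEll x ^ K)) := by gcongr
  linarith

lemma le_errScale_mul_of_le {f : ℝ → ℝ} {C : ℝ} {j : ℕ} (hC : 0 ≤ C)
    (hf : ∀ x, 1 ≤ x → f x ≤ C * errScale j x) (hf0 : ∀ x, x < 1 → f x = 0)
    {y μ : ℝ} (hy : 1 ≤ y) (hμ : 1 ≤ μ) : f (y / μ) ≤ C * errScale j y * (ell μ / μ) := by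
  have hl := ell_pos hμ
  have hB := errScale_pos j hy
  rcases lt_or_ge (y / μ) 1 with h | h
  · rw [hf0 _ h]; positivity
  · calc _ ≤ C * errScale j (y / μ) := hf _ h
      _ ≤ C * (errScale j y * (ell μ / μ)) := by gcongr; exact errScale_div_le j hμ h
      _ = _ := by ring

lemma abs_errScale_div_sub_le (K : ℕ) {y μ : ℝ} (hμ : 1 ≤ μ) (hy : 1 ≤ y / μ) :
    |errScale (K + 1) (y / μ) - errScale (K + 1) y / μ| ≤
      (K + 2) * (errScale K y * (ell μ / μ)) := by
  have hμ0 : 0 < μ := by linarith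
  have hle := div_le_self_of_one_le hμ hy
  have hy1 : 1 ≤ y := hy.trans hle
  set z := y / μ with hz
  have hz0 : 0 < z := by linarith
  have hlz := ell_pos hy
  have hly := ell_pos hy1
  have hLz := logEll_pos hy
  have hLy := logEll_pos hy1
  have hLm := logEll_mono hy hle
  have hlm := ell_mono hy hle
  have hL : logEll y - logEll z ≤ ell μ := by
    have h1 := logEll_sub_le hy1 hy (one_le_ell hμ) (by rw [mul_comm]; exact ell_le_mul_ell hμ hy)
    have h2 := log_le_sub_one_of_pos (ell_pos hμ)
    linarith
  have hell : ell y - ell z ≤ ell μ := by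
    have : log y = log z + log μ := by
      rw [← log_mul hz0.ne' hμ0.ne', hz, div_mul_cancel₀ _ hμ0.ne']
    unfold ell; linarith
  have e : errScale (K + 1) z - errScale (K + 1) y / μ =
      z * (logEll z ^ (K + 1) * (ell y - ell z) / (ell z * ell y)) -
      z * ((logEll y ^ (K + 1) - logEll z ^ (K + 1)) / ell y) := by
    have : errScale (K + 1) y / μ = z * (logEll y ^ (K + 1) / ell y) := by
      rw [errScale, hz]; ring
    rw [this, errScale]
    field_simp
    ring
  have p1 : logEll z ^ (K + 1) * (ell y - ell z) / (ell z * ell y) ≤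
      logEll y ^ K * ell μ / ell y := by
    have h1 : logEll z ^ (K + 1) ≤ logEll y ^ K * ell z := by
      rw [pow_succ]; gcongr; exact logEll_le_ell hy
    calc _ ≤ logEll y ^ K * ell z * ell μ / (ell z * ell y) := by
          have : 0 ≤ ell y - ell z := by linarith
          gcongr
      _ = _ := by field_simp
  have p2 : (logEll y ^ (K + 1) - logEll z ^ (K + 1)) / ell y ≤
      (K + 1) * (logEll y ^ K * ell μ / ell y) := by
    have h1 := abs_pow_sub_pow_le (logEll y) (logEll z) (K + 1)
    rw [abs_of_pos hLy, abs_of_pos hLz, max_eq_left hLm,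
      abs_of_nonneg (sub_nonneg.mpr hLm)] at h1
    have h2 := (le_abs_self _).trans h1
    rw [← mul_div_assoc]
    gcongr
    refine h2.trans ?_
    push_cast
    calc _ ≤ ell μ * (K + 1) * logEll y ^ K := by gcongr
      _ = _ := by ring
  have q1 : 0 ≤ logEll z ^ (K + 1) * (ell y - ell z) / (ell z * ell y) := by
    have : 0 ≤ ell y - ell z := by linarith
    positivity
  have q2 : 0 ≤ (logEll y ^ (K + 1) - logEll z ^ (K + 1)) / ell y := by
    have : logEll z ^ (K + 1) ≤ logEll y ^ (K + 1) := by gcongr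
    have : 0 ≤ logEll y ^ (K + 1) - logEll z ^ (K + 1) := by linarith
    positivity
  have hm := ell_pos hμ
  have r : errScale K y * (ell μ / μ) = z * (logEll y ^ K * ell μ / ell y) := by
    rw [errScale, hz]; ring
  rw [e, r, ← mul_sub, abs_mul, abs_of_pos hz0]
  have : |logEll z ^ (K + 1) * (ell y - ell z) / (ell z * ell y) -
      (logEll y ^ (K + 1) - logEll z ^ (K + 1)) / ell y| ≤
      (K + 2) * (logEll y ^ K * ell μ / ell y) := by
    have h0 : 0 ≤ logEll y ^ K * ell μ / ell y := by positivity
    have h1 : 0 ≤ (K : ℝ) * (logEll y ^ K * ell μ / ell y) := by positivity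
    rw [abs_le]; constructor <;> nlinarith
  calc _ ≤ z * ((K + 2) * (logEll y ^ K * ell μ / ell y)) := by gcongr
    _ = _ := by ring

/-- The asymptotics of `tupleSum` at `y / μ`, uniformly in `μ ≥ 1`. -/
lemma exists_abs_tupleSum_div_sub_le (K : ℕ) : ∃ C : ℝ, 0 < C ∧ ∀ y μ : ℝ, 1 ≤ y → 1 ≤ μ →
    |tupleSum (K + 2) (y / μ) - (K + 2) * errScale (K + 1) y / μ| ≤
      C * errScale K y * (ell μ / μ) := by
  obtain ⟨C, hC, h⟩ := exists_abs_tupleSum_sub_le K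
  refine ⟨C + (K + 2) * (K + 2), by positivity, fun y μ hy hμ => ?_⟩
  have hμ0 : 0 < μ := by linarith
  have hl := ell_pos hμ
  have hly := ell_pos hy
  have hB := errScale_pos K hy
  have hLy := logEll_pos hy
  rcases lt_or_ge (y / μ) 1 with hlt | hge
  · rw [tupleSum_eq_zero _ hlt, zero_sub, abs_neg, abs_of_nonneg
      (by have := errScale_pos (K + 1) hy; positivity)]
    have h1 : y ≤ μ := by rw [div_lt_one hμ0] at hlt; exact hlt.le
    have h2 : errScale (K + 1) y ≤ errScale K y * ell μ := by
      calc errScale (K + 1) y = errScale K y * logEll y := by unfold errScale; ring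
        _ ≤ errScale K y * ell μ := by
          gcongr
          exact (logEll_le_ell hy).trans (ell_mono hy h1)
    calc _ ≤ (K + 2) * (errScale K y * ell μ) / μ := by gcongr
      _ = (K + 2) * (errScale K y * (ell μ / μ)) := by ring
      _ ≤ (C + (K + 2) * (K + 2)) * (errScale K y * (ell μ / μ)) := by
        refine mul_le_mul_of_nonneg_right ?_ (by positivity)
        have : (0 : ℝ) ≤ K := by positivity
        nlinarith
      _ = _ := by ring
  · have h1 := h _ hge
    have h2 := abs_errScale_div_sub_le K hμ hge
    have h3 := errScale_div_le K hμ hge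
    have e : tupleSum (K + 2) (y / μ) - (K + 2) * errScale (K + 1) y / μ =
        (tupleSum (K + 2) (y / μ) - (K + 2) * errScale (K + 1) (y / μ)) +
        (K + 2) * (errScale (K + 1) (y / μ) - errScale (K + 1) y / μ) := by ring
    rw [e]
    refine (abs_add_le _ _).trans ?_
    rw [abs_mul, abs_of_pos (show (0 : ℝ) < K + 2 by positivity)]
    calc _ ≤ C * (errScale K y * (ell μ / μ)) +
          (K + 2) * ((K + 2) * (errScale K y * (ell μ / μ))) := by
          refine add_le_add (h1.trans ?_) ?_ <;> gcongr
      _ = _ := by ring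

end TupleAsymptotics

section PrimeProducts

open ArithmeticFunction hiding log

lemma summable_fin_prod {r : ℕ} {f : Fin r → ℕ → ℝ} (h0 : ∀ i n, 0 ≤ f i n)
    (hf : ∀ i, Summable (f i)) : Summable fun p : Fin r → ℕ => ∏ i, f i (p i) := by
  induction r with
  | zero => exact Summable.of_finite
  | succ r ih =>
    rw [← (Fin.consEquiv fun _ : Fin (r + 1) => ℕ).summable_iff]
    have := (hf 0).mul_of_nonneg (ih (f := fun i => f i.succ) (fun i => h0 _) fun i => hf _)
      (h0 0) fun p => Finset.prod_nonneg fun i _ => h0 _ _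
    refine this.congr fun p => ?_
    simp [Fin.prod_univ_succ, Fin.consEquiv]

lemma pos_of_mem_Psigma {r : ℕ} {β : Fin r → ℕ} {m : ℕ} (hm : m ∈ Psigma β) : 0 < m := by
  obtain ⟨p, hp, rfl⟩ := hm
  exact Finset.prod_pos fun i _ => pow_pos (hp i).pos _

lemma summable_Psigma_rpow {r : ℕ} {β : Fin r → ℕ} {s : ℝ} (hs : ∀ i, 1 < β i * s) :
    Summable fun m : Psigma β => ((m : ℕ) : ℝ) ^ (-s) := by
  have hsum : Summable fun p : Fin r → ℕ => ∏ i, (p i : ℝ) ^ (-(β i * s)) :=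
    summable_fin_prod (f := fun i n => (n : ℝ) ^ (-(β i * s)))
      (fun i n => by positivity)
      fun i => Real.summable_nat_rpow.mpr (by linarith [hs i])
  choose p _ hm using fun m : Psigma β => m.2
  have hinj : Function.Injective p := fun m m' h => by
    rw [Subtype.ext_iff, hm m, hm m', h]
  refine (hsum.comp_injective hinj).congr fun m => ?_
  simp only [Function.comp_apply]
  conv_rhs => rw [hm m]
  push_cast
  rw [← Real.finsetProd_rpow _ _ fun i _ => by positivity]
  refine Finset.prod_congr rfl fun i _ => ?_
  rw [← rpow_natCast, ← rpow_mul (by positivity)]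
  congr 1; ring

lemma one_le_rpow_of_mem_Psigma {r : ℕ} {β : Fin r → ℕ} (m : Psigma β) (α : ℕ) :
    1 ≤ ((m : ℕ) : ℝ) ^ ((1 : ℝ) / α) :=
  one_le_rpow (by exact_mod_cast pos_of_mem_Psigma m.2) (by positivity)

lemma summable_Psigma_ell_div {r α : ℕ} {β : Fin r → ℕ} (hα : 0 < α) (h : ∀ i, α < β i) :
    Summable fun m : Psigma β =>
      ell (((m : ℕ) : ℝ) ^ ((1 : ℝ) / α)) / ((m : ℕ) : ℝ) ^ ((1 : ℝ) / α) := by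
  have hα0 : (0 : ℝ) < α := by exact_mod_cast hα
  have hs := summable_Psigma_rpow (β := β) (s := 2 / (2 * α + 1)) fun i => by
    have : (α : ℝ) + 1 ≤ β i := by exact_mod_cast h i
    rw [← mul_div_assoc, one_lt_div (by positivity)]
    linarith
  refine Summable.of_nonneg_of_le (fun m => ?_) (fun m => ?_) (hs.mul_left (2 * α + 2 : ℝ))
  · have h1 := one_le_rpow_of_mem_Psigma m α
    have := ell_pos h1
    positivity
  · have h1 := one_le_rpow_of_mem_Psigma m α
    have hm : (0 : ℝ) < (m : ℕ) := by exact_mod_cast pos_of_mem_Psigma m.2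
    set μ := ((m : ℕ) : ℝ) ^ ((1 : ℝ) / α) with hμ
    have hμ0 : 0 < μ := by linarith
    have h2 := log_le_rpow_div hμ0.le (show (0 : ℝ) < 1 / (2 * α + 1) by positivity)
    have h3 : 1 ≤ μ ^ (1 / (2 * α + 1) : ℝ) := one_le_rpow h1 (by positivity)
    have h4 : μ ^ (1 / (2 * α + 1) : ℝ) / (1 / (2 * α + 1)) =
        (2 * α + 1) * μ ^ (1 / (2 * α + 1) : ℝ) := by field_simp
    have h5 : ((m : ℕ) : ℝ) ^ (-(2 / (2 * α + 1) : ℝ)) = μ ^ (1 / (2 * α + 1) : ℝ) / μ := by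
      rw [← rpow_sub_one hμ0.ne', hμ, ← rpow_mul hm.le]
      congr 1; field_simp; ring
    rw [h5, ← mul_div_assoc]
    gcongr
    unfold ell
    linarith

lemma card_primeFactors_le_of_mem_Psigma {r : ℕ} {β : Fin r → ℕ} {m : ℕ} (hm : m ∈ Psigma β) :
    m.primeFactors.card ≤ r := by
  obtain ⟨p, hp, rfl⟩ := hm
  calc _ ≤ (Finset.univ.image p).card := by
        refine Finset.card_le_card fun q hq => ?_
        obtain ⟨hqp, hqd, -⟩ := Nat.mem_primeFactors.mp hq
        obtain ⟨i, -, hi⟩ := (hqp.prime.dvd_finsetProd_iff _).mp hqd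
        exact Finset.mem_image.mpr ⟨i, Finset.mem_univ _,
          ((Nat.prime_dvd_prime_iff_eq hqp (hp i)).mp (hqp.dvd_of_dvd_pow hi)).symm⟩
    _ ≤ r := Finset.card_image_le.trans_eq (by simp)

lemma lt_factorization_of_mem_Psigma {r α : ℕ} {β : Fin r → ℕ} (h : ∀ i, α < β i) {m q : ℕ}
    (hm : m ∈ Psigma β) (hq : q.Prime) (hqm : q ∣ m) : α < m.factorization q := by
  have hm0 := (pos_of_mem_Psigma hm).ne'
  obtain ⟨p, hp, rfl⟩ := hm
  obtain ⟨i, -, hi⟩ := (hq.prime.dvd_finsetProd_iff _).mp hqm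
  have hqi : q = p i := (Nat.prime_dvd_prime_iff_eq hq (hp i)).mp (hq.dvd_of_dvd_pow hi)
  refine (h i).trans_le ((hq.pow_dvd_iff_le_factorization hm0).mp ?_)
  rw [hqi]
  exact Finset.dvd_prod_of_mem (fun i => p i ^ β i) (Finset.mem_univ i)

lemma mem_Psigma_append_iff {k r α : ℕ} {β : Fin r → ℕ} {n : ℕ} :
    n ∈ Psigma (Fin.append (fun _ : Fin k => α) β) ↔
      ∃ a m, a ≠ 0 ∧ cardFactors a = k ∧ m ∈ Psigma β ∧ n = a ^ α * m := by
  constructor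
  · rintro ⟨p, hp, rfl⟩
    have hne : ∀ s : Finset (Fin k), ∏ i ∈ s, p (Fin.castAdd r i) ≠ 0 := fun s =>
      Finset.prod_ne_zero_iff.mpr fun i _ => (hp _).ne_zero
    have hΩ : ∀ s : Finset (Fin k), cardFactors (∏ i ∈ s, p (Fin.castAdd r i)) = s.card := by
      intro s
      induction s using Finset.induction_on with
      | empty => simp
      | insert i s hi ih =>
        rw [Finset.prod_insert hi, cardFactors_mul (hp _).ne_zero (hne s), ih,
          cardFactors_apply_prime (hp _), Finset.card_insert_of_notMem hi, add_comm]
    refine ⟨∏ i : Fin k, p (Fin.castAdd r i), ∏ i : Fin r, p (Fin.natAdd k i) ^ β i,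
      hne _, by rw [hΩ]; simp, ⟨fun i => p (Fin.natAdd k i), fun i => hp _, rfl⟩, ?_⟩
    rw [Fin.prod_univ_add, ← Finset.prod_pow]
    simp
  · rintro ⟨a, m, ha, hΩ, ⟨p, hp, rfl⟩, rfl⟩
    rw [cardFactors_apply] at hΩ
    subst hΩ
    refine ⟨Fin.append (fun i => a.primeFactorsList.get i) p, fun i => ?_, ?_⟩
    · refine Fin.addCases (fun i => ?_) (fun i => ?_) i
      · rw [Fin.append_left]
        exact Nat.prime_of_mem_primeFactorsList (List.get_mem _ _)
      · rw [Fin.append_right]; exact hp i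
    · rw [Fin.prod_univ_add]
      simp only [Fin.append_left, Fin.append_right]
      rw [Finset.prod_pow]
      congr 2
      rw [← List.prod_ofFn, List.ofFn_get, Nat.prod_primeFactorsList ha]

lemma pow_mul_injective {r α : ℕ} (hα : 0 < α) {β : Fin r → ℕ} (h : ∀ i, α < β i)
    {a b m l : ℕ} (ha : Squarefree a) (hb : Squarefree b) (hm : m ∈ Psigma β) (hl : l ∈ Psigma β)
    (ham : a.Coprime m) (hbl : b.Coprime l) (e : a ^ α * m = b ^ α * l) : a = b ∧ m = l := by
  have key : ∀ {a m : ℕ}, Squarefree a → m ∈ Psigma β → a.Coprime m → ∀ p, p.Prime →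
      (p ∣ a ↔ (a ^ α * m).factorization p = α) := by
    intro a m ha hm ham p hp
    rw [Nat.factorization_mul (pow_ne_zero _ ha.ne_zero) (pos_of_mem_Psigma hm).ne',
      Nat.factorization_pow, Finsupp.add_apply, Finsupp.smul_apply, smul_eq_mul]
    constructor
    · intro hpa
      have h1 : a.factorization p = 1 := le_antisymm (ha.natFactorization_le_one p)
        ((hp.dvd_iff_one_le_factorization ha.ne_zero).mp hpa)
      have h2 : m.factorization p = 0 := Nat.factorization_eq_zero_of_not_dvd fun hpm =>
        Nat.not_coprime_of_dvd_of_dvd hp.one_lt hpa hpm ham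
      rw [h1, h2]; omega
    · intro hv
      by_contra hpa
      rw [Nat.factorization_eq_zero_of_not_dvd hpa] at hv
      have hpm : p ∣ m := by
        by_contra hpm
        rw [Nat.factorization_eq_zero_of_not_dvd hpm] at hv
        omega
      have := lt_factorization_of_mem_Psigma h hm hp hpm
      omega
  have hab : a = b := (Nat.Squarefree.ext_iff ha hb).mpr fun p hp => by
    rw [key ha hm ham p hp, key hb hl hbl p hp, e]
  subst hab
  exact ⟨rfl, Nat.eq_of_mul_eq_mul_left (pow_pos ha.ne_zero.bot_lt _) e⟩

end PrimeProducts

section AlmostPrimes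

open ArithmeticFunction hiding log

/-- The positive integers up to `z` with exactly `k` prime factors counted with multiplicity. -/
noncomputable def almostPrimes (k : ℕ) (z : ℝ) : Finset ℕ :=
  (Finset.Icc 1 ⌊z⌋₊).filter fun a => cardFactors a = k

lemma mem_almostPrimes {k : ℕ} {z : ℝ} {a : ℕ} :
    a ∈ almostPrimes k z ↔ a ≠ 0 ∧ (a : ℝ) ≤ z ∧ cardFactors a = k := by
  rw [almostPrimes, Finset.mem_filter, Finset.mem_Icc]
  constructor
  · rintro ⟨⟨h1, h2⟩, h3⟩
    have h0 : a ≠ 0 := by omega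
    exact ⟨h0, (Nat.le_floor_iff' h0).mp h2, h3⟩
  · rintro ⟨h0, h2, h3⟩
    exact ⟨⟨by omega, (Nat.le_floor_iff' h0).mpr h2⟩, h3⟩

lemma sum_almostPrimes_tupleCount (k : ℕ) (z : ℝ) :
    ∑ a ∈ almostPrimes k z, (tupleCount k a : ℝ) = tupleSum k z := by
  rw [tupleSum, almostPrimes]
  refine Finset.sum_filter_of_ne fun a ha h => ?_
  rw [Finset.mem_Icc] at ha
  exact cardFactors_of_tupleCount_ne_zero (by omega) (by exact_mod_cast h)

lemma card_almostPrimes_le (k : ℕ) (z : ℝ) : ((almostPrimes k z).card : ℝ) ≤ tupleSum k z := by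
  rw [← sum_almostPrimes_tupleCount, Finset.card_eq_sum_ones, Nat.cast_sum]
  refine Finset.sum_le_sum fun a ha => ?_
  obtain ⟨h0, -, h⟩ := mem_almostPrimes.mp ha
  exact_mod_cast one_le_tupleCount h0 h

lemma tupleSum_le_factorial_mul_card (k : ℕ) (z : ℝ) :
    tupleSum k z ≤ k.factorial * (almostPrimes k z).card := by
  rw [← sum_almostPrimes_tupleCount, mul_comm, ← nsmul_eq_mul]
  refine Finset.sum_le_card_nsmul _ _ _ fun a ha => ?_
  exact_mod_cast tupleCount_le_factorial k (mem_almostPrimes.mp ha).1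

lemma factorial_mul_card_filter_squarefree_le (k : ℕ) (z : ℝ) :
    (k.factorial : ℝ) * ((almostPrimes k z).filter Squarefree).card ≤ tupleSum k z := by
  rw [← sum_almostPrimes_tupleCount, mul_comm, ← nsmul_eq_mul, ← Finset.sum_const]
  calc _ = ∑ a ∈ (almostPrimes k z).filter Squarefree, (tupleCount k a : ℝ) := by
        refine Finset.sum_congr rfl fun a ha => ?_
        obtain ⟨h1, h2⟩ := Finset.mem_filter.mp ha
        rw [tupleCount_of_squarefree h2 (mem_almostPrimes.mp h1).2.2]
    _ ≤ _ := Finset.sum_le_sum_of_subset_of_nonneg (Finset.filter_subset _ _)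
        fun _ _ _ => by positivity

lemma div_mem_almostPrimes {k : ℕ} {z : ℝ} {a q : ℕ} (ha : a ∈ almostPrimes (k + 1) z)
    (hq : q.Prime) (hqa : q ∣ a) : a / q ∈ almostPrimes k (z / q) := by
  obtain ⟨h0, hz, hΩ⟩ := mem_almostPrimes.mp ha
  rw [cardFactors_div_prime h0 hq hqa] at hΩ
  have hq0 : (0 : ℝ) < q := by exact_mod_cast hq.pos
  refine mem_almostPrimes.mpr
    ⟨(Nat.div_ne_zero_iff_of_dvd hqa).mpr ⟨h0, hq.ne_zero⟩, ?_, by omega⟩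
  rw [Nat.cast_div hqa hq0.ne']
  gcongr

/-- The number of non-squarefree integers up to `z` with exactly `k` prime factors. -/
noncomputable def nonSquarefreeCount (k : ℕ) (z : ℝ) : ℝ :=
  ((almostPrimes k z).filter fun a => ¬ Squarefree a).card

lemma almostPrimes_eq_empty (k : ℕ) {z : ℝ} (hz : z < 1) : almostPrimes k z = ∅ := by
  rw [almostPrimes, Nat.floor_eq_zero.mpr hz]; simp

lemma nonSquarefreeCount_eq_zero (k : ℕ) {z : ℝ} (hz : z < 1) : nonSquarefreeCount k z = 0 := by
  rw [nonSquarefreeCount, almostPrimes_eq_empty k hz]; simp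

lemma nonSquarefreeCount_le_sum (K : ℕ) (z : ℝ) :
    nonSquarefreeCount (K + 2) z ≤ ∑ q ∈ Nat.primesLE ⌊z⌋₊, tupleSum K (z / (q : ℝ) ^ 2) := by
  have hsub : ((almostPrimes (K + 2) z).filter fun a => ¬ Squarefree a) ⊆
      (Nat.primesLE ⌊z⌋₊).biUnion fun q =>
        (almostPrimes K (z / (q : ℝ) ^ 2)).image fun b => q * (q * b) := by
    intro a ha
    obtain ⟨ha, hns⟩ := Finset.mem_filter.mp ha
    rw [Nat.squarefree_iff_prime_squarefree] at hns
    push Not at hns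
    obtain ⟨q, hq, hqa⟩ := hns
    have hd1 : q ∣ a := (dvd_mul_right q q).trans hqa
    have hd2 : q ∣ a / q := by
      obtain ⟨c, rfl⟩ := hqa
      rw [mul_assoc, Nat.mul_div_cancel_left _ hq.pos]
      exact dvd_mul_right _ _
    have h1 := div_mem_almostPrimes (div_mem_almostPrimes ha hq hd1) hq hd2
    obtain ⟨h0, hz, -⟩ := mem_almostPrimes.mp ha
    refine Finset.mem_biUnion.mpr ⟨q, mem_primesLE_floor.mpr ⟨hq, ?_⟩,
      Finset.mem_image.mpr ⟨a / q / q, ?_, ?_⟩⟩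
    · exact le_trans (by exact_mod_cast Nat.le_of_dvd h0.bot_lt hd1) hz
    · rwa [div_div, ← sq] at h1
    · rw [Nat.mul_div_cancel' hd2, Nat.mul_div_cancel' hd1]
  have h1 : ((almostPrimes (K + 2) z).filter fun a => ¬ Squarefree a).card ≤
      ∑ q ∈ Nat.primesLE ⌊z⌋₊, (almostPrimes K (z / (q : ℝ) ^ 2)).card :=
    (Finset.card_le_card hsub).trans (Finset.card_biUnion_le.trans
      (Finset.sum_le_sum fun q _ => Finset.card_image_le))
  calc nonSquarefreeCount (K + 2) z ≤
        ((∑ q ∈ Nat.primesLE ⌊z⌋₊, (almostPrimes K (z / (q : ℝ) ^ 2)).card : ℕ) : ℝ) := by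
        unfold nonSquarefreeCount; exact_mod_cast h1
    _ ≤ _ := by
        rw [Nat.cast_sum]
        exact Finset.sum_le_sum fun q _ => card_almostPrimes_le _ _

lemma card_filter_not_coprime_le (k : ℕ) {z : ℝ} (hz : 0 ≤ z) {m : ℕ} (hm : m ≠ 0) :
    (((almostPrimes (k + 1) z).filter fun a => ¬ a.Coprime m).card : ℝ) ≤
      m.primeFactors.card * tupleSum k z := by
  have hsub : ((almostPrimes (k + 1) z).filter fun a => ¬ a.Coprime m) ⊆
      m.primeFactors.biUnion fun q => (almostPrimes k (z / q)).image fun b => q * b := by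
    intro a ha
    obtain ⟨ha, hc⟩ := Finset.mem_filter.mp ha
    obtain ⟨q, hq, hqa, hqm⟩ := Nat.Prime.not_coprime_iff_dvd.mp hc
    exact Finset.mem_biUnion.mpr ⟨q, Nat.mem_primeFactors.mpr ⟨hq, hqm, hm⟩,
      Finset.mem_image.mpr ⟨a / q, div_mem_almostPrimes ha hq hqa, Nat.mul_div_cancel' hqa⟩⟩
  have h1 : ((almostPrimes (k + 1) z).filter fun a => ¬ a.Coprime m).card ≤
      ∑ q ∈ m.primeFactors, (almostPrimes k (z / q)).card :=
    (Finset.card_le_card hsub).trans (Finset.card_biUnion_le.trans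
      (Finset.sum_le_sum fun q _ => Finset.card_image_le))
  calc _ ≤ ((∑ q ∈ m.primeFactors, (almostPrimes k (z / q)).card : ℕ) : ℝ) := by
        exact_mod_cast h1
    _ ≤ ∑ q ∈ m.primeFactors, tupleSum k z := by
        rw [Nat.cast_sum]
        refine Finset.sum_le_sum fun q hq => (card_almostPrimes_le _ _).trans (tupleSum_mono _ ?_)
        exact div_le_self hz (by exact_mod_cast (Nat.prime_of_mem_primeFactors hq).one_le)
    _ = _ := by rw [Finset.sum_const, nsmul_eq_mul]

lemma exists_nonSquarefreeCount_le (K : ℕ) : ∃ C : ℝ, 0 < C ∧ ∀ z : ℝ, 1 ≤ z →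
    nonSquarefreeCount (K + 2) z ≤ C * errScale K z := by
  obtain ⟨C, hC, h⟩ := exists_tupleSum_le K
  have hs : Summable fun n : ℕ => (n : ℝ) ^ (-(3 / 2) : ℝ) :=
    Real.summable_nat_rpow.mpr (by norm_num)
  have hS : 0 ≤ ∑' n : ℕ, (n : ℝ) ^ (-(3 / 2) : ℝ) := tsum_nonneg fun _ => by positivity
  refine ⟨C * 4 * (∑' n : ℕ, (n : ℝ) ^ (-(3 / 2) : ℝ) + 1), by positivity, fun z hz => ?_⟩
  have hB := errScale_pos K hz
  calc _ ≤ ∑ q ∈ Nat.primesLE ⌊z⌋₊, tupleSum K (z / (q : ℝ) ^ 2) := nonSquarefreeCount_le_sum K z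
    _ ≤ ∑ q ∈ Nat.primesLE ⌊z⌋₊, C * errScale K z * 4 * (q : ℝ) ^ (-(3 / 2) : ℝ) := by
        refine Finset.sum_le_sum fun q hq => ?_
        have hq1 : (1 : ℝ) ≤ q := by exact_mod_cast (mem_primesLE_floor.mp hq).1.one_le
        have hq0 : (0 : ℝ) < q := by linarith
        have hq2 : (1 : ℝ) ≤ (q : ℝ) ^ 2 := one_le_pow₀ hq1
        refine (le_errScale_mul_of_le hC.le h (fun x hx => tupleSum_eq_zero K hx) hz hq2).trans ?_
        rw [mul_assoc _ (4 : ℝ)]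
        gcongr
        have h1 := ell_sq_le hq2
        rw [sqrt_sq hq0.le] at h1
        have h2 : ell ((q : ℝ) ^ 2) ≤ 4 * √(q : ℝ) := by
          refine le_of_sq_le_sq ?_ (by positivity)
          rw [mul_pow, sq_sqrt hq0.le]; linarith
        have h3 : (q : ℝ) ^ (-(3 / 2) : ℝ) = √(q : ℝ) / (q : ℝ) ^ 2 := by
          rw [sqrt_eq_rpow, ← rpow_natCast, ← rpow_sub hq0]; norm_num
        rw [h3, ← mul_div_assoc]
        gcongr
    _ = C * 4 * (∑ q ∈ Nat.primesLE ⌊z⌋₊, (q : ℝ) ^ (-(3 / 2) : ℝ)) * errScale K z := by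
        rw [Finset.mul_sum, Finset.sum_mul]
        exact Finset.sum_congr rfl fun _ _ => by ring
    _ ≤ _ := by
        gcongr
        have := hs.sum_le_tsum (Nat.primesLE ⌊z⌋₊) fun _ _ => by positivity
        linarith

end AlmostPrimes

section Counting

open ArithmeticFunction hiding log

variable {k r α : ℕ} {β : Fin r → ℕ}

lemma pow_mul_le_iff (hα : 0 < α) {x : ℝ} (hx : 0 ≤ x) {a m : ℕ} (hm : 0 < m) :
    ((a ^ α * m : ℕ) : ℝ) ≤ x ↔ (a : ℝ) ≤ x ^ ((1 : ℝ) / α) / (m : ℝ) ^ ((1 : ℝ) / α) := by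
  have hm0 : (0 : ℝ) < m := by exact_mod_cast hm
  have hμ : (0 : ℝ) < (m : ℝ) ^ ((1 : ℝ) / α) := by positivity
  rw [le_div_iff₀ hμ, ← pow_le_pow_iff_left₀ (a := (a : ℝ) * (m : ℝ) ^ ((1 : ℝ) / α))
    (by positivity) (by positivity) hα.ne', mul_pow,
    one_div, rpow_inv_natCast_pow hx hα.ne', rpow_inv_natCast_pow hm0.le hα.ne']
  push_cast
  rfl

lemma finite_setOf_le_and_mem (S : Set ℕ) (x : ℝ) : {n : ℕ | (n : ℝ) ≤ x ∧ n ∈ S}.Finite :=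
  (Set.finite_Iic ⌊x⌋₊).subset fun _ hn => Nat.le_floor hn.1

open Classical in
/-- The elements of `Psigma β` up to `x`. -/
noncomputable def psigmaLE (β : Fin r → ℕ) (x : ℝ) : Finset (Psigma β) :=
  (Finset.Icc 1 ⌊x⌋₊).subtype fun m => m ∈ Psigma β

lemma mem_psigmaLE {x : ℝ} {m : Psigma β} : m ∈ psigmaLE β x ↔ ((m : ℕ) : ℝ) ≤ x := by
  classical
  have h0 := pos_of_mem_Psigma m.2
  rw [psigmaLE, Finset.mem_subtype, Finset.mem_Icc, Nat.le_floor_iff' h0.ne']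
  exact ⟨fun h => h.2, fun h => ⟨h0, h⟩⟩

lemma mem_psigmaLE_of_pow_mul_le {x : ℝ} {a : ℕ} (ha : a ≠ 0) {m : Psigma β}
    (h : ((a ^ α * m : ℕ) : ℝ) ≤ x) : m ∈ psigmaLE β x := by
  refine mem_psigmaLE.mpr (le_trans ?_ h)
  exact_mod_cast Nat.le_mul_of_pos_left _ (pow_pos ha.bot_lt _)

lemma countIn_le_sum (hα : 0 < α) {x : ℝ} (hx : 0 ≤ x) :
    countIn (Psigma (Fin.append (fun _ : Fin k => α) β)) x ≤ ∑ m ∈ psigmaLE β x,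
      (almostPrimes k (x ^ ((1 : ℝ) / α) / ((m : ℕ) : ℝ) ^ ((1 : ℝ) / α))).card := by
  rw [countIn, Nat.card_coe_set_eq]
  calc _ ≤ (((psigmaLE β x).biUnion fun m =>
        (almostPrimes k (x ^ ((1 : ℝ) / α) / ((m : ℕ) : ℝ) ^ ((1 : ℝ) / α))).image
          fun a => a ^ α * (m : ℕ) : Finset ℕ) : Set ℕ).ncard := by
        refine Set.ncard_le_ncard (fun n hn => ?_) (Finset.finite_toSet _)
        obtain ⟨hnx, hn⟩ := hn
        obtain ⟨a, m, ha, hΩ, hm, rfl⟩ := mem_Psigma_append_iff.mp hn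
        rw [Finset.mem_coe]
        exact Finset.mem_biUnion.mpr ⟨⟨m, hm⟩, mem_psigmaLE_of_pow_mul_le ha hnx,
          Finset.mem_image.mpr ⟨a, mem_almostPrimes.mpr
            ⟨ha, (pow_mul_le_iff hα hx (pos_of_mem_Psigma hm)).mp hnx, hΩ⟩, rfl⟩⟩
    _ ≤ _ := by
        rw [Set.ncard_coe_finset]
        exact Finset.card_biUnion_le.trans (Finset.sum_le_sum fun m _ => Finset.card_image_le)

lemma sum_le_countIn (hα : 0 < α) (h : ∀ i, α < β i) {x : ℝ} (hx : 0 ≤ x) :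
    ∑ m ∈ psigmaLE β x,
      ((almostPrimes k (x ^ ((1 : ℝ) / α) / ((m : ℕ) : ℝ) ^ ((1 : ℝ) / α))).filter
        fun a => Squarefree a ∧ a.Coprime m).card ≤
      countIn (Psigma (Fin.append (fun _ : Fin k => α) β)) x := by
  rw [countIn, Nat.card_coe_set_eq, ← Finset.card_sigma]
  rw [← Set.ncard_coe_finset]
  refine Set.ncard_le_ncard_of_injOn (fun b => b.2 ^ α * (b.1 : ℕ)) ?_ ?_
    (finite_setOf_le_and_mem _ x)
  · rintro ⟨m, a⟩ hb
    simp only [Finset.coe_sigma, Set.mem_sigma_iff, Finset.mem_coe, Finset.mem_filter] at hb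
    obtain ⟨ha0, haz, hΩ⟩ := mem_almostPrimes.mp hb.2.1
    exact ⟨(pow_mul_le_iff hα hx (pos_of_mem_Psigma m.2)).mpr haz,
      mem_Psigma_append_iff.mpr ⟨a, m, ha0, hΩ, m.2, rfl⟩⟩
  · rintro ⟨m, a⟩ hb ⟨l, b⟩ hc e
    simp only [Finset.coe_sigma, Set.mem_sigma_iff, Finset.mem_coe, Finset.mem_filter] at hb hc
    obtain ⟨rfl, hml⟩ := pow_mul_injective hα h hb.2.2.1 hc.2.2.1 m.2 l.2 hb.2.2.2 hc.2.2.2 e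
    obtain rfl := Subtype.ext hml
    rfl

lemma factorial_mul_card_almostPrimes_le (k : ℕ) (z : ℝ) :
    (k.factorial : ℝ) * (almostPrimes k z).card ≤
      tupleSum k z + k.factorial * nonSquarefreeCount k z := by
  have h1 := factorial_mul_card_filter_squarefree_le k z
  have h2 : (((almostPrimes k z).filter Squarefree).card : ℝ) + nonSquarefreeCount k z =
      (almostPrimes k z).card := by
    unfold nonSquarefreeCount
    exact_mod_cast Finset.card_filter_add_card_filter_not _
  rw [← h2]
  linarith

lemma tupleSum_sub_le_card_filter (K : ℕ) {z : ℝ} (hz : 0 ≤ z) {m : ℕ} (hm : m ∈ Psigma β) :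
    tupleSum (K + 2) z - (K + 2).factorial *
      (nonSquarefreeCount (K + 2) z + r * tupleSum (K + 1) z) ≤
      (K + 2).factorial * ((almostPrimes (K + 2) z).filter
        fun a => Squarefree a ∧ a.Coprime m).card := by
  have h1 := tupleSum_le_factorial_mul_card (K + 2) z
  have h2 : (((almostPrimes (K + 2) z).filter fun a => ¬ a.Coprime m).card : ℝ) ≤
      r * tupleSum (K + 1) z := by
    refine (card_filter_not_coprime_le (K + 1) hz (pos_of_mem_Psigma hm).ne').trans ?_
    have := tupleSum_nonneg (K + 1) z
    gcongr
    exact card_primeFactors_le_of_mem_Psigma hm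
  have h3 : (almostPrimes (K + 2) z).card ≤
      ((almostPrimes (K + 2) z).filter fun a => Squarefree a ∧ a.Coprime m).card +
      (((almostPrimes (K + 2) z).filter fun a => ¬ Squarefree a).card +
        ((almostPrimes (K + 2) z).filter fun a => ¬ a.Coprime m).card) := by
    refine (Finset.card_le_card fun a ha => ?_).trans ((Finset.card_union_le _ _).trans
      (Nat.add_le_add_left (Finset.card_union_le _ _) _))
    simp only [Finset.mem_union, Finset.mem_filter, ha, true_and]
    tauto
  have h4 : ((almostPrimes (K + 2) z).card : ℝ) ≤
      ((almostPrimes (K + 2) z).filter fun a => Squarefree a ∧ a.Coprime m).card +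
        (nonSquarefreeCount (K + 2) z + r * tupleSum (K + 1) z) := by
    have h5 : ((almostPrimes (K + 2) z).card : ℝ) ≤
        ((almostPrimes (K + 2) z).filter fun a => Squarefree a ∧ a.Coprime m).card +
        (((almostPrimes (K + 2) z).filter fun a => ¬ Squarefree a).card +
        ((almostPrimes (K + 2) z).filter fun a => ¬ a.Coprime m).card) := by exact_mod_cast h3
    unfold nonSquarefreeCount
    linarith
  have h6 := mul_le_mul_of_nonneg_left h4 (Nat.cast_nonneg (α := ℝ) (K + 2).factorial)
  linarith

/-- Counting products of prime powers through weighted sums over almost primes. -/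
lemma exists_abs_countIn_sub_tsum_le (K : ℕ) (hα : 0 < α) (h : ∀ i, α < β i) :
    ∃ C : ℝ, 0 < C ∧ ∀ x : ℝ, 1 ≤ x →
      |((K + 2).factorial : ℝ) *
          countIn (Psigma (Fin.append (fun _ : Fin (K + 2) => α) β)) x -
        ∑' m : Psigma β, tupleSum (K + 2)
          (x ^ ((1 : ℝ) / α) / ((m : ℕ) : ℝ) ^ ((1 : ℝ) / α))| ≤
        C * errScale K (x ^ ((1 : ℝ) / α)) := by
  obtain ⟨A, hA, hns⟩ := exists_nonSquarefreeCount_le K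
  obtain ⟨B, hB, hT⟩ := exists_tupleSum_succ_le K
  have hsum := summable_Psigma_ell_div hα h
  set S := ∑' m : Psigma β,
    ell (((m : ℕ) : ℝ) ^ ((1 : ℝ) / α)) / ((m : ℕ) : ℝ) ^ ((1 : ℝ) / α) with hS
  have hnn : ∀ m : Psigma β,
      0 ≤ ell (((m : ℕ) : ℝ) ^ ((1 : ℝ) / α)) / ((m : ℕ) : ℝ) ^ ((1 : ℝ) / α) := fun m => by
    have h1 := one_le_rpow_of_mem_Psigma m α
    have := ell_pos h1
    positivity
  have hS0 : 0 ≤ S := tsum_nonneg hnn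
  refine ⟨(K + 2).factorial * (A + r * B) * (S + 1), by positivity, fun x hx => ?_⟩
  set y := x ^ ((1 : ℝ) / α) with hy
  have hy1 : 1 ≤ y := one_le_rpow hx (by positivity)
  have hE := errScale_pos K hy1
  set R : Psigma β → ℝ := fun m => (K + 2).factorial *
    (nonSquarefreeCount (K + 2) (y / ((m : ℕ) : ℝ) ^ ((1 : ℝ) / α)) +
      r * tupleSum (K + 1) (y / ((m : ℕ) : ℝ) ^ ((1 : ℝ) / α))) with hR
  have hRle : ∑ m ∈ psigmaLE β x, R m ≤
      (K + 2).factorial * (A + r * B) * (S + 1) * errScale K y := by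
    calc _ ≤ ∑ m ∈ psigmaLE β x, (K + 2).factorial * (A + r * B) * errScale K y *
          (ell (((m : ℕ) : ℝ) ^ ((1 : ℝ) / α)) / ((m : ℕ) : ℝ) ^ ((1 : ℝ) / α)) := by
          refine Finset.sum_le_sum fun m _ => ?_
          have h1 := one_le_rpow_of_mem_Psigma m α
          have h2 := le_errScale_mul_of_le hA.le hns
            (fun x hx => nonSquarefreeCount_eq_zero _ hx) hy1 h1
          have h3 := le_errScale_mul_of_le hB.le hT (fun x hx => tupleSum_eq_zero _ hx) hy1 h1
          calc R m ≤ (K + 2).factorial * (A * errScale K y * (ell (((m : ℕ) : ℝ) ^ ((1 : ℝ) / α)) /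
                ((m : ℕ) : ℝ) ^ ((1 : ℝ) / α)) + r * (B * errScale K y *
                (ell (((m : ℕ) : ℝ) ^ ((1 : ℝ) / α)) / ((m : ℕ) : ℝ) ^ ((1 : ℝ) / α)))) := by
                rw [hR]
                refine mul_le_mul_of_nonneg_left (add_le_add h2 ?_) (by positivity)
                exact mul_le_mul_of_nonneg_left h3 (by positivity)
            _ = _ := by ring
      _ ≤ (K + 2).factorial * (A + r * B) * errScale K y * S := by
          rw [← Finset.mul_sum]
          refine mul_le_mul_of_nonneg_left ?_ (by positivity)
          exact hsum.sum_le_tsum _ fun m _ => hnn m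
      _ ≤ _ := by
          have : 0 ≤ (K + 2).factorial * (A + r * B) * errScale K y := by positivity
          nlinarith
  have htsum : ∑' m : Psigma β, tupleSum (K + 2) (y / ((m : ℕ) : ℝ) ^ ((1 : ℝ) / α)) =
      ∑ m ∈ psigmaLE β x, tupleSum (K + 2) (y / ((m : ℕ) : ℝ) ^ ((1 : ℝ) / α)) := by
    refine tsum_eq_sum fun m hm => tupleSum_eq_zero _ ?_
    rw [mem_psigmaLE, not_le] at hm
    have h1 := one_le_rpow_of_mem_Psigma m α
    rw [div_lt_one (by linarith)]
    have hα0 : (0 : ℝ) < α := by exact_mod_cast hα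
    exact rpow_lt_rpow (by linarith) hm (by positivity)
  have hup : ((K + 2).factorial : ℝ) *
      countIn (Psigma (Fin.append (fun _ : Fin (K + 2) => α) β)) x ≤
      ∑ m ∈ psigmaLE β x, tupleSum (K + 2) (y / ((m : ℕ) : ℝ) ^ ((1 : ℝ) / α)) +
        ∑ m ∈ psigmaLE β x, R m := by
    have h1 := countIn_le_sum (k := K + 2) (β := β) hα (show 0 ≤ x by linarith)
    have h2 : (countIn (Psigma (Fin.append (fun _ : Fin (K + 2) => α) β)) x : ℝ) ≤
        ∑ m ∈ psigmaLE β x,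
          ((almostPrimes (K + 2) (y / ((m : ℕ) : ℝ) ^ ((1 : ℝ) / α))).card : ℝ) := by
      exact_mod_cast h1
    calc _ ≤ ((K + 2).factorial : ℝ) * ∑ m ∈ psigmaLE β x,
          ((almostPrimes (K + 2) (y / ((m : ℕ) : ℝ) ^ ((1 : ℝ) / α))).card : ℝ) := by gcongr
      _ ≤ _ := by
        rw [Finset.mul_sum, ← Finset.sum_add_distrib]
        refine Finset.sum_le_sum fun m _ => (factorial_mul_card_almostPrimes_le _ _).trans ?_
        rw [hR]
        have h3 : 0 ≤ ((K + 2).factorial : ℝ) *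
            (r * tupleSum (K + 1) (y / ((m : ℕ) : ℝ) ^ ((1 : ℝ) / α))) :=
          mul_nonneg (by positivity) (mul_nonneg (by positivity) (tupleSum_nonneg _ _))
        linarith
  have hlow : ∑ m ∈ psigmaLE β x, tupleSum (K + 2) (y / ((m : ℕ) : ℝ) ^ ((1 : ℝ) / α)) -
      ∑ m ∈ psigmaLE β x, R m ≤ ((K + 2).factorial : ℝ) *
        countIn (Psigma (Fin.append (fun _ : Fin (K + 2) => α) β)) x := by
    have h1 := sum_le_countIn (k := K + 2) hα h (show 0 ≤ x by linarith)
    rw [← hy] at h1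
    rw [← Finset.sum_sub_distrib]
    calc _ ≤ ∑ m ∈ psigmaLE β x, ((K + 2).factorial : ℝ) *
          (((almostPrimes (K + 2) (y / ((m : ℕ) : ℝ) ^ ((1 : ℝ) / α))).filter
            fun a => Squarefree a ∧ a.Coprime m).card : ℝ) := by
          refine Finset.sum_le_sum fun m _ => tupleSum_sub_le_card_filter K ?_ m.2
          positivity
      _ ≤ _ := by
          rw [← Finset.mul_sum]
          gcongr
          exact_mod_cast h1
  rw [htsum, abs_le]
  constructor <;> linarith

lemma exists_abs_countIn_sub_le (K : ℕ) (hα : 0 < α) (h : ∀ i, α < β i) :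
    ∃ C : ℝ, 0 < C ∧ ∀ x : ℝ, 1 ≤ x →
      |((K + 2).factorial : ℝ) *
          countIn (Psigma (Fin.append (fun _ : Fin (K + 2) => α) β)) x -
        (K + 2) * errScale (K + 1) (x ^ ((1 : ℝ) / α)) *
          ∑' m : Psigma β, ((m : ℕ) : ℝ) ^ (-(1 : ℝ) / α)| ≤
        C * errScale K (x ^ ((1 : ℝ) / α)) := by
  obtain ⟨A, hA, hcount⟩ := exists_abs_countIn_sub_tsum_le K hα h
  obtain ⟨B, hB, hT⟩ := exists_abs_tupleSum_div_sub_le K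
  have hsum := summable_Psigma_ell_div hα h
  set S := ∑' m : Psigma β,
    ell (((m : ℕ) : ℝ) ^ ((1 : ℝ) / α)) / ((m : ℕ) : ℝ) ^ ((1 : ℝ) / α) with hS
  have hS0 : 0 ≤ S := tsum_nonneg fun m => by
    have h1 := one_le_rpow_of_mem_Psigma m α
    have := ell_pos h1
    positivity
  have hα0 : (0 : ℝ) < α := by exact_mod_cast hα
  have hmain : Summable fun m : Psigma β => ((m : ℕ) : ℝ) ^ (-(1 : ℝ) / α) := by
    rw [neg_div]
    refine summable_Psigma_rpow fun i => ?_
    have : (α : ℝ) < β i := by exact_mod_cast h i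
    rw [mul_one_div, one_lt_div hα0]
    exact this
  refine ⟨A + B * S, by positivity, fun x hx => ?_⟩
  have hc := hcount x hx
  set y := x ^ ((1 : ℝ) / α) with hy
  have hy1 : 1 ≤ y := one_le_rpow hx (by positivity)
  have hterm : ∀ m : Psigma β,
      ‖tupleSum (K + 2) (y / ((m : ℕ) : ℝ) ^ ((1 : ℝ) / α)) -
        (K + 2) * errScale (K + 1) y * ((m : ℕ) : ℝ) ^ (-(1 : ℝ) / α)‖ ≤
      B * errScale K y *
        (ell (((m : ℕ) : ℝ) ^ ((1 : ℝ) / α)) / ((m : ℕ) : ℝ) ^ ((1 : ℝ) / α)) := fun m => by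
    have h1 := hT y _ hy1 (one_le_rpow_of_mem_Psigma m α)
    rw [norm_eq_abs, neg_div, rpow_neg (by positivity), ← div_eq_mul_inv]
    exact h1
  have hdom := hsum.mul_left (B * errScale K y)
  have hdiff := Summable.of_norm_bounded hdom hterm
  have hTs : Summable fun m : Psigma β =>
      tupleSum (K + 2) (y / ((m : ℕ) : ℝ) ^ ((1 : ℝ) / α)) := by
    refine (hdiff.add (hmain.mul_left ((K + 2) * errScale (K + 1) y))).congr fun m => ?_
    ring
  have hbd := tsum_of_norm_bounded hdom.hasSum hterm
  rw [hTs.tsum_sub (hmain.mul_left _), tsum_mul_left, tsum_mul_left, norm_eq_abs, ← hS] at hbd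
  refine (abs_sub_le _ _ _).trans ((add_le_add hc hbd).trans_eq ?_)
  ring

end Counting

section Normalisation

lemma exists_errScale_rpow_bounds (K : ℕ) {α : ℕ} (hα : 0 < α) : ∃ C : ℝ, 0 < C ∧
    ∀ x : ℝ, 1 ≤ x → 1 ≤ log x → 1 ≤ log (log x) →
      errScale K (x ^ ((1 : ℝ) / α)) ≤ C * (x ^ ((1 : ℝ) / α) * log (log x) ^ K / log x) ∧
      |errScale (K + 1) (x ^ ((1 : ℝ) / α)) -
          α * x ^ ((1 : ℝ) / α) * log (log x) ^ (K + 1) / log x| ≤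
        C * (x ^ ((1 : ℝ) / α) * log (log x) ^ K / log x) := by
  have hα1 : (1 : ℝ) ≤ α := by exact_mod_cast hα
  have hα0 : (0 : ℝ) < α := by linarith
  have hlα : 0 ≤ log α := log_nonneg hα1
  set c : ℝ := 2 + log α with hc
  have hc0 : 0 < c := by positivity
  refine ⟨(1 + c) ^ K * α + (c * (K + 1) * (1 + c) ^ K * α + α ^ 2), by positivity,
    fun x hx hl hL => ?_⟩
  set y := x ^ ((1 : ℝ) / α) with hy
  set l := log x with hldef
  set L := log l with hLdef
  have hy1 : 1 ≤ y := one_le_rpow hx (by positivity)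
  have hy0 : 0 < y := by linarith
  have hl0 : 0 < l := by linarith
  have hL0 : 0 < L := by linarith
  have hLl : L ≤ l := (log_le_sub_one_of_pos hl0).trans (by linarith)
  have hell : ell y = (α + l) / α := by
    rw [ell, hy, log_rpow (by linarith), ← hldef]; field_simp
  have hely := ell_pos hy1
  have hLy := logEll_pos hy1
  have hinv : 1 / ell y = α / (α + l) := by rw [hell, one_div_div]
  have hinv1 : 1 / ell y ≤ α / l := by
    rw [hinv]; gcongr; linarith
  have hinv2 : |1 / ell y - α / l| ≤ α ^ 2 / l ^ 2 := by
    have e : α / l - 1 / ell y = α ^ 2 / (l * (α + l)) := by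
      rw [hinv]; field_simp; ring
    rw [abs_sub_comm, e, abs_of_pos (by positivity), sq l]
    gcongr
    linarith
  have hlog : |logEll y - L| ≤ c := by
    have h1 : log (ell y) ≤ log 2 + L := by
      rw [← log_mul two_ne_zero hl0.ne']
      refine log_le_log hely ?_
      rw [hell, div_le_iff₀ hα0]
      nlinarith
    have h2 : L - log α ≤ log (ell y) := by
      rw [← log_div hl0.ne' hα0.ne', hell]
      refine log_le_log (by positivity) ?_
      gcongr; linarith
    have h3 : log 2 ≤ 1 := by linarith [log_le_sub_one_of_pos (show (0 : ℝ) < 2 by norm_num)]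
    unfold logEll
    rw [abs_le]; constructor <;> linarith
  have hle : logEll y ≤ (1 + c) * L := by
    have := (abs_le.mp hlog).2
    nlinarith
  have hmax : max |logEll y| |L| ≤ (1 + c) * L := by
    rw [abs_of_pos hLy, abs_of_pos hL0]
    exact max_le hle (by nlinarith)
  have hD : 0 ≤ y * L ^ K / l := by positivity
  constructor
  · calc errScale K y = y * logEll y ^ K * (1 / ell y) := by unfold errScale; ring
      _ ≤ y * ((1 + c) * L) ^ K * (α / l) :=
          mul_le_mul (by gcongr) hinv1 (by positivity) (by positivity)
      _ = (1 + c) ^ K * α * (y * L ^ K / l) := by rw [mul_pow]; ring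
      _ ≤ _ := by
          refine mul_le_mul_of_nonneg_right ?_ hD
          exact le_add_of_nonneg_right (by positivity)
  · have e : errScale (K + 1) y - α * y * L ^ (K + 1) / l =
        y * ((logEll y ^ (K + 1) - L ^ (K + 1)) * (1 / ell y) +
          L ^ (K + 1) * (1 / ell y - α / l)) := by
      unfold errScale; ring
    have h1 : |logEll y ^ (K + 1) - L ^ (K + 1)| ≤ c * (K + 1) * ((1 + c) * L) ^ K := by
      have := abs_pow_sub_pow_le (logEll y) L (K + 1)
      push_cast at this
      refine this.trans ?_
      gcongr
    have h2 : L ^ (K + 1) * (α ^ 2 / l ^ 2) ≤ α ^ 2 * (L ^ K / l) := by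
      calc _ ≤ L ^ K * l * (α ^ 2 / l ^ 2) := by rw [pow_succ]; gcongr
        _ = _ := by field_simp
    rw [e, abs_mul, abs_of_pos hy0]
    calc _ ≤ y * (|logEll y ^ (K + 1) - L ^ (K + 1)| * (1 / ell y) +
          L ^ (K + 1) * |1 / ell y - α / l|) := by
          gcongr
          refine (abs_add_le _ _).trans_eq ?_
          rw [abs_mul, abs_mul, abs_of_pos (show 0 < 1 / ell y by positivity),
            abs_of_pos (show 0 < L ^ (K + 1) by positivity)]
      _ ≤ y * (c * (K + 1) * ((1 + c) * L) ^ K * (α / l) + α ^ 2 * (L ^ K / l)) := by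
          refine mul_le_mul_of_nonneg_left (add_le_add ?_ ?_) hy0.le
          · exact mul_le_mul h1 hinv1 (by positivity) (by positivity)
          · exact (mul_le_mul_of_nonneg_left hinv2 (by positivity)).trans h2
      _ = (c * (K + 1) * (1 + c) ^ K * α + α ^ 2) * (y * L ^ K / l) := by
          rw [mul_pow]; ring
      _ ≤ _ := by
          refine mul_le_mul_of_nonneg_right ?_ hD
          exact le_add_of_nonneg_left (by positivity)

end Normalisation

/-- for `k > 1`,
`σ_α(x) = α x^{1/α} (log log x)^{k-1} / ((k-1)! log x) ⋅ ∑_{m ∈ 𝒫_β^σ} m^{-1/α}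
  + O(x^{1/α} (log log x)^{k-2} / log x)`. -/
theorem sigma_alpha_with_error_k_gt_one (k r α : ℕ) (hk : 1 < k) (hα : 0 < α)
    (β : Fin r → ℕ) (h : ∀ i, α < β i) :
    (fun x : ℝ =>
        (countIn (Psigma (Fin.append (fun _ : Fin k => α) β)) x : ℝ) -
          (α : ℝ) * x ^ ((1 : ℝ) / (α : ℝ)) * Real.log (Real.log x) ^ (k - 1) /
              ((k - 1).factorial * Real.log x) *
            ∑' m : Psigma β, ((m : ℕ) : ℝ) ^ (-(1 : ℝ) / (α : ℝ)))
      =O[atTop]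
      (fun x : ℝ =>
        x ^ ((1 : ℝ) / (α : ℝ)) * Real.log (Real.log x) ^ (k - 2) / Real.log x) := by
  obtain ⟨K, rfl⟩ : ∃ K, k = K + 2 := ⟨k - 2, by omega⟩
  obtain ⟨A, hA, hcount⟩ := exists_abs_countIn_sub_le K hα h
  obtain ⟨B, hB, hscale⟩ := exists_errScale_rpow_bounds K hα
  rw [show K + 2 - 1 = K + 1 by omega, show K + 2 - 2 = K by omega]
  set S := ∑' m : Psigma β, ((m : ℕ) : ℝ) ^ (-(1 : ℝ) / (α : ℝ)) with hS
  have hS0 : 0 ≤ S := tsum_nonneg fun m => by positivity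
  have hf : (0 : ℝ) < (K + 1).factorial := by positivity
  have hf2 : ((K + 2).factorial : ℝ) = (K + 2) * (K + 1).factorial := by
    rw [Nat.factorial_succ]; push_cast; ring
  have hKf : (1 : ℝ) ≤ (K + 2) * (K + 1).factorial := by
    rw [← hf2]; exact_mod_cast Nat.one_le_iff_ne_zero.mpr (Nat.factorial_ne_zero _)
  have hlog : Tendsto (fun x : ℝ => log (log x)) atTop atTop :=
    tendsto_log_atTop.comp tendsto_log_atTop
  refine IsBigO.of_bound (A * B + (K + 2) * (B * S)) ?_
  filter_upwards [eventually_ge_atTop 1, tendsto_log_atTop.eventually_ge_atTop 1,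
    hlog.eventually_ge_atTop 1] with x hx hl hL
  obtain ⟨h1, h2⟩ := hscale x hx hl hL
  have h3 := hcount x hx
  set y := x ^ ((1 : ℝ) / α) with hy
  set N := (countIn (Psigma (Fin.append (fun _ : Fin (K + 2) => α) β)) x : ℝ) with hN
  have hy0 : 0 ≤ y := by positivity
  have hD : 0 ≤ y * log (log x) ^ K / log x := by positivity
  have e : (K + 2) * (K + 1).factorial *
      (N - α * y * log (log x) ^ (K + 1) / ((K + 1).factorial * log x) * S) =
      ((K + 2).factorial * N - (K + 2) * errScale (K + 1) y * S) +
      (K + 2) * S * (errScale (K + 1) y - α * y * log (log x) ^ (K + 1) / log x) := by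
    rw [hf2]
    field_simp
    ring
  rw [norm_eq_abs, norm_eq_abs, abs_of_nonneg hD]
  calc _ ≤ |(K + 2) * (K + 1).factorial *
      (N - α * y * log (log x) ^ (K + 1) / ((K + 1).factorial * log x) * S)| := by
        rw [abs_mul, abs_of_pos (by linarith : (0 : ℝ) < (K + 2) * (K + 1).factorial)]
        exact le_mul_of_one_le_left (abs_nonneg _) hKf
    _ ≤ A * errScale K y + (K + 2) * S * (B * (y * log (log x) ^ K / log x)) := by
        rw [e]
        refine (abs_add_le _ _).trans (add_le_add h3 ?_)
        rw [abs_mul, abs_of_nonneg (show 0 ≤ (K + 2) * S by positivity)]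
        gcongr
    _ ≤ A * (B * (y * log (log x) ^ K / log x)) +
        (K + 2) * S * (B * (y * log (log x) ^ K / log x)) := by gcongr
    _ = _ := by ring
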